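/- Let $u$ be $\mathscr{L}_a$-parabolic in an open set containing the closure of the parabolic ball $\Omega_r(\xi_0)$, with $\xi_0=(X_0,t_0)$, $X_0=(x_0',x_0)$. Then the mean value formula holds: $u(\xi_0)=\varphi(r)^{-1}\int_{\Omega_r(\xi_0)}\frac{u(Y,t)\,|y|^a\,|\nabla_Y\Gamma(X_0,t_0;Y,t)|^2}{\Gamma(X_0,t_0;Y,t)^2}\,dY\,dt$, where $\varphi(r)=(4\pi r)^{(n+a)/2}(1+x_0^2/r)^{a/2}$. -/

import Mathlib

noncomputable section
open Real MeasureTheory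

/-- Partial derivative of `f : (Fin n → ℝ) → ℝ` in the `i`-th coordinate at `X`. -/
def pd {n : ℕ} (i : Fin n) (f : (Fin n → ℝ) → ℝ) (X : Fin n → ℝ) : ℝ :=
  deriv (fun s => f (Function.update X i s)) (X i)

/-- The Bessel-type profile `F(z)` with `ν = (a-1)/2`:
`F(z) = e^{-z/2} ( ∑_k (z/4)^{2k}/(k! Γ(k+ν+1)) + (z/4)|z/4|^{-a} ∑_k (z/4)^{2k}/(k! Γ(k-ν+1)) )`. -/
def Fker (a z : ℝ) : ℝ :=
  Real.exp (-z / 2) *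
    ((∑' k : ℕ, (z / 4) ^ (2 * k) / ((Nat.factorial k : ℝ) * Real.Gamma ((k : ℝ) + (a - 1) / 2 + 1))) +
      z / 4 * |z / 4| ^ (-a) *
        ∑' k : ℕ, (z / 4) ^ (2 * k) / ((Nat.factorial k : ℝ) * Real.Gamma ((k : ℝ) - (a - 1) / 2 + 1)))

/-- The one-dimensional degenerate heat kernel
`ũ(x,y,t) = (4t)^{-(a+1)/2} e^{-(x-y)²/(4t)} F(xy/t)`. -/
def utilde (a x y t : ℝ) : ℝ :=
  (4 * t) ^ (-(a + 1) / 2) * Real.exp (-(x - y) ^ 2 / (4 * t)) * Fker a (x * y / t)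
/-- The fundamental solution `Γ(X,t;Y,τ)` of the degenerate parabolic operator
`𝓛_a u = D_t(|y|^a u) - div_Y(|y|^a ∇_Y u)` in spatial dimension `n = m+1 ≥ 2`:
`Γ = C_{n,a} (t-τ)^{-(n+a)/2} e^{-|X-Y|²/(4(t-τ))} F(xy/(t-τ))` for `t > τ`, and `0` otherwise,
where `x, y` are the last coordinates of `X, Y` and `C_{n,a} = 2^{-1-a}(4π)^{-(n-1)/2}`. -/
def GammaFS (a : ℝ) (m : ℕ) (X : Fin (m + 1) → ℝ) (t : ℝ) (Y : Fin (m + 1) → ℝ) (τ : ℝ) : ℝ :=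
  if τ < t then
    2 ^ (-1 - a) * (4 * π) ^ (-(m : ℝ) / 2) * (t - τ) ^ (-((m : ℝ) + 1 + a) / 2) *
      Real.exp (-(∑ i, (X i - Y i) ^ 2) / (4 * (t - τ))) *
      Fker a (X (Fin.last m) * Y (Fin.last m) / (t - τ))
  else 0

/-- The class `𝓗_a`: continuous functions on `ℝⁿ × ℝ` that are `C²` away from the hyperplane
`{y = 0}` and whose weighted normal derivative `|y|^a D_y u` has matching one-sided limits
across `{y = 0}`. -/
def memHa (a : ℝ) (m : ℕ) (u : (Fin (m + 1) → ℝ) → ℝ → ℝ) : Prop :=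
  Continuous (fun p : (Fin (m + 1) → ℝ) × ℝ => u p.1 p.2) ∧
  (∀ (X : Fin (m + 1) → ℝ) (t : ℝ), X (Fin.last m) ≠ 0 →
    ContDiffAt ℝ 2 (fun p : (Fin (m + 1) → ℝ) × ℝ => u p.1 p.2) (X, t)) ∧
  (∀ (X : Fin (m + 1) → ℝ) (t : ℝ), ∃ L : ℝ,
    Filter.Tendsto
      (fun y => |y| ^ a * pd (Fin.last m) (fun Z => u Z t) (Function.update X (Fin.last m) y))
      (nhdsWithin 0 (Set.Ioi 0)) (nhds L) ∧
    Filter.Tendsto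
      (fun y => |y| ^ a * pd (Fin.last m) (fun Z => u Z t) (Function.update X (Fin.last m) y))
      (nhdsWithin 0 (Set.Iio 0)) (nhds L))

/-- `φ(r) = (4πr)^{(n+a)/2} (1 + x₀²/r)^{a/2}`, the normalizing factor of the parabolic ball. -/
def phiw (a : ℝ) (m : ℕ) (x₀ r : ℝ) : ℝ :=
  (4 * π * r) ^ (((m : ℝ) + 1 + a) / 2) * (1 + x₀ ^ 2 / r) ^ (a / 2)

/-- The `𝓛_a`-parabolic ball
`Ω_r(ξ₀) = {(Y,t) : Γ(ξ₀;Y,t) > (4πr)^{-(n+a)/2}(1+x₀²/r)^{-a/2}}`. -/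
def pball (a : ℝ) (m : ℕ) (X₀ : Fin (m + 1) → ℝ) (t₀ r : ℝ) :
    Set ((Fin (m + 1) → ℝ) × ℝ) :=
  {ζ | (phiw a m (X₀ (Fin.last m)) r)⁻¹ < GammaFS a m X₀ t₀ ζ.1 ζ.2}

/-- The mean value
`u_r(ξ₀) = φ(r)⁻¹ ∫_{Ω_r(ξ₀)} u |y|^a |∇_Y Γ(ξ₀;Y,t)|² / Γ(ξ₀;Y,t)² dY dt`. -/
def mval (a : ℝ) (m : ℕ) (u : (Fin (m + 1) → ℝ) → ℝ → ℝ) (X₀ : Fin (m + 1) → ℝ)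
    (t₀ r : ℝ) : ℝ :=
  (phiw a m (X₀ (Fin.last m)) r)⁻¹ *
    ∫ ζ in pball a m X₀ t₀ r,
      u ζ.1 ζ.2 * |ζ.1 (Fin.last m)| ^ a *
        (∑ i, (pd i (fun Y => GammaFS a m X₀ t₀ Y ζ.2) ζ.1) ^ 2) /
        (GammaFS a m X₀ t₀ ζ.1 ζ.2) ^ 2

noncomputable section
open Real MeasureTheory Set Filter Topology

namespace MV

/-- the entire series `∑ q^k/(k! Γ(k+μ+1))` -/
def Bs (μ q : ℝ) : ℝ := ∑' k : ℕ, q ^ k / ((Nat.factorial k : ℝ) * Real.Gamma ((k : ℝ) + μ + 1))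

lemma gam_pos {μ : ℝ} (hμ : -1 < μ) (k : ℕ) : 0 < Real.Gamma ((k : ℝ) + μ + 1) := by
  apply Real.Gamma_pos_of_pos
  have : (0 : ℝ) ≤ k := Nat.cast_nonneg k
  linarith

lemma gam_succ {μ : ℝ} (hμ : -1 < μ) (k : ℕ) :
    Real.Gamma ((k : ℝ) + 1 + μ + 1) = ((k : ℝ) + μ + 1) * Real.Gamma ((k : ℝ) + μ + 1) := by
  have : (0 : ℝ) ≤ k := Nat.cast_nonneg k
  rw [← Real.Gamma_add_one (by linarith)]
  congr 1; ring

lemma gam_lb {μ : ℝ} (hμ : -1 < μ) : ∃ m0 : ℝ, 0 < m0 ∧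
    ∀ k : ℕ, m0 ≤ Real.Gamma ((k : ℝ) + μ + 1) := by
  have key : ∀ k : ℕ, min (Real.Gamma (((0:ℕ) : ℝ) + μ + 1)) (Real.Gamma (((1:ℕ) : ℝ) + μ + 1)) ≤
      Real.Gamma ((k : ℝ) + μ + 1) := by
    intro k
    rcases k with _ | k
    · exact min_le_left _ _
    induction k with
    | zero => exact min_le_right _ _
    | succ j ih =>
      refine ih.trans ?_
      have h := gam_succ hμ (j + 1)
      have hp := gam_pos hμ (j + 1)
      have e : (((j + 1 + 1 : ℕ) : ℝ) + μ + 1) = ((j + 1 : ℕ) : ℝ) + 1 + μ + 1 := by push_cast; ring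
      rw [e, h]
      have : (0 : ℝ) ≤ j := Nat.cast_nonneg j
      push_cast at hp ⊢
      nlinarith
  exact ⟨_, lt_min (gam_pos hμ 0) (gam_pos hμ 1), key⟩

lemma summable_Bs {μ : ℝ} (hμ : -1 < μ) (q : ℝ) :
    Summable (fun k : ℕ => q ^ k / ((Nat.factorial k : ℝ) * Real.Gamma ((k : ℝ) + μ + 1))) := by
  obtain ⟨m0, hm0, hb⟩ := gam_lb hμ
  refine Summable.of_norm_bounded (g := fun k : ℕ => (|q| ^ k / (Nat.factorial k : ℝ)) * (1 / m0)) ?_ ?_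
  · exact (Real.summable_pow_div_factorial |q|).mul_right _
  · intro k
    have hk := gam_pos hμ k
    have hf : (0 : ℝ) < Nat.factorial k := by exact_mod_cast Nat.factorial_pos k
    rw [norm_div, norm_pow, Real.norm_eq_abs, Real.norm_eq_abs, abs_of_pos (mul_pos hf hk),
      div_mul_div_comm, mul_one]
    gcongr
    exact hb k

lemma hasDerivAt_Bs {μ : ℝ} (hμ : -1 < μ) (q : ℝ) : HasDerivAt (Bs μ) (Bs (μ + 1) q) q := by
  obtain ⟨m0, hm0, hb⟩ := gam_lb hμ
  set R : ℝ := |q| + 1 with hR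
  have hR1 : 1 ≤ R := by rw [hR]; linarith [abs_nonneg q]
  have hd : HasDerivAt (fun z => ∑' k : ℕ, z ^ k / ((Nat.factorial k : ℝ) * Real.Gamma ((k : ℝ) + μ + 1)))
      (∑' k : ℕ, (k : ℝ) * q ^ (k - 1) / ((Nat.factorial k : ℝ) * Real.Gamma ((k : ℝ) + μ + 1))) q := by
    refine hasDerivAt_tsum_of_isPreconnected (t := Metric.ball (0:ℝ) R) (y₀ := q)
      (g := fun (k : ℕ) (z : ℝ) => z ^ k / ((Nat.factorial k : ℝ) * Real.Gamma ((k : ℝ) + μ + 1)))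
      (g' := fun (k : ℕ) (z : ℝ) => (k : ℝ) * z ^ (k - 1) / ((Nat.factorial k : ℝ) * Real.Gamma ((k : ℝ) + μ + 1)))
      (u := fun k : ℕ => ((2 * R) ^ k / (Nat.factorial k : ℝ)) * (1 / m0)) ?_ Metric.isOpen_ball
      (convex_ball _ _).isPreconnected ?_ ?_ ?_ (summable_Bs hμ q) ?_
    · exact (Real.summable_pow_div_factorial _).mul_right _
    · intro k y _
      exact (hasDerivAt_pow k y).div_const _
    · intro k y hy
      have hk := gam_pos hμ k
      have hf : (0 : ℝ) < Nat.factorial k := by exact_mod_cast Nat.factorial_pos k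
      have hy' : |y| ≤ R := by simpa using (mem_ball_zero_iff.1 hy).le
      rw [norm_div, norm_mul, norm_pow, Real.norm_eq_abs, Real.norm_eq_abs, Real.norm_eq_abs,
        abs_of_pos (mul_pos hf hk), div_mul_div_comm, mul_one, Nat.abs_cast]
      have h1 : (k : ℝ) ≤ 2 ^ k := by exact_mod_cast Nat.lt_two_pow_self.le
      have h2 : |y| ^ (k - 1) ≤ R ^ k :=
        (pow_le_pow_left₀ (abs_nonneg _) hy' _).trans (pow_le_pow_right₀ hR1 (Nat.sub_le _ _))
      rw [mul_pow]
      gcongr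
      exact hb k
    · simp [hR]
    · simp [hR]
  have he : (∑' k : ℕ, (k : ℝ) * q ^ (k - 1) / ((Nat.factorial k : ℝ) * Real.Gamma ((k : ℝ) + μ + 1)))
      = Bs (μ + 1) q := by
    rw [tsum_eq_zero_add']
    · simp only [Bs, Nat.cast_zero, zero_mul, zero_div, zero_add]
      congr 1; ext k
      have hk := gam_pos hμ (k + 1)
      have hf : (0 : ℝ) < Nat.factorial k := by exact_mod_cast Nat.factorial_pos k
      have e : ((k + 1 : ℕ) : ℝ) + μ + 1 = (k : ℝ) + (μ + 1) + 1 := by push_cast; ring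
      rw [e] at hk ⊢
      rw [Nat.factorial_succ]
      push_cast
      have : (k : ℝ) + 1 ≠ 0 := by positivity
      field_simp
    · refine (summable_Bs (μ := μ + 1) (by linarith) q).congr ?_
      intro k
      have hk := gam_pos hμ (k + 1)
      have hf : (0 : ℝ) < Nat.factorial k := by exact_mod_cast Nat.factorial_pos k
      have e : ((k + 1 : ℕ) : ℝ) + μ + 1 = (k : ℝ) + (μ + 1) + 1 := by push_cast; ring
      rw [e] at hk ⊢
      rw [Nat.factorial_succ]
      push_cast
      have : (k : ℝ) + 1 ≠ 0 := by positivity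
      field_simp
  rw [he] at hd
  exact hd

lemma continuous_Bs {μ : ℝ} (hμ : -1 < μ) : Continuous (Bs μ) :=
  continuous_iff_continuousAt.2 fun q => (hasDerivAt_Bs hμ q).continuousAt

lemma Bs_rec {μ : ℝ} (hμ : -1 < μ) (q : ℝ) :
    q * Bs (μ + 2) q + (μ + 1) * Bs (μ + 1) q = Bs μ q := by
  have h1 := (summable_Bs hμ q)
  have h2 := (summable_Bs (μ := μ + 1) (by linarith) q)
  have h3 := (summable_Bs (μ := μ + 2) (by linarith) q)
  have hA : q * Bs (μ + 2) q = ∑' k : ℕ, (k : ℝ) * (q ^ k / ((Nat.factorial k : ℝ) * Real.Gamma ((k : ℝ) + (μ+1) + 1))) ∧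
     Summable (fun k : ℕ => (k : ℝ) * (q ^ k / ((Nat.factorial k : ℝ) * Real.Gamma ((k : ℝ) + (μ+1) + 1)))) := by
    have ee : ∀ k : ℕ, ((k + 1 : ℕ) : ℝ) * (q ^ (k+1) / ((Nat.factorial (k+1) : ℝ) * Real.Gamma (((k + 1 : ℕ) : ℝ) + (μ+1) + 1)))
        = q * (q ^ k / ((Nat.factorial k : ℝ) * Real.Gamma ((k : ℝ) + (μ+2) + 1))) := by
      intro k
      have hk := gam_pos (μ := μ + 2) (by linarith) k
      have hf : (0 : ℝ) < Nat.factorial k := by exact_mod_cast Nat.factorial_pos k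
      have e : ((k + 1 : ℕ) : ℝ) + (μ + 1) + 1 = (k : ℝ) + (μ + 2) + 1 := by push_cast; ring
      rw [e, Nat.factorial_succ]
      push_cast
      have : (k : ℝ) + 1 ≠ 0 := by positivity
      field_simp
      ring
    have hs : Summable (fun k : ℕ => ((k + 1 : ℕ) : ℝ) * (q ^ (k+1) / ((Nat.factorial (k+1) : ℝ) * Real.Gamma (((k + 1 : ℕ) : ℝ) + (μ+1) + 1)))) :=
      (h3.mul_left q).congr fun k => (ee k).symm
    refine ⟨?_, ?_⟩
    · rw [tsum_eq_zero_add' (f := fun k : ℕ => (k : ℝ) * (q ^ k / ((Nat.factorial k : ℝ) * Real.Gamma ((k : ℝ) + (μ+1) + 1)))) hs]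
      simp only [Nat.cast_zero, zero_mul, zero_add]
      rw [Bs, ← tsum_mul_left]
      exact tsum_congr fun k => (ee k).symm
    · exact (summable_nat_add_iff 1).1 hs
  rw [hA.1, Bs, ← tsum_mul_left, ← Summable.tsum_add hA.2 (h2.mul_left _), Bs]
  refine tsum_congr fun k => ?_
  have hk := gam_pos hμ k
  have hf : (0 : ℝ) < Nat.factorial k := by exact_mod_cast Nat.factorial_pos k
  have hk0 : (0 : ℝ) ≤ k := Nat.cast_nonneg k
  have hk1 : (k : ℝ) + μ + 1 ≠ 0 := by linarith
  have e : (k : ℝ) + (μ + 1) + 1 = (k : ℝ) + 1 + μ + 1 := by ring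
  rw [e, gam_succ hμ k]
  field_simp
  ring

lemma Bs_nonneg {μ : ℝ} (hμ : -1 < μ) {q : ℝ} (hq : 0 ≤ q) : 0 ≤ Bs μ q :=
  tsum_nonneg fun k => by have := gam_pos hμ k; positivity

lemma Bs_zero {μ : ℝ} : Bs μ 0 = 1 / Real.Gamma (μ + 1) := by
  rw [Bs, tsum_eq_single 0]
  · simp
  · intro k hk; simp [hk]

lemma Bs_growth {μ : ℝ} (hμ : -1 < μ) : ∃ C : ℝ, 0 ≤ C ∧ ∀ w : ℝ, 0 ≤ w →
    Bs μ ((w / 2) ^ 2) ≤ C * ((1 + w) * exp w) := by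
  -- coefficients
  set r : ℕ → ℝ := fun k => (Nat.factorial (2 * k) : ℝ) /
    (4 ^ k * Nat.factorial k * Real.Gamma ((k : ℝ) + μ + 1) * (2 * k + 1)) with hr
  have hrpos : ∀ k, 0 < r k := fun k => by
    have := gam_pos hμ k
    have hf : (0 : ℝ) < Nat.factorial k := by exact_mod_cast Nat.factorial_pos k
    have hf2 : (0 : ℝ) < Nat.factorial (2*k) := by exact_mod_cast Nat.factorial_pos _
    simp only [hr]; positivity
  have hstep : ∀ k : ℕ, r (k + 1) * (2 * (k + μ + 1) * (2 * k + 3)) = r k * (2 * k + 1) ^ 2 := by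
    intro k
    have hk := gam_pos hμ k
    have hf : (0 : ℝ) < Nat.factorial k := by exact_mod_cast Nat.factorial_pos k
    have hf2 : (0 : ℝ) < Nat.factorial (2*k) := by exact_mod_cast Nat.factorial_pos _
    have hk0 : (0 : ℝ) ≤ k := Nat.cast_nonneg k
    have hk1 : 0 < (k : ℝ) + μ + 1 := by linarith
    simp only [hr]
    have e1 : 2 * (k + 1) = (2 * k + 1) + 1 := by ring
    rw [e1, Nat.factorial_succ, Nat.factorial_succ, Nat.factorial_succ]
    have e2 : ((k + 1 : ℕ) : ℝ) + μ + 1 = (k : ℝ) + 1 + μ + 1 := by push_cast; ring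
    rw [e2, gam_succ hμ k]
    push_cast
    field_simp
    ring
  have hmono : ∀ k : ℕ, 1 ≤ k → r (k + 1) ≤ r k := by
    intro k hk
    have hk0 : (1 : ℝ) ≤ k := by exact_mod_cast hk
    have h := hstep k
    have hp := hrpos k
    have hle : (2 * (k:ℝ) + 1) ^ 2 ≤ 2 * (k + μ + 1) * (2 * k + 3) := by nlinarith
    have hden : 0 < 2 * ((k:ℝ) + μ + 1) * (2 * k + 3) := by nlinarith
    have : r (k + 1) * (2 * (k + μ + 1) * (2 * k + 3)) ≤ r k * (2 * (k + μ + 1) * (2 * k + 3)) := by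
      rw [h]; exact mul_le_mul_of_nonneg_left hle hp.le
    exact le_of_mul_le_mul_right this hden
  have hbd : ∀ k, r k ≤ max (r 0) (r 1) := by
    intro k
    rcases k with _ | k
    · exact le_max_left _ _
    induction k with
    | zero => exact le_max_right _ _
    | succ j ih => exact (hmono (j + 1) (by omega)).trans ih
  set C := max (r 0) (r 1)
  have hC : 0 ≤ C := (hrpos 0).le.trans (le_max_left _ _)
  refine ⟨C, hC, fun w hw => ?_⟩
  have hs1 := Real.hasSum_cosh w
  have hs2 := (Real.hasSum_sinh w).mul_left w
  -- termwise : odd multiple of the even term ≤ cosh term + w * sinh term (shift)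
  have hterm : ∀ k : ℕ, ((w / 2) ^ 2) ^ k / ((Nat.factorial k : ℝ) * Real.Gamma ((k : ℝ) + μ + 1))
      = r k * ((2 * k + 1) * (w ^ (2 * k) / (Nat.factorial (2 * k) : ℝ))) := by
    intro k
    have hk := gam_pos hμ k
    have hf : (0 : ℝ) < Nat.factorial k := by exact_mod_cast Nat.factorial_pos k
    have hf2 : (0 : ℝ) < Nat.factorial (2*k) := by exact_mod_cast Nat.factorial_pos _
    have : ((w / 2) ^ 2) ^ k = w ^ (2 * k) / 4 ^ k := by
      rw [div_pow, div_pow, ← pow_mul]; norm_num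
    rw [this]
    simp only [hr]
    field_simp
  have hg : HasSum (fun k : ℕ => (2 * (k:ℝ)) * (w ^ (2 * k) / (Nat.factorial (2 * k) : ℝ))) (w * sinh w) := by
    rw [← hasSum_nat_add_iff' 1]
    simp only [Finset.range_one, Finset.sum_singleton, Nat.cast_zero, mul_zero, zero_mul, sub_zero]
    refine hs2.congr_fun ?_ |> fun h => h
    intro k
    have e1 : 2 * (k + 1) = (2 * k + 1) + 1 := by ring
    rw [e1, Nat.factorial_succ]
    have hf2 : (0 : ℝ) < Nat.factorial (2*k+1) := by exact_mod_cast Nat.factorial_pos _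
    push_cast
    field_simp
    ring
  have hsum := (hs1.add hg).mul_left C
  have hle : Bs μ ((w / 2) ^ 2) ≤ C * (cosh w + w * sinh w) := by
    rw [← hsum.tsum_eq, Bs]
    refine Summable.tsum_le_tsum ?_ (summable_Bs hμ _) hsum.summable
    intro k
    rw [hterm k]
    have : (0:ℝ) ≤ (w ^ (2 * k) / (Nat.factorial (2 * k) : ℝ)) := by positivity
    have h2 : w ^ (2 * k) / (Nat.factorial (2 * k) : ℝ) + 2 * (k:ℝ) * (w ^ (2 * k) / (Nat.factorial (2 * k) : ℝ))
      = (2 * k + 1) * (w ^ (2 * k) / (Nat.factorial (2 * k) : ℝ)) := by ring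
    rw [h2]
    exact mul_le_mul_of_nonneg_right (hbd k) (by positivity)
  refine hle.trans (mul_le_mul_of_nonneg_left ?_ hC)
  have h1 : cosh w ≤ exp w := by
    rw [← Real.cosh_add_sinh]; linarith [Real.sinh_nonneg_iff.2 hw]
  have h2 : sinh w ≤ exp w := by
    rw [← Real.cosh_add_sinh]; linarith [Real.cosh_pos w]
  nlinarith
end MV
end

noncomputable section
open Real MeasureTheory Set Filter Topology

namespace MV

/-- `∫_0^∞ e^{-s-x/s} s^{e-1} ds` -/
def Jk (e x : ℝ) : ℝ := ∫ s in Ioi (0:ℝ), exp (-s - x / s) * s ^ (e - 1)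

lemma Jk_cont (e x : ℝ) : ContinuousOn (fun s : ℝ => exp (-s - x / s) * s ^ (e - 1)) (Ioi 0) := by
  intro s hs
  have hs' : s ≠ 0 := (ne_of_gt hs)
  apply ContinuousAt.continuousWithinAt
  apply ContinuousAt.mul
  · apply ContinuousAt.rexp
    exact (continuousAt_id.neg).sub (continuousAt_const.div continuousAt_id hs')
  · exact Real.continuousAt_rpow_const _ _ (Or.inl hs')

lemma Jk_integrable (e : ℝ) {x : ℝ} (hx : 0 < x) :
    IntegrableOn (fun s : ℝ => exp (-s - x / s) * s ^ (e - 1)) (Ioi 0) := by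
  obtain ⟨N, hN⟩ := exists_nat_gt (-e)
  have hg := Real.GammaIntegral_convergent (s := e + N) (by linarith)
  refine Integrable.mono' (hg.const_mul ((Nat.factorial N : ℝ) / x ^ N))
    ((Jk_cont e x).aestronglyMeasurable measurableSet_Ioi) ?_
  refine (ae_restrict_iff' measurableSet_Ioi).2 (ae_of_all _ fun s hs => ?_)
  have hs' : 0 < s := hs
  have hp : 0 < s ^ (e - 1) := rpow_pos_of_pos hs' _
  rw [norm_mul, Real.norm_eq_abs, Real.norm_eq_abs, abs_of_pos (exp_pos _), abs_of_pos hp]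
  have h1 : exp (-s - x / s) = exp (-s) * (exp (x / s))⁻¹ := by
    rw [← Real.exp_neg, ← Real.exp_add]; ring_nf
  have h2 : (x / s) ^ N / (Nat.factorial N : ℝ) ≤ exp (x / s) :=
    Real.pow_div_factorial_le_exp _ (by positivity) N
  have hf : (0 : ℝ) < Nat.factorial N := by exact_mod_cast Nat.factorial_pos N
  have h3 : (exp (x / s))⁻¹ ≤ (Nat.factorial N : ℝ) / x ^ N * s ^ N := by
    have : 0 < (x / s) ^ N / (Nat.factorial N : ℝ) := by positivity
    refine (inv_anti₀ this h2).trans (le_of_eq ?_)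
    rw [div_pow]; field_simp
  have h4 : s ^ (e + N - 1) = s ^ N * s ^ (e - 1) := by
    rw [← Real.rpow_natCast s N, ← Real.rpow_add hs']; ring_nf
  rw [h1, h4]
  calc exp (-s) * (exp (x / s))⁻¹ * s ^ (e - 1)
      ≤ exp (-s) * ((Nat.factorial N : ℝ) / x ^ N * s ^ N) * s ^ (e - 1) := by gcongr
    _ = _ := by ring

lemma Jk_nonneg (e x : ℝ) : 0 ≤ Jk e x :=
  setIntegral_nonneg measurableSet_Ioi fun s hs =>
    mul_nonneg (exp_pos _).le (rpow_nonneg (le_of_lt hs) _)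

lemma Jk_hasDerivAt (e : ℝ) {x : ℝ} (hx : 0 < x) : HasDerivAt (Jk e) (-Jk (e - 1) x) x := by
  have h := hasDerivAt_integral_of_dominated_loc_of_deriv_le (μ := volume.restrict (Ioi (0:ℝ)))
    (s := Ioi (x / 2)) (x₀ := x)
    (F := fun x s => exp (-s - x / s) * s ^ (e - 1))
    (F' := fun x s => -(exp (-s - x / s) * s ^ (e - 1 - 1)))
    (bound := fun s => exp (-s - (x/2) / s) * s ^ (e - 1 - 1)) (Ioi_mem_nhds (by linarith))
    (Eventually.of_forall fun y => (Jk_cont e y).aestronglyMeasurable measurableSet_Ioi)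
    (Jk_integrable e hx)
    ((Jk_cont (e-1) x).neg.aestronglyMeasurable measurableSet_Ioi) ?_
    (Jk_integrable (e-1) (by linarith)) ?_
  · have h2 := h.2
    rw [integral_neg] at h2
    exact h2
  · refine (ae_restrict_iff' measurableSet_Ioi).2 (ae_of_all _ fun s hs y hy => ?_)
    have hs' : 0 < s := hs
    have hp : 0 < s ^ (e - 1 - 1) := rpow_pos_of_pos hs' _
    rw [norm_neg, norm_mul, Real.norm_eq_abs, Real.norm_eq_abs, abs_of_pos (exp_pos _), abs_of_pos hp]
    have hy' : x / 2 ≤ y := le_of_lt hy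
    gcongr
  · refine (ae_restrict_iff' measurableSet_Ioi).2 (ae_of_all _ fun s hs y hy => ?_)
    have hs' : 0 < s := hs
    have h1 : HasDerivAt (fun y : ℝ => -s - y / s) (-(1 / s)) y := by
      simpa using ((hasDerivAt_id y).div_const s).const_sub (-s)
    refine ((h1.exp).mul_const (s ^ (e - 1))).congr_deriv ?_
    rw [Real.rpow_sub_one hs'.ne' (e - 1)]
    field_simp

lemma Jk_symm (e : ℝ) {x : ℝ} (hx : 0 < x) : Jk e x = x ^ e * Jk (-e) x := by
  have h1 := integral_comp_rpow_Ioi (fun s : ℝ => exp (-s - x / s) * s ^ (e - 1)) (p := -1) (by norm_num)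
  have h2 := integral_comp_mul_left_Ioi (fun s : ℝ => x ^ (1 + e) * (exp (-s - x / s) * s ^ (-e - 1))) 0 hx
  rw [mul_zero, smul_eq_mul] at h2
  unfold Jk
  rw [← h1]
  have h3 : x ^ e * ∫ s in Ioi (0:ℝ), exp (-s - x / s) * s ^ (-e - 1) =
      x⁻¹ * (∫ s in Ioi (0:ℝ), x ^ (1 + e) * (exp (-s - x / s) * s ^ (-e - 1))) := by
    rw [integral_const_mul, Real.rpow_add hx, Real.rpow_one]; field_simp
  rw [h3, ← h2]
  refine setIntegral_congr_fun measurableSet_Ioi fun s hs => ?_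
  have hs' : 0 < s := hs
  simp only [abs_neg, abs_one, one_mul, smul_eq_mul]
  rw [Real.rpow_neg_one, Real.mul_rpow hx.le hs'.le, Real.inv_rpow hs'.le, ← Real.rpow_neg hs'.le]
  have e1 : -s⁻¹ - x / s⁻¹ = -(x * s) - x / (x * s) := by field_simp; ring
  rw [e1]
  have e2 : x ^ (1 + e) * x ^ (-e - 1) = 1 := by rw [← Real.rpow_add hx]; ring_nf; simp
  have e3 : s ^ (-1 - 1 : ℝ) * s ^ (-(e - 1)) = s ^ (-e - 1) := by rw [← Real.rpow_add hs']; ring_nf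
  calc s ^ (-1 - 1 : ℝ) * (exp (-(x * s) - x / (x * s)) * s ^ (-(e - 1)))
      = exp (-(x * s) - x / (x * s)) * (s ^ (-1 - 1 : ℝ) * s ^ (-(e - 1))) := by ring
    _ = exp (-(x * s) - x / (x * s)) * s ^ (-e - 1) * (x ^ (1 + e) * x ^ (-e - 1)) := by rw [e3, e2, mul_one]
    _ = _ := by ring

lemma Jk_tendsto {e : ℝ} (he : 0 < e) : Tendsto (Jk e) (𝓝[>] 0) (𝓝 (Real.Gamma e)) := by
  rw [Real.Gamma_eq_integral he]
  refine tendsto_integral_filter_of_dominated_convergence (fun s => exp (-s) * s ^ (e - 1)) ?_ ?_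
    (Real.GammaIntegral_convergent he) ?_
  · exact Eventually.of_forall fun y => (Jk_cont e y).aestronglyMeasurable measurableSet_Ioi
  · filter_upwards [self_mem_nhdsWithin] with x hx
    have hx' : 0 < x := hx
    refine (ae_restrict_iff' measurableSet_Ioi).2 (ae_of_all _ fun s hs => ?_)
    have hs' : 0 < s := hs
    have hp : 0 < s ^ (e - 1) := rpow_pos_of_pos hs' _
    rw [norm_mul, Real.norm_eq_abs, Real.norm_eq_abs, abs_of_pos (exp_pos _), abs_of_pos hp]
    have : 0 ≤ x / s := by positivity
    gcongr
    linarith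
  · refine (ae_restrict_iff' measurableSet_Ioi).2 (ae_of_all _ fun s hs => ?_)
    have hc : Continuous (fun x : ℝ => exp (-s - x / s) * s ^ (e - 1)) := by fun_prop
    have := (hc.tendsto 0).mono_left (nhdsWithin_le_nhds (s := Ioi 0))
    simpa using this

lemma Jk_bound {e : ℝ} (he : 0 < e) : ∃ C : ℝ, 0 ≤ C ∧ ∀ w : ℝ, 0 ≤ w →
    Jk e (w ^ 2) ≤ C * exp (-w) := by
  have hInt : IntegrableOn (fun s : ℝ => exp (-(s / 2)) * s ^ (e - 1)) (Ioi 0) := by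
    have h := Real.GammaIntegral_convergent he
    have h2 := (integrableOn_Ioi_comp_mul_left_iff (fun x => exp (-x) * x ^ (e - 1)) 0
      (a := 1/2) (by norm_num)).2 (by simpa using h)
    refine Integrable.congr (h2.const_mul ((1/2 : ℝ) ^ (-(e-1)))) ?_
    refine (ae_restrict_iff' measurableSet_Ioi).2 (ae_of_all _ fun s hs => ?_)
    have hs' : 0 < s := hs
    simp only
    rw [Real.mul_rpow (by norm_num) hs'.le]
    have : (1/2 : ℝ) ^ (-(e-1)) * (1/2 : ℝ) ^ (e - 1) = 1 := by
      rw [← Real.rpow_add (by norm_num)]; simp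
    have e2 : (1/2 : ℝ) * s = s / 2 := by ring
    rw [e2]
    linear_combination (exp (-(s/2)) * s ^ (e-1)) * this
  refine ⟨∫ s in Ioi (0:ℝ), exp (-(s / 2)) * s ^ (e - 1),
    setIntegral_nonneg measurableSet_Ioi fun s hs =>
      mul_nonneg (exp_pos _).le (rpow_nonneg (le_of_lt hs) _), fun w hw => ?_⟩
  rw [← integral_mul_const]
  refine integral_mono_of_nonneg ?_ (hInt.mul_const _) ?_
  · refine (ae_restrict_iff' measurableSet_Ioi).2 (ae_of_all _ fun s hs =>
      mul_nonneg (exp_pos _).le (rpow_nonneg (le_of_lt hs) _))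
  · refine (ae_restrict_iff' measurableSet_Ioi).2 (ae_of_all _ fun s hs => ?_)
    have hs' : 0 < s := hs
    have hp : 0 ≤ s ^ (e - 1) := rpow_nonneg hs'.le _
    have h1 : -s - w ^ 2 / s ≤ -(s/2) + -w := by
      have h3 : s * (w ^ 2 / s) = w ^ 2 := by field_simp
      have h4 : 0 ≤ w ^ 2 / s := by positivity
      nlinarith [sq_nonneg (s - w), sq_nonneg (w^2/s - w), sq_nonneg (s + w ^2 / s - w),
        mul_pos hs' hs']
    calc exp (-s - w ^ 2 / s) * s ^ (e - 1) ≤ exp (-(s/2) + -w) * s ^ (e-1) := by gcongr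
      _ = _ := by rw [Real.exp_add]; ring

lemma mono0 {X K a : ℝ} (ha : 0 < a) {f f' : ℝ → ℝ}
    (hf : ∀ x ∈ Ioc 0 X, HasDerivAt f (f' x) x) (h0 : Tendsto f (𝓝[>] 0) (𝓝 0))
    (hb : ∀ x ∈ Ioc 0 X, |f' x| ≤ K * (a * x ^ (a - 1))) : ∀ x ∈ Ioc 0 X, |f x| ≤ K * x ^ a := by
  have key : ∀ ε : ℝ, (ε = 1 ∨ ε = -1) → ∀ x ∈ Ioc 0 X, 0 ≤ K * x ^ a + ε * f x := by
    intro ε hε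
    have hd : ∀ x ∈ Ioc 0 X, HasDerivAt (fun x => K * x ^ a + ε * f x) (K * (a * x ^ (a-1)) + ε * f' x) x := by
      intro x hx
      exact ((Real.hasDerivAt_rpow_const (Or.inl hx.1.ne')).const_mul K).add ((hf x hx).const_mul ε)
    have hm : MonotoneOn (fun x => K * x ^ a + ε * f x) (Ioc 0 X) := by
      apply monotoneOn_of_deriv_nonneg (convex_Ioc 0 X)
      · exact fun x hx => (hd x hx).continuousAt.continuousWithinAt
      · exact fun x hx => (hd x (interior_subset hx)).differentiableAt.differentiableWithinAt
      · intro x hx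
        rw [(hd x (interior_subset hx)).deriv]
        have := hb x (interior_subset hx)
        rw [abs_le] at this
        rcases hε with h | h <;> rw [h] <;> linarith
    have hl : Tendsto (fun x => K * x ^ a + ε * f x) (𝓝[>] 0) (𝓝 (K * 0 + ε * 0)) := by
      refine Tendsto.add (Tendsto.const_mul _ ?_) (h0.const_mul _)
      have := (Real.continuousAt_rpow_const 0 a (Or.inr ha.le)).tendsto
      rw [Real.zero_rpow ha.ne'] at this
      exact this.mono_left nhdsWithin_le_nhds
    simp only [mul_zero, add_zero] at hl
    intro x hx
    refine le_of_tendsto hl ?_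
    filter_upwards [Ioo_mem_nhdsGT hx.1] with y hy
    exact hm ⟨hy.1, hy.2.le.trans hx.2⟩ hx hy.2.le
  intro x hx
  have h1 := key 1 (Or.inl rfl) x hx
  have h2 := key (-1) (Or.inr rfl) x hx
  rw [abs_le]; constructor <;> linarith

lemma ode_unique {μ : ℝ} (hμ : 0 < μ) {D D1 : ℝ → ℝ}
    (hD : ∀ x, 0 < x → HasDerivAt D (D1 x) x)
    (hD1 : ∀ x, 0 < x → HasDerivAt (fun x => x ^ μ * D1 x) (x ^ (μ - 1) * D x) x)
    (h0 : Tendsto D (𝓝[>] 0) (𝓝 0)) (h1 : Tendsto (fun x => x ^ μ * D1 x) (𝓝[>] 0) (𝓝 0)) :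
    ∀ x, 0 < x → D x = 0 := by
  intro X hX
  obtain ⟨S, hS0, hS⟩ : ∃ S : ℝ, 0 ≤ S ∧ ∀ x ∈ Ioc 0 X, |D x| ≤ S := by
    have h2 : ∀ᶠ x in 𝓝[>] (0:ℝ), |D x| < 1 := by
      have := h0.abs
      rw [abs_zero] at this
      exact this.eventually (gt_mem_nhds one_pos)
    obtain ⟨δ, hδ, hδ2⟩ := mem_nhdsGT_iff_exists_Ioo_subset.1 h2
    have hc : ContinuousOn (fun x => |D x|) (Icc δ X) := fun x hx =>
      ((hD x (lt_of_lt_of_le hδ hx.1)).continuousAt.abs).continuousWithinAt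
    obtain ⟨B, hB⟩ := (isCompact_Icc.image_of_continuousOn hc).bddAbove
    refine ⟨max 1 B, le_max_of_le_left zero_le_one, fun x hx => ?_⟩
    by_cases hxd : x < δ
    · exact (le_of_lt (hδ2 ⟨hx.1, hxd⟩)).trans (le_max_left _ _)
    · exact (hB ⟨x, ⟨not_lt.1 hxd, hx.2⟩, rfl⟩).trans (le_max_right _ _)
  have key : ∀ k : ℕ, ∀ x ∈ Ioc 0 X, |D x| ≤ S / ((Nat.factorial k : ℝ) * μ ^ k) * x ^ (k : ℝ) := by
    intro k
    induction k with
    | zero => intro x hx; simpa using hS x hx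
    | succ k ih =>
      set T := S / ((Nat.factorial k : ℝ) * μ ^ k) with hT
      have hT0 : 0 ≤ T := by positivity
      have hk : (0:ℝ) ≤ k := Nat.cast_nonneg k
      have s1 : ∀ x ∈ Ioc 0 X, |x ^ μ * D1 x| ≤ T / (k + μ) * x ^ ((k:ℝ) + μ) := by
        refine mono0 (by positivity) (fun x hx => hD1 x hx.1) h1 fun x hx => ?_
        rw [abs_mul, abs_of_pos (rpow_pos_of_pos hx.1 _)]
        calc x ^ (μ - 1) * |D x| ≤ x ^ (μ - 1) * (T * x ^ (k:ℝ)) := by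
              gcongr
              · exact rpow_nonneg hx.1.le _
              · exact ih x hx
          _ = T * (x ^ (k:ℝ) * x ^ (μ - 1)) := by ring
          _ = T * x ^ ((k:ℝ) + μ - 1) := by rw [← Real.rpow_add hx.1]; ring_nf
          _ = _ := by field_simp
      have s2 : ∀ x ∈ Ioc 0 X, |D x| ≤ T / ((k + μ) * (k + 1)) * x ^ ((k:ℝ) + 1) := by
        refine mono0 (by positivity) (fun x hx => hD x hx.1) h0 fun x hx => ?_
        have := s1 x hx
        have hp := rpow_pos_of_pos hx.1 μ
        rw [abs_mul, abs_of_pos hp, Real.rpow_add hx.1] at this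
        have h3 : |D1 x| ≤ T / (k + μ) * x ^ (k:ℝ) := by
          have : x ^ μ * |D1 x| ≤ x ^ μ * (T / (k + μ) * x ^ (k:ℝ)) := by linarith
          exact le_of_mul_le_mul_left this hp
        refine h3.trans (le_of_eq ?_)
        rw [add_sub_cancel_right]; field_simp
      intro x hx
      refine (s2 x hx).trans ?_
      push_cast
      refine mul_le_mul_of_nonneg_right ?_ (rpow_nonneg hx.1.le _)
      rw [hT, div_div, Nat.factorial_succ]
      push_cast
      have hf : (0 : ℝ) < Nat.factorial k := by exact_mod_cast Nat.factorial_pos k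
      apply div_le_div_of_nonneg_left hS0 (by positivity)
      have : μ ≤ k + μ := by linarith
      calc ((k:ℝ) + 1) * Nat.factorial k * μ ^ (k+1) = Nat.factorial k * μ ^ k * (μ * (k + 1)) := by ring
        _ ≤ _ := by gcongr
  have hlim : Tendsto (fun k : ℕ => S * ((X / μ) ^ k / (Nat.factorial k : ℝ))) atTop (𝓝 (S * 0)) :=
    (FloorSemiring.tendsto_pow_div_factorial_atTop (X / μ)).const_mul S
  rw [mul_zero] at hlim
  have : |D X| ≤ 0 := by
    refine ge_of_tendsto hlim (Eventually.of_forall fun k => ?_)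
    refine (key k X ⟨hX, le_rfl⟩).trans (le_of_eq ?_)
    rw [Real.rpow_natCast, div_pow]
    have hf : (0 : ℝ) < Nat.factorial k := by exact_mod_cast Nat.factorial_pos k
    field_simp
  exact abs_eq_zero.1 (le_antisymm this (abs_nonneg _))

end MV
end

noncomputable section
open Real MeasureTheory Set Filter Topology

namespace MV

lemma Bs_rep {β : ℝ} (h0 : 0 < β) (h1 : β < 1) {x : ℝ} (hx : 0 < x) :
    Bs (-β) x - x ^ β * Bs β x = (Real.Gamma β * Real.Gamma (1 - β))⁻¹ * Jk β x := by
  set K := (Real.Gamma β * Real.Gamma (1 - β))⁻¹ with hK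
  have g1 : 0 < Real.Gamma β := Real.Gamma_pos_of_pos h0
  have g2 : 0 < Real.Gamma (1 - β) := Real.Gamma_pos_of_pos (by linarith)
  have hrw : ∀ y : ℝ, 0 < y → y ^ (1 - β) * (Bs (1 - β) y - (β * y ^ (β - 1) * Bs β y + y ^ β * Bs (β + 1) y)
      + K * Jk (β - 1) y) = y ^ (1 - β) * Bs (1 - β) y - Bs (β - 1) y + K * Jk (1 - β) y := by
    intro y hy
    have r1 := Bs_rec (μ := β - 1) (by linarith) y
    have e1 : β - 1 + 2 = β + 1 := by ring
    have e2 : β - 1 + 1 = β := by ring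
    rw [e1, e2] at r1
    have e3 := Jk_symm (1 - β) hy
    rw [neg_sub] at e3
    have e4 : y ^ (1 - β) * y ^ (β - 1) = 1 := by rw [← Real.rpow_add hy]; ring_nf; simp
    have e5 : y ^ (1 - β) * y ^ β = y := by rw [← Real.rpow_add hy]; ring_nf; simp
    rw [e3]
    linear_combination (-β * Bs β y) * e4 - Bs (β+1) y * e5 - r1
  have key := ode_unique (μ := 1 - β) (by linarith)
    (D := fun x => Bs (-β) x - x ^ β * Bs β x - K * Jk β x)
    (D1 := fun y => Bs (1 - β) y - (β * y ^ (β - 1) * Bs β y + y ^ β * Bs (β + 1) y)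
      + K * Jk (β - 1) y) ?_ ?_ ?_ ?_ x hx
  · linarith
  · intro y hy
    have d1 := hasDerivAt_Bs (μ := -β) (by linarith) y
    have d2 := hasDerivAt_Bs (μ := β) (by linarith) y
    have d3 := (Real.hasDerivAt_rpow_const (p := β) (Or.inl hy.ne'))
    refine ((d1.sub (d3.mul d2)).sub ((Jk_hasDerivAt β hy).const_mul K)).congr_deriv ?_
    rw [show -β + 1 = 1 - β by ring]; ring
  · intro y hy
    have d1 := hasDerivAt_Bs (μ := 1-β) (by linarith) y
    have d2 := hasDerivAt_Bs (μ := β - 1) (by linarith) y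
    have d3 := (Real.hasDerivAt_rpow_const (p := 1 - β) (Or.inl hy.ne'))
    have d := ((d3.mul d1).sub d2).add ((Jk_hasDerivAt (1-β) hy).const_mul K)
    refine (d.congr_of_eventuallyEq ?_).congr_deriv ?_
    · filter_upwards [Ioi_mem_nhds hy] with z hz
      exact hrw z hz
    · have r1 := Bs_rec (μ := -β) (by linarith) y
      have e1 : -β + 2 = 1 - β + 1 := by ring
      have e2 : -β + 1 = 1 - β := by ring
      rw [e1, e2] at r1
      have e3 := Jk_symm β hy
      have e6 : 1 - β - 1 = - β := by ring
      rw [e6, e3, sub_add_cancel]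
      have e4 : y ^ (-β) * y ^ β = 1 := by rw [← Real.rpow_add hy]; ring_nf; simp
      have e5 : y ^ (1 - β) = y * y ^ (-β) := by rw [sub_eq_add_neg, Real.rpow_add hy, Real.rpow_one]
      rw [e5]
      linear_combination y ^ (-β) * r1 + (Bs β y + K * Jk (-β) y) * e4
  · have t1 : Tendsto (Bs (-β)) (𝓝[>] 0) (𝓝 (Bs (-β) 0)) :=
      ((continuous_Bs (by linarith)).tendsto 0).mono_left nhdsWithin_le_nhds
    have t2 : Tendsto (Bs (β)) (𝓝[>] 0) (𝓝 (Bs (β) 0)) :=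
      ((continuous_Bs (by linarith)).tendsto 0).mono_left nhdsWithin_le_nhds
    have t3 : Tendsto (fun x : ℝ => x ^ β) (𝓝[>] 0) (𝓝 ((0:ℝ) ^ β)) :=
      (Real.continuousAt_rpow_const 0 β (Or.inr h0.le)).tendsto.mono_left nhdsWithin_le_nhds
    have := (t1.sub (t3.mul t2)).sub ((Jk_tendsto h0).const_mul K)
    convert this using 2
    rw [Real.zero_rpow h0.ne', Bs_zero, hK, show -β + 1 = 1 - β by ring]
    field_simp; simp
  · have t1 : Tendsto (Bs (1-β)) (𝓝[>] 0) (𝓝 (Bs (1-β) 0)) :=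
      ((continuous_Bs (by linarith)).tendsto 0).mono_left nhdsWithin_le_nhds
    have t2 : Tendsto (Bs (β-1)) (𝓝[>] 0) (𝓝 (Bs (β-1) 0)) :=
      ((continuous_Bs (by linarith)).tendsto 0).mono_left nhdsWithin_le_nhds
    have t3 : Tendsto (fun x : ℝ => x ^ (1-β)) (𝓝[>] 0) (𝓝 ((0:ℝ) ^ (1-β))) :=
      (Real.continuousAt_rpow_const 0 (1-β) (Or.inr (by linarith))).tendsto.mono_left nhdsWithin_le_nhds
    have := ((t3.mul t1).sub t2).add ((Jk_tendsto (e := 1 - β) (by linarith)).const_mul K)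
    refine Tendsto.congr' (f₁ := fun y => y ^ (1 - β) * Bs (1 - β) y - Bs (β - 1) y + K * Jk (1 - β) y) ?_ ?_
    · filter_upwards [self_mem_nhdsWithin] with y hy
      exact (hrw y hy).symm
    convert this using 2
    rw [Real.zero_rpow (by linarith), Bs_zero (μ := 1 - β), Bs_zero (μ := β - 1), hK, show β - 1 + 1 = β by ring]
    field_simp; simp

lemma Fker_eq (a z : ℝ) : Fker a z = exp (-z / 2) *
    (Bs ((a-1)/2) ((z/4)^2) + z / 4 * |z / 4| ^ (-a) * Bs (-((a-1)/2)) ((z/4)^2)) := by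
  unfold Fker Bs
  simp only [pow_mul, sub_eq_add_neg]

lemma Fker_bound {a : ℝ} (h1 : -1 < a) (h2 : a < 1) : ∃ C : ℝ, 0 ≤ C ∧ ∀ z : ℝ,
    0 ≤ Fker a z ∧ Fker a z ≤ C * (1 + |z|) * exp (max (-z) 0 / 4) := by
  obtain ⟨C1, hC1, hb1⟩ := Bs_growth (μ := (a-1)/2) (by linarith)
  set β := (1 - a)/2 with hβ
  have hβ0 : 0 < β := by rw [hβ]; linarith
  have hβ1 : β < 1 := by rw [hβ]; linarith
  have hnu : (a-1)/2 = -β := by rw [hβ]; ring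
  obtain ⟨C2, hC2, hb2⟩ := Jk_bound hβ0
  have g1 : 0 < Real.Gamma β := Real.Gamma_pos_of_pos hβ0
  have g2 : 0 < Real.Gamma (1 - β) := Real.Gamma_pos_of_pos (by linarith)
  set K := (Real.Gamma β * Real.Gamma (1 - β))⁻¹ with hK
  have hK0 : 0 < K := by positivity
  have hB0 : 0 ≤ Bs (-β) 0 := Bs_nonneg (by linarith) le_rfl
  refine ⟨2 * C1 + K * C2 + Bs (-β) 0, by positivity, fun z => ?_⟩
  rw [Fker_eq, hnu, neg_neg]
  rw [hnu] at hb1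
  rcases lt_trichotomy z 0 with hz | hz | hz
  · -- negative
    set w := -z/4 with hw
    have hw0 : 0 < w := by rw [hw]; linarith
    have hzw : z / 4 = -w := by rw [hw]; ring
    have hwp : w * w ^ (-a) = (w^2) ^ β := by
      rw [← Real.rpow_natCast w 2, ← Real.rpow_mul hw0.le, hβ]
      nth_rw 1 [← Real.rpow_one w]
      rw [← Real.rpow_add hw0]; congr 1; push_cast; ring
    have rep := Bs_rep hβ0 hβ1 (x := w^2) (by positivity)
    rw [hzw, abs_neg, abs_of_pos hw0, neg_sq]
    have : Bs (-β) (w^2) + -w * w ^ (-a) * Bs β (w^2) = K * Jk β (w^2) := by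
      rw [← rep, ← hwp]; ring
    rw [this]
    have hJ := Jk_nonneg β (w^2)
    refine ⟨by positivity, ?_⟩
    have hm : max (-z) 0 / 4 = w := by rw [max_eq_left (by linarith)]
    rw [hm]
    have hz2 : -z / 2 = 2 * w := by rw [hw]; ring
    rw [hz2]
    calc exp (2*w) * (K * Jk β (w^2)) ≤ exp (2 * w) * (K * (C2 * exp (-w))) := by
          gcongr; exact hb2 w hw0.le
      _ = (K * C2) * 1 * exp w := by
          have : exp (2*w) * exp (-w) = exp w := by rw [← Real.exp_add]; ring_nf
          rw [← this]; ring
      _ ≤ _ := by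
          gcongr
          · linarith
          · linarith [abs_nonneg z]
  · subst hz
    simp only [neg_zero, zero_div, Real.exp_zero, zero_mul, add_zero, one_mul, abs_zero, max_self, mul_one]
    norm_num
    refine ⟨hB0, by nlinarith [mul_nonneg hK0.le hC2]⟩
  · set w := z/4 with hw
    have hw0 : 0 < w := by rw [hw]; linarith
    have hwp : w * w ^ (-a) = (w^2) ^ β := by
      rw [← Real.rpow_natCast w 2, ← Real.rpow_mul hw0.le, hβ]
      nth_rw 1 [← Real.rpow_one w]
      rw [← Real.rpow_add hw0]; congr 1; push_cast; ring
    have rep := Bs_rep hβ0 hβ1 (x := w^2) (by positivity)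
    rw [abs_of_pos hw0, hwp]
    have hJ := Jk_nonneg β (w^2)
    have hA : 0 ≤ Bs (-β) (w^2) := Bs_nonneg (by linarith) (by positivity)
    have hB : 0 ≤ (w^2)^β * Bs β (w^2) := mul_nonneg (by positivity) (Bs_nonneg (by linarith) (by positivity))
    refine ⟨by positivity, ?_⟩
    have hm : max (-z) 0 / 4 = 0 := by rw [max_eq_right (by linarith)]; simp
    rw [hm, Real.exp_zero, mul_one]
    have hle : (w^2)^β * Bs β (w^2) ≤ Bs (-β) (w^2) := by
      have : 0 ≤ K * Jk β (w^2) := by positivity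
      linarith
    have hz2 : -z / 2 = -(2 * w) := by rw [hw]; ring
    have hbb := hb1 (2*w) (by positivity)
    rw [mul_div_cancel_left₀ _ (two_ne_zero)] at hbb
    rw [hz2, abs_of_pos hz]
    calc exp (-(2*w)) * (Bs (-β) (w^2) + (w^2)^β * Bs β (w^2)) ≤ exp (-(2*w)) * (2 * (C1 * ((1+2*w)*exp (2*w)))) := by
          gcongr; linarith
      _ = 2 * C1 * (1 + 2 * w) := by
          have : exp (-(2*w)) * exp (2*w) = 1 := by rw [← Real.exp_add]; simp
          linear_combination (2 * C1 * (1 + 2 * w)) * this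
      _ ≤ _ := by
          have : 0 ≤ K * C2 := by positivity
          gcongr
          · linarith
          · rw [hw]; linarith

end MV
end

noncomputable section
open Real MeasureTheory Set Filter Topology

namespace MV

/-- `y |y|^e` -/
def sg (e y : ℝ) : ℝ := y * |y| ^ e

lemma sg_cont {e : ℝ} (he : -1 < e) : Continuous (sg e) := by
  rw [continuous_iff_continuousAt]
  intro y
  rcases eq_or_ne y 0 with rfl | hy
  · have h : sg e 0 = 0 := by simp [sg]
    rw [ContinuousAt, h]
    have hb : ∀ y, |sg e y| ≤ |y| ^ (1 + e) := by
      intro y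
      unfold sg
      rcases eq_or_ne y 0 with rfl | hy
      · simp only [zero_mul, abs_zero]; positivity
      · rw [abs_mul, abs_of_nonneg (rpow_nonneg (abs_nonneg y) e), Real.rpow_add (abs_pos.2 hy), Real.rpow_one]
    have ht : Tendsto (fun y : ℝ => |y| ^ (1 + e)) (𝓝 0) (𝓝 0) := by
      have hc : ContinuousAt (fun y : ℝ => |y| ^ (1 + e)) 0 :=
        ContinuousAt.rpow_const continuous_abs.continuousAt (Or.inr (by linarith))
      have := hc.tendsto
      simpa [Real.zero_rpow (show (1 + e) ≠ 0 by linarith)] using this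
    exact squeeze_zero_norm hb ht
  · exact continuousAt_id.mul (ContinuousAt.rpow_const continuous_abs.continuousAt (Or.inl (abs_pos.2 hy).ne'))

lemma abs_rpow_deriv (e : ℝ) {y : ℝ} (hy : y ≠ 0) :
    HasDerivAt (fun y : ℝ => |y| ^ e) (e * |y| ^ e / y) y := by
  rcases lt_or_gt_of_ne hy with h | h
  · have h1 : HasDerivAt (fun y : ℝ => (-y) ^ e) (e * (-y) ^ (e-1) * (-1)) y :=
      (Real.hasDerivAt_rpow_const (x := -y) (p := e) (Or.inl (by linarith))).comp y (hasDerivAt_neg y)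
    refine (h1.congr_of_eventuallyEq ?_).congr_deriv ?_
    · filter_upwards [Iio_mem_nhds h] with z hz
      rw [abs_of_neg hz]
    · rw [abs_of_neg h, Real.rpow_sub_one (by linarith)]; field_simp
  · have h1 : HasDerivAt (fun y : ℝ => y ^ e) (e * y ^ (e-1)) y :=
      (Real.hasDerivAt_rpow_const (x := y) (p := e) (Or.inl hy))
    refine (h1.congr_of_eventuallyEq ?_).congr_deriv ?_
    · filter_upwards [Ioi_mem_nhds h] with z hz
      rw [abs_of_pos hz]
    · rw [abs_of_pos h, Real.rpow_sub_one hy]; field_simp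

lemma sg_deriv (e : ℝ) {y : ℝ} (hy : y ≠ 0) : HasDerivAt (sg e) ((1 + e) * |y| ^ e) y := by
  refine ((hasDerivAt_id y).mul (abs_rpow_deriv e hy)).congr_deriv ?_
  simp only [id]; field_simp

def eK (μ x0 y s : ℝ) : ℝ := s ^ (-μ) * exp (-(x0 ^ 2 + y ^ 2) / (4 * s))
def Kf (μ x0 y s : ℝ) : ℝ := eK μ x0 y s * Bs (μ - 1) ((x0 * y / (4 * s)) ^ 2)
def Lf (μ x0 y s : ℝ) : ℝ := eK μ x0 y s * (-(1 / (2 * s)) * Bs (μ - 1) ((x0 * y / (4 * s)) ^ 2)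
  + x0 ^ 2 / (8 * s ^ 2) * Bs μ ((x0 * y / (4 * s)) ^ 2))
def Ksf (μ x0 y s : ℝ) : ℝ := eK μ x0 y s * ((-μ / s + (x0 ^ 2 + y ^ 2) / (4 * s ^ 2)) *
    Bs (μ - 1) ((x0 * y / (4 * s)) ^ 2)
  - 2 * (x0 * y / (4 * s)) ^ 2 / s * Bs μ ((x0 * y / (4 * s)) ^ 2))

section cont
variable {X : Type*} [TopologicalSpace X] {f g : X → ℝ} {S : Set X} {μ x0 : ℝ}

lemma eK_cont (hf : ContinuousOn f S) (hg : ContinuousOn g S)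
    (h0 : ∀ x ∈ S, 0 < g x) : ContinuousOn (fun x => eK μ x0 (f x) (g x)) S := by
  unfold eK
  refine ContinuousOn.mul (hg.rpow_const fun x hx => Or.inl (h0 x hx).ne') ?_
  refine ContinuousOn.rexp (ContinuousOn.div (by fun_prop) (by fun_prop) fun x hx => ?_)
  have := h0 x hx; positivity

lemma q_cont (hf : ContinuousOn f S) (hg : ContinuousOn g S)
    (h0 : ∀ x ∈ S, 0 < g x) : ContinuousOn (fun x => (x0 * f x / (4 * g x)) ^ 2) S := by
  refine ContinuousOn.pow (ContinuousOn.div (by fun_prop) (by fun_prop) fun x hx => ?_) 2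
  have := h0 x hx; positivity

lemma Bs_contOn (hμ : -1 < μ) {h : X → ℝ} (hh : ContinuousOn h S) : ContinuousOn (fun x => Bs μ (h x)) S :=
  (continuous_Bs hμ).comp_continuousOn hh

lemma Kf_cont (hμ : 0 < μ) (hf : ContinuousOn f S) (hg : ContinuousOn g S)
    (h0 : ∀ x ∈ S, 0 < g x) : ContinuousOn (fun x => Kf μ x0 (f x) (g x)) S :=
  (eK_cont hf hg h0).mul (Bs_contOn (by linarith) (q_cont hf hg h0))

lemma Lf_cont (hμ : 0 < μ) (hf : ContinuousOn f S) (hg : ContinuousOn g S)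
    (h0 : ∀ x ∈ S, 0 < g x) : ContinuousOn (fun x => Lf μ x0 (f x) (g x)) S := by
  refine (eK_cont hf hg h0).mul (ContinuousOn.add (ContinuousOn.mul ?_ (Bs_contOn (by linarith) (q_cont hf hg h0)))
    (ContinuousOn.mul ?_ (Bs_contOn (by linarith) (q_cont hf hg h0))))
  · refine (ContinuousOn.div (by fun_prop) (by fun_prop) fun x hx => ?_).neg
    have := h0 x hx; positivity
  · refine (ContinuousOn.div (by fun_prop) (by fun_prop) fun x hx => ?_)
    have := h0 x hx; positivity

lemma Ksf_cont (hμ : 0 < μ) (hf : ContinuousOn f S) (hg : ContinuousOn g S)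
    (h0 : ∀ x ∈ S, 0 < g x) : ContinuousOn (fun x => Ksf μ x0 (f x) (g x)) S := by
  have hn : ∀ x ∈ S, g x ≠ 0 := fun x hx => (h0 x hx).ne'
  refine (eK_cont hf hg h0).mul (ContinuousOn.sub (ContinuousOn.mul ?_ (Bs_contOn (by linarith) (q_cont hf hg h0)))
    (ContinuousOn.mul ?_ (Bs_contOn (by linarith) (q_cont hf hg h0))))
  · refine ((continuousOn_const).div hg hn).add (ContinuousOn.div (by fun_prop) (by fun_prop) fun x hx => ?_)
    have := h0 x hx; positivity
  · exact (((q_cont hf hg h0).const_smul (2:ℝ)).div hg hn)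
end cont

section der
variable {μ x0 y s : ℝ}

lemma eK_deriv_y (hs : 0 < s) : HasDerivAt (fun y => eK μ x0 y s) (-(y / (2 * s)) * eK μ x0 y s) y := by
  have h1 : HasDerivAt (fun y : ℝ => -(x0 ^ 2 + y ^ 2) / (4 * s)) (-(2 * y) / (4 * s)) y := by
    have := ((hasDerivAt_pow 2 y).const_add (x0 ^ 2)).neg.div_const (4 * s)
    simpa using this
  refine ((h1.exp).const_mul (s ^ (-μ))).congr_deriv ?_
  unfold eK; field_simp; ring

lemma q_deriv_y (hs : 0 < s) : HasDerivAt (fun y => (x0 * y / (4 * s)) ^ 2) (x0 ^ 2 * y / (8 * s ^ 2)) y := by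
  have h1 : HasDerivAt (fun y : ℝ => x0 * y / (4 * s)) (x0 * 1 / (4 * s)) y :=
    ((hasDerivAt_id y).const_mul x0).div_const _
  refine (h1.pow 2).congr_deriv ?_
  simp only [Nat.cast_ofNat, Nat.add_one_sub_one, pow_one]; field_simp; ring

lemma B_deriv_y {κ : ℝ} (hκ : -1 < κ) (hs : 0 < s) : HasDerivAt (fun y => Bs κ ((x0 * y / (4 * s)) ^ 2))
    (Bs (κ + 1) ((x0 * y / (4 * s)) ^ 2) * (x0 ^ 2 * y / (8 * s ^ 2))) y :=
  (hasDerivAt_Bs hκ _).comp y (q_deriv_y hs)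

lemma Kf_deriv_y (hμ : 0 < μ) (hs : 0 < s) : HasDerivAt (fun y => Kf μ x0 y s) (y * Lf μ x0 y s) y := by
  refine ((eK_deriv_y hs).mul (B_deriv_y (κ := μ - 1) (by linarith) hs)).congr_deriv ?_
  rw [sub_add_cancel]; unfold Lf; ring

lemma Lf_deriv_y (hμ : 0 < μ) (hs : 0 < s) : ∃ L', HasDerivAt (fun y => Lf μ x0 y s) L' y ∧
    2 * μ * Lf μ x0 y s + y * L' = Ksf μ x0 y s := by
  refine ⟨_, (eK_deriv_y hs).mul (((B_deriv_y (κ := μ - 1) (by linarith) hs).const_mul _).add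
    ((B_deriv_y (κ := μ) (by linarith) hs).const_mul _)), ?_⟩
  have r := Bs_rec (μ := μ - 1) (by linarith) ((x0 * y / (4 * s)) ^ 2)
  rw [show μ - 1 + 2 = μ + 1 by ring, sub_add_cancel] at r
  rw [sub_add_cancel]; unfold Lf Ksf
  generalize hB2 : Bs (μ + 1) ((x0 * y / (4 * s)) ^ 2) = B2 at *
  generalize hB1 : Bs (μ) ((x0 * y / (4 * s)) ^ 2) = B1 at *
  generalize hB0 : Bs (μ - 1) ((x0 * y / (4 * s)) ^ 2) = B0 at *
  subst r
  field_simp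
  ring

lemma Kf_deriv_s (hμ : 0 < μ) (hs : 0 < s) : HasDerivAt (fun s => Kf μ x0 y s) (Ksf μ x0 y s) s := by
  have h1 : HasDerivAt (fun s : ℝ => s ^ (-μ)) (-μ * s ^ (-μ - 1)) s :=
    Real.hasDerivAt_rpow_const (Or.inl hs.ne')
  have h2 : HasDerivAt (fun s : ℝ => -(x0 ^ 2 + y ^ 2) / (4 * s)) ((x0 ^ 2 + y ^ 2) / (4 * s ^ 2)) s := by
    refine ((hasDerivAt_const s (-(x0 ^ 2 + y ^ 2))).div ((hasDerivAt_id s).const_mul 4) (by simpa using hs.ne')).congr_deriv ?_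
    simp only [id]; field_simp; ring
  have h3 : HasDerivAt (fun s : ℝ => (x0 * y / (4 * s)) ^ 2) (-(2 * (x0 * y / (4 * s)) ^ 2 / s)) s := by
    have : HasDerivAt (fun s : ℝ => x0 * y / (4 * s)) (-(x0 * y / (4 * s ^ 2))) s := by
      refine ((hasDerivAt_const s (x0 * y)).div ((hasDerivAt_id s).const_mul 4) (by simpa using hs.ne')).congr_deriv ?_
      simp only [id]; field_simp; ring
    refine (this.pow 2).congr_deriv ?_
    simp only [Nat.cast_ofNat, Nat.add_one_sub_one, pow_one]; field_simp
  have h4 := (hasDerivAt_Bs (μ := μ - 1) (by linarith) ((x0 * y / (4 * s)) ^ 2)).comp s h3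
  refine ((h1.mul h2.exp).mul h4).congr_deriv ?_
  rw [sub_add_cancel, Real.rpow_sub_one hs.ne']
  unfold Ksf eK
  simp only [Function.comp_apply, Pi.mul_apply]
  field_simp
  ring

/-- one dimensional kernel -/
def kf (a x0 y s : ℝ) : ℝ := Kf ((1 + a) / 2) x0 y s + x0 * |x0| ^ (-a) * 4 ^ (a - 1) * (sg (-a) y * Kf ((3 - a) / 2) x0 y s)
def kq (a x0 y s : ℝ) : ℝ := sg a y * Lf ((1 + a) / 2) x0 y s +
  x0 * |x0| ^ (-a) * 4 ^ (a - 1) * ((1 - a) * Kf ((3 - a) / 2) x0 y s + y ^ 2 * Lf ((3 - a) / 2) x0 y s)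
def ks (a x0 y s : ℝ) : ℝ := Ksf ((1 + a) / 2) x0 y s + x0 * |x0| ^ (-a) * 4 ^ (a - 1) * (sg (-a) y * Ksf ((3 - a) / 2) x0 y s)

variable {a : ℝ}
lemma kf_deriv_s (h1 : -1 < a) (h2 : a < 1) (hs : 0 < s) : HasDerivAt (fun s => kf a x0 y s) (ks a x0 y s) s :=
  (Kf_deriv_s (by linarith) hs).add (((Kf_deriv_s (by linarith) hs).const_mul _).const_mul _)

lemma abs_rpow_mul_neg (a : ℝ) (hy : y ≠ 0) : |y| ^ a * |y| ^ (-a) = 1 := by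
  rw [← Real.rpow_add (abs_pos.2 hy)]; simp

lemma kf_deriv_y (h1 : -1 < a) (h2 : a < 1) (hs : 0 < s) (hy : y ≠ 0) :
    HasDerivAt (fun y => kf a x0 y s) (|y| ^ (-a) * kq a x0 y s) y := by
  refine ((Kf_deriv_y (by linarith) hs).add (((sg_deriv (-a) hy).mul
    (Kf_deriv_y (by linarith) hs)).const_mul _)).congr_deriv ?_
  have e := abs_rpow_mul_neg a hy
  unfold kq sg
  linear_combination (-y * Lf ((1+a)/2) x0 y s) * e

lemma kq_deriv_y (h1 : -1 < a) (h2 : a < 1) (hs : 0 < s) (hy : y ≠ 0) :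
    HasDerivAt (fun y => kq a x0 y s) (|y| ^ a * ks a x0 y s) y := by
  obtain ⟨L1, d1, e1⟩ := Lf_deriv_y (μ := (1 + a)/2) (x0 := x0) (y := y) (by linarith) hs
  obtain ⟨L2, d2, e2⟩ := Lf_deriv_y (μ := (3 - a)/2) (x0 := x0) (y := y) (by linarith) hs
  refine (((sg_deriv a hy).mul d1).add ((((Kf_deriv_y (by linarith) hs).const_mul _).add
    ((hasDerivAt_pow 2 y).mul d2)).const_mul _)).congr_deriv ?_
  have e := abs_rpow_mul_neg a hy
  unfold ks sg
  simp only [Nat.cast_ofNat]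
  rw [← e1, ← e2]
  linear_combination (-(x0 * |x0| ^ (-a) * 4 ^ (a - 1) * (y * (2 * ((3 - a) / 2) * Lf ((3 - a) / 2) x0 y s + y * L2)))) * e

lemma kf_eq (h1 : -1 < a) (h2 : a < 1) (hs : 0 < s) : s ^ (-(1 + a) / 2) * exp (-(x0 - y) ^ 2 / (4 * s)) * Fker a (x0 * y / s)
    = kf a x0 y s := by
  rw [Fker_eq, kf, Kf, Kf, eK, eK, sg]
  have e1 : x0 * y / s / 4 = x0 * y / (4 * s) := by field_simp
  have e2 : exp (-(x0 - y) ^ 2 / (4 * s)) * exp (-(x0 * y / s) / 2) = exp (-(x0 ^ 2 + y ^ 2) / (4 * s)) := by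
    rw [← Real.exp_add]; congr 1; field_simp; ring
  rw [e1, ← e2]
  have e3 : |x0 * y / (4 * s)| ^ (-a) = |x0| ^ (-a) * |y| ^ (-a) * (4 ^ a * s ^ a) := by
    rw [abs_div, abs_mul, abs_of_pos (show 0 < 4 * s by positivity), Real.div_rpow (by positivity) (by positivity),
      Real.mul_rpow (by positivity) (by positivity), Real.mul_rpow (by positivity) (by positivity),
      Real.rpow_neg (by norm_num : (0:ℝ) ≤ 4), Real.rpow_neg hs.le]
    field_simp
  have e4 : s ^ (-((3 - a) / 2)) = s ^ (-(1+a)/2) * s ^ a * s⁻¹ := by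
    rw [← Real.rpow_neg_one, ← Real.rpow_add hs, ← Real.rpow_add hs]; congr 1; ring
  have e5 : (4:ℝ) ^ (a - 1) = 4 ^ a / 4 := by rw [Real.rpow_sub_one (by norm_num)]
  rw [e3, e4, e5, show (1 + a)/2 - 1 = (a - 1)/2 by ring, show (3 - a)/2 - 1 = -((a-1)/2) by ring,
    show -((1+a)/2) = -(1+a)/2 by ring]
  field_simp

end der
end MV
end

noncomputable section
open Real MeasureTheory Set Filter Topology

namespace MV
set_option linter.unusedSectionVars false

abbrev P (m : ℕ) := (Fin m → ℝ) × ℝ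
abbrev Q (m : ℕ) := P m × ℝ

def di {m : ℕ} (i : Fin m) : P m := (Pi.single i 1, 0)
def dt {m : ℕ} : P m := (0, 1)

variable {m : ℕ} {a : ℝ}

/-- squared distance in space -/
def d2 (ξ q : Q m) : ℝ := ∑ i, (q.1.1 i - ξ.1.1 i) ^ 2 + (q.2 - ξ.2) ^ 2
def rr (ξ q : Q m) : ℝ := ∑ i, (q.1.1 i - ξ.1.1 i) ^ 2
def c0 (a : ℝ) (m : ℕ) : ℝ := 2 ^ (-1 - a) * (4 * π) ^ (-(m : ℝ) / 2)

def Gk (a : ℝ) (ξ q : Q m) : ℝ :=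
  GammaFS a m (Fin.snoc (α := fun _ => ℝ) ξ.1.1 ξ.2) ξ.1.2 (Fin.snoc (α := fun _ => ℝ) q.1.1 q.2) q.1.2

def Eh (ξ q : Q m) : ℝ := (ξ.1.2 - q.1.2) ^ (-(m : ℝ) / 2) * exp (-rr ξ q / (4 * (ξ.1.2 - q.1.2)))

lemma c0_pos : 0 < c0 a m := by unfold c0; positivity

lemma sum_snoc (ξ q : Q m) : ∑ i, ((Fin.snoc (α := fun _ => ℝ) ξ.1.1 ξ.2 : Fin (m+1) → ℝ) i - (Fin.snoc (α := fun _ => ℝ) q.1.1 q.2 : Fin (m+1) → ℝ) i) ^ 2 = d2 ξ q := by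
  rw [Fin.sum_univ_castSucc]
  simp only [Fin.snoc_castSucc, Fin.snoc_last, d2]
  congr 1
  · exact Finset.sum_congr rfl fun i _ => by ring
  · ring

lemma Gk_raw (ξ q : Q m) (hq : q.1.2 < ξ.1.2) : Gk a ξ q = c0 a m * (ξ.1.2 - q.1.2) ^ (-((m : ℝ) + 1 + a) / 2) *
      Real.exp (-(d2 ξ q) / (4 * (ξ.1.2 - q.1.2))) *
      Fker a (ξ.2 * q.2 / (ξ.1.2 - q.1.2)) := by
  unfold Gk GammaFS
  rw [if_pos hq, sum_snoc, Fin.snoc_last, Fin.snoc_last, c0]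

lemma Gk_zero (ξ q : Q m) (hq : ξ.1.2 ≤ q.1.2) : Gk a ξ q = 0 := by
  unfold Gk GammaFS
  rw [if_neg (not_lt.2 hq)]

lemma Gk_eq (h1 : -1 < a) (h2 : a < 1) (ξ q : Q m) (hq : q.1.2 < ξ.1.2) :
    Gk a ξ q = c0 a m * Eh ξ q * kf a ξ.2 q.2 (ξ.1.2 - q.1.2) := by
  have hs : 0 < ξ.1.2 - q.1.2 := sub_pos.2 hq
  rw [Gk_raw ξ q hq, ← kf_eq h1 h2 hs]
  unfold Eh d2 rr
  set s := ξ.1.2 - q.1.2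
  have e1 : s ^ (-((m : ℝ) + 1 + a) / 2) = s ^ (-(m:ℝ)/2) * s ^ (-(1+a)/2) := by
    rw [← Real.rpow_add hs]; congr 1; ring
  have e2 : exp (-(∑ i, (q.1.1 i - ξ.1.1 i) ^ 2 + (q.2 - ξ.2) ^ 2) / (4 * s)) =
    exp (-(∑ i, (q.1.1 i - ξ.1.1 i) ^ 2) / (4 * s)) * exp (-(ξ.2 - q.2)^2 / (4 * s)) := by
    rw [← Real.exp_add]; congr 1; ring
  rw [e1, e2]; ring

def Gt (a : ℝ) (ξ q : Q m) : ℝ :=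
  -(c0 a m * Eh ξ q * ks a ξ.2 q.2 (ξ.1.2 - q.1.2)
    + (-(m:ℝ) / (2 * (ξ.1.2 - q.1.2)) + rr ξ q / (4 * (ξ.1.2 - q.1.2) ^ 2)) *
      (c0 a m * Eh ξ q * kf a ξ.2 q.2 (ξ.1.2 - q.1.2)))
def Gi (a : ℝ) (ξ : Q m) (i : Fin m) (q : Q m) : ℝ :=
  -((q.1.1 i - ξ.1.1 i) / (2 * (ξ.1.2 - q.1.2))) * Gk a ξ q
def Gii (a : ℝ) (ξ : Q m) (i : Fin m) (q : Q m) : ℝ :=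
  (-(1 / (2 * (ξ.1.2 - q.1.2))) + (q.1.1 i - ξ.1.1 i) ^ 2 / (4 * (ξ.1.2 - q.1.2) ^ 2)) * Gk a ξ q
def Gq (a : ℝ) (ξ q : Q m) : ℝ := c0 a m * Eh ξ q * kq a ξ.2 q.2 (ξ.1.2 - q.1.2)

section



lemma Eh_cont (h1 : -1 < a) (h2 : a < 1) (ξ : Q m) : ContinuousOn (fun q => Eh ξ q) {q : Q m | q.1.2 < ξ.1.2} := by
  unfold Eh rr
  refine ContinuousOn.mul (ContinuousOn.rpow_const (by fun_prop) fun x hx => Or.inl ?_) ?_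
  · exact (sub_pos.2 hx).ne'
  · refine ContinuousOn.rexp (ContinuousOn.div (by fun_prop) (by fun_prop) fun x hx => ?_)
    have : 0 < ξ.1.2 - x.1.2 := sub_pos.2 hx
    positivity

lemma kf_cont (h1 : -1 < a) (h2 : a < 1) (ξ : Q m) : ContinuousOn (fun q : Q m => kf a ξ.2 q.2 (ξ.1.2 - q.1.2)) {q : Q m | q.1.2 < ξ.1.2} := by
  have hf : ContinuousOn (fun q : Q m => q.2) {q : Q m | q.1.2 < ξ.1.2} := by fun_prop
  have hg : ContinuousOn (fun q : Q m => ξ.1.2 - q.1.2) {q : Q m | q.1.2 < ξ.1.2} := by fun_prop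
  have h0 : ∀ q ∈ {q : Q m | q.1.2 < ξ.1.2}, 0 < ξ.1.2 - q.1.2 := fun q hq => sub_pos.2 hq
  refine (Kf_cont (by linarith) hf hg h0).add (continuousOn_const.mul
    (((sg_cont (e := -a) (by linarith)).comp_continuousOn hf).mul (Kf_cont (by linarith) hf hg h0)))

lemma ks_cont (h1 : -1 < a) (h2 : a < 1) (ξ : Q m) : ContinuousOn (fun q : Q m => ks a ξ.2 q.2 (ξ.1.2 - q.1.2)) {q : Q m | q.1.2 < ξ.1.2} := by
  have hf : ContinuousOn (fun q : Q m => q.2) {q : Q m | q.1.2 < ξ.1.2} := by fun_prop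
  have hg : ContinuousOn (fun q : Q m => ξ.1.2 - q.1.2) {q : Q m | q.1.2 < ξ.1.2} := by fun_prop
  have h0 : ∀ q ∈ {q : Q m | q.1.2 < ξ.1.2}, 0 < ξ.1.2 - q.1.2 := fun q hq => sub_pos.2 hq
  refine (Ksf_cont (by linarith) hf hg h0).add (continuousOn_const.mul
    (((sg_cont (e := -a) (by linarith)).comp_continuousOn hf).mul (Ksf_cont (by linarith) hf hg h0)))

lemma kq_cont (h1 : -1 < a) (h2 : a < 1) (ξ : Q m) : ContinuousOn (fun q : Q m => kq a ξ.2 q.2 (ξ.1.2 - q.1.2)) {q : Q m | q.1.2 < ξ.1.2} := by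
  have hf : ContinuousOn (fun q : Q m => q.2) {q : Q m | q.1.2 < ξ.1.2} := by fun_prop
  have hg : ContinuousOn (fun q : Q m => ξ.1.2 - q.1.2) {q : Q m | q.1.2 < ξ.1.2} := by fun_prop
  have h0 : ∀ q ∈ {q : Q m | q.1.2 < ξ.1.2}, 0 < ξ.1.2 - q.1.2 := fun q hq => sub_pos.2 hq
  refine (((sg_cont (e := a) (by linarith)).comp_continuousOn hf).mul (Lf_cont (by linarith) hf hg h0)).add
    (continuousOn_const.mul ((continuousOn_const.mul (Kf_cont (by linarith) hf hg h0)).add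
      ((hf.pow 2).mul (Lf_cont (by linarith) hf hg h0))))

lemma Gk_cont (h1 : -1 < a) (h2 : a < 1) (ξ : Q m) : ContinuousOn (fun q => Gk a ξ q) {q : Q m | q.1.2 < ξ.1.2} :=
  ((continuousOn_const.mul (Eh_cont h1 h2 ξ)).mul (kf_cont h1 h2 ξ)).congr fun q hq => Gk_eq h1 h2 ξ q hq

lemma Gq_cont (h1 : -1 < a) (h2 : a < 1) (ξ : Q m) : ContinuousOn (fun q => Gq a ξ q) {q : Q m | q.1.2 < ξ.1.2} :=
  ((continuousOn_const.mul (Eh_cont h1 h2 ξ)).mul (kq_cont h1 h2 ξ))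

lemma Gi_cont (h1 : -1 < a) (h2 : a < 1) (ξ : Q m) (i : Fin m) : ContinuousOn (fun q => Gi a ξ i q) {q : Q m | q.1.2 < ξ.1.2} := by
  refine ContinuousOn.mul (ContinuousOn.neg (ContinuousOn.div (by fun_prop) (by fun_prop) fun x hx => ?_)) (Gk_cont h1 h2 ξ)
  have : 0 < ξ.1.2 - x.1.2 := sub_pos.2 hx
  positivity

lemma Gii_cont (h1 : -1 < a) (h2 : a < 1) (ξ : Q m) (i : Fin m) : ContinuousOn (fun q => Gii a ξ i q) {q : Q m | q.1.2 < ξ.1.2} := by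
  refine ContinuousOn.mul (ContinuousOn.add (ContinuousOn.neg (ContinuousOn.div (by fun_prop) (by fun_prop) fun x hx => ?_))
    (ContinuousOn.div (by fun_prop) (by fun_prop) fun x hx => ?_)) (Gk_cont h1 h2 ξ) <;>
  · have : 0 < ξ.1.2 - x.1.2 := sub_pos.2 hx
    positivity

lemma Gt_cont (h1 : -1 < a) (h2 : a < 1) (ξ : Q m) : ContinuousOn (fun q => Gt a ξ q) {q : Q m | q.1.2 < ξ.1.2} := by
  unfold Gt
  refine ContinuousOn.neg (ContinuousOn.add ((continuousOn_const.mul (Eh_cont h1 h2 ξ)).mul (ks_cont h1 h2 ξ))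
    (ContinuousOn.mul (ContinuousOn.add (ContinuousOn.div (by fun_prop) (by fun_prop) fun x hx => ?_)
    (ContinuousOn.div (by unfold rr; fun_prop) (by fun_prop) fun x hx => ?_)) ((continuousOn_const.mul (Eh_cont h1 h2 ξ)).mul (kf_cont h1 h2 ξ))))
  <;>
  · have : 0 < ξ.1.2 - x.1.2 := sub_pos.2 hx
    positivity

lemma rr_line (h1 : -1 < a) (h2 : a < 1) (ξ : Q m) (q : Q m) (i : Fin m) : HasDerivAt (fun r : ℝ => rr ξ (q.1 + r • di i, q.2)) (2 * (q.1.1 i - ξ.1.1 i)) 0 := by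
  have h : (fun r : ℝ => rr ξ (q.1 + r • di i, q.2)) = fun r => rr ξ q + 2 * (q.1.1 i - ξ.1.1 i) * r + r ^ 2 := by
    funext r
    unfold rr di
    have hk : ∀ k, ((q.1 + r • ((Pi.single i 1 : Fin m → ℝ), (0:ℝ))).1 k - ξ.1.1 k) ^ 2 =
      (q.1.1 k - ξ.1.1 k) ^ 2 + (if k = i then 2 * (q.1.1 i - ξ.1.1 i) * r + r ^ 2 else 0) := by
      intro k
      by_cases hk : k = i
      · subst hk; simp; ring
      · simp [hk]
    simp only [hk, Finset.sum_add_distrib, Finset.sum_ite_eq', Finset.mem_univ, if_true]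
    ring
  rw [h]
  refine (((hasDerivAt_id (0:ℝ)).const_mul (2 * (q.1.1 i - ξ.1.1 i))).const_add (rr ξ q) |>.add (hasDerivAt_pow 2 (0:ℝ))).congr_deriv ?_
  simp

lemma Gk_line (h1 : -1 < a) (h2 : a < 1) (ξ : Q m) (q : Q m) (hq : q.1.2 < ξ.1.2) (i : Fin m) :
    HasLineDerivAt ℝ (fun p => Gk a ξ (p, q.2)) (Gi a ξ i q) q.1 (di i) := by
  unfold HasLineDerivAt
  have hs : 0 < ξ.1.2 - q.1.2 := sub_pos.2 hq
  have hd := ((((rr_line h1 h2 ξ q i).neg.div_const (4 * (ξ.1.2 - q.1.2))).exp).const_mul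
    (c0 a m * (ξ.1.2 - q.1.2) ^ (-(m : ℝ) / 2))).mul_const (kf a ξ.2 q.2 (ξ.1.2 - q.1.2))
  have he : (fun r : ℝ => Gk a ξ (q.1 + r • di i, q.2)) = fun r => c0 a m * (ξ.1.2 - q.1.2) ^ (-(m : ℝ) / 2) *
     exp (-rr ξ (q.1 + r • di i, q.2) / (4 * (ξ.1.2 - q.1.2))) * (kf a ξ.2 q.2 (ξ.1.2 - q.1.2)) := by
    funext r
    rw [Gk_eq h1 h2 ξ _ (by simpa [di] using hq), Eh]
    simp only [di, Prod.snd_add, Prod.smul_snd, smul_eq_mul, mul_zero, add_zero]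
    ring
  rw [he]
  refine hd.congr_deriv ?_
  rw [Gi, Gk_eq h1 h2 ξ q hq, Eh]
  simp only [Pi.neg_apply, zero_smul, add_zero, Prod.mk.eta]
  field_simp
  ring

lemma Gi_line (h1 : -1 < a) (h2 : a < 1) (ξ : Q m) (q : Q m) (hq : q.1.2 < ξ.1.2) (i : Fin m) :
    HasLineDerivAt ℝ (fun p => Gi a ξ i (p, q.2)) (Gii a ξ i q) q.1 (di i) := by
  have hs : 0 < ξ.1.2 - q.1.2 := sub_pos.2 hq
  have h := Gk_line h1 h2 ξ q hq i
  unfold HasLineDerivAt at h ⊢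
  have e : (fun r : ℝ => Gi a ξ i (q.1 + r • di i, q.2)) = fun r =>
     (-((q.1.1 i + r - ξ.1.1 i) / (2 * (ξ.1.2 - q.1.2)))) * Gk a ξ (q.1 + r • di i, q.2) := by
    funext r
    simp [Gi, di]
  rw [e]
  have hd : HasDerivAt (fun r : ℝ => -((q.1.1 i + r - ξ.1.1 i) / (2 * (ξ.1.2 - q.1.2)))) (-(1 / (2 * (ξ.1.2 - q.1.2)))) 0 :=
    ((((hasDerivAt_id (0:ℝ)).const_add (q.1.1 i)).sub_const (ξ.1.1 i)).div_const _).neg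
  refine (hd.mul h).congr_deriv ?_
  simp only [zero_smul, add_zero, Gi, Gii]
  field_simp
  ring

lemma Gk_line_t (h1 : -1 < a) (h2 : a < 1) (ξ : Q m) (q : Q m) (hq : q.1.2 < ξ.1.2) :
    HasLineDerivAt ℝ (fun p => Gk a ξ (p, q.2)) (Gt a ξ q) q.1 dt := by
  unfold HasLineDerivAt
  have hs : 0 < ξ.1.2 - q.1.2 := sub_pos.2 hq
  have hl : HasDerivAt (fun r : ℝ => ξ.1.2 - (q.1.2 + r)) (-1) 0 := by
    simpa using ((hasDerivAt_id (0:ℝ)).const_add q.1.2).const_sub ξ.1.2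
  have a0 : ξ.1.2 - (q.1.2 + 0) = ξ.1.2 - q.1.2 := by ring
  have hA : HasDerivAt (fun s : ℝ => s ^ (-(m : ℝ) / 2)) (-(m:ℝ)/2 * (ξ.1.2 - q.1.2) ^ (-(m:ℝ)/2 - 1)) (ξ.1.2 - (q.1.2 + 0)) := by
    rw [a0]; exact Real.hasDerivAt_rpow_const (Or.inl hs.ne')
  have hB : HasDerivAt (fun s : ℝ => -rr ξ q / (4 * s)) (rr ξ q / (4 * (ξ.1.2 - q.1.2) ^ 2)) (ξ.1.2 - (q.1.2 + 0)) := by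
    rw [a0]
    refine ((hasDerivAt_const _ (-rr ξ q)).div ((hasDerivAt_id _).const_mul 4) (by simpa using hs.ne')).congr_deriv ?_
    field_simp; ring
  have hC : HasDerivAt (fun s => kf a ξ.2 q.2 s) (ks a ξ.2 q.2 (ξ.1.2 - q.1.2)) (ξ.1.2 - (q.1.2 + 0)) := by
    rw [a0]; exact kf_deriv_s h1 h2 hs
  have hd := ((((hA.mul hB.exp).const_mul (c0 a m)).mul hC).comp (0:ℝ) hl)
  refine (hd.congr_of_eventuallyEq ?_).congr_deriv ?_
  · have : ∀ᶠ r : ℝ in 𝓝 0, q.1.2 + r < ξ.1.2 := by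
      have hc : Continuous (fun r : ℝ => q.1.2 + r) := by fun_prop
      exact (hc.tendsto 0).eventually (gt_mem_nhds (by simpa using hq))
    filter_upwards [this] with r hr
    rw [Gk_eq h1 h2 ξ _ (by simpa [dt] using hr), Eh]
    simp [dt, rr]
  · simp only [a0, Gt, Eh, Pi.mul_apply]
    rw [Real.rpow_sub_one hs.ne']
    field_simp
    ring

lemma Gk_deriv_y (h1 : -1 < a) (h2 : a < 1) (ξ : Q m) (q : Q m) (hq : q.1.2 < ξ.1.2) (hy : q.2 ≠ 0) :
    HasDerivAt (fun y => Gk a ξ (q.1, y)) (|q.2| ^ (-a) * Gq a ξ q) q.2 := by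
  have hs : 0 < ξ.1.2 - q.1.2 := sub_pos.2 hq
  have := (kf_deriv_y (x0 := ξ.2) h1 h2 hs hy).const_mul (c0 a m * Eh ξ q)
  have e : (fun y => Gk a ξ (q.1, y)) = fun y => c0 a m * Eh ξ q * kf a ξ.2 y (ξ.1.2 - q.1.2) := by
    funext y; rw [Gk_eq h1 h2 ξ _ (by simpa using hq)]; rfl
  rw [e]
  refine this.congr_deriv ?_
  unfold Gq; ring

lemma Gq_deriv_y (h1 : -1 < a) (h2 : a < 1) (ξ : Q m) (q : Q m) (hq : q.1.2 < ξ.1.2) (hy : q.2 ≠ 0) :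
    HasDerivAt (fun y => Gq a ξ (q.1, y)) (-(|q.2| ^ a * (Gt a ξ q + ∑ i, Gii a ξ i q))) q.2 := by
  have hs : 0 < ξ.1.2 - q.1.2 := sub_pos.2 hq
  have := (kq_deriv_y (x0 := ξ.2) h1 h2 hs hy).const_mul (c0 a m * Eh ξ q)
  have e : (fun y => Gq a ξ (q.1, y)) = fun y => c0 a m * Eh ξ q * kq a ξ.2 y (ξ.1.2 - q.1.2) := by
    funext y; rfl
  rw [e]
  refine this.congr_deriv ?_
  unfold Gt Gii
  rw [← Finset.sum_mul, Finset.sum_add_distrib, ← Finset.sum_div, Gk_eq h1 h2 ξ q hq]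
  simp only [Finset.sum_const, Finset.card_univ, Fintype.card_fin, nsmul_eq_mul]
  unfold rr
  field_simp
  ring

end
end MV
end

noncomputable section
open Real MeasureTheory Set Filter Topology

namespace MV
variable {m : ℕ} {a : ℝ}

lemma abs_gauss_integral {b β : ℝ} (hb : -1 < b) (hβ : 0 < β) :
    ∫ y : ℝ, |y| ^ b * exp (-β * y ^ 2) = β ^ (-(b + 1) / 2) * Real.Gamma ((b + 1) / 2) := by
  have h := integral_comp_abs (f := fun y => y ^ b * exp (-β * y ^ 2))
  simp only [sq_abs] at h
  rw [h]
  have h2 := integral_rpow_mul_exp_neg_mul_rpow (p := 2) (q := b) (b := β) (by norm_num) hb hβ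
  simp only [Real.rpow_two] at h2
  rw [h2]; ring

lemma abs_gauss_integrable {b β : ℝ} (hb : -1 < b) (hβ : 0 < β) :
    Integrable (fun y : ℝ => |y| ^ b * exp (-β * y ^ 2)) := by
  refine Integrable.of_integral_ne_zero ?_
  rw [abs_gauss_integral hb hβ]
  have : 0 < Real.Gamma ((b+1)/2) := Real.Gamma_pos_of_pos (by linarith)
  positivity

lemma even_mass (h1 : -1 < a) (x0 : ℝ) {s : ℝ} (hs : 0 < s) :
    ∫ y : ℝ, |y| ^ a * Kf ((1 + a) / 2) x0 y s = 2 ^ (1 + a) := by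
  set μ := (1 + a) / 2 with hμ
  have hμ0 : 0 < μ := by rw [hμ]; linarith
  let co : ℕ → ℝ := fun k => s ^ (-μ) * exp (-x0 ^ 2 / (4 * s)) * ((x0 / (4 * s)) ^ 2) ^ k / ((Nat.factorial k : ℝ) * Real.Gamma (k + (μ - 1) + 1))
  have hco : ∀ k, 0 ≤ co k := by
    intro k
    have : 0 < Real.Gamma ((k:ℝ) + (μ - 1) + 1) := Real.Gamma_pos_of_pos (by have : (0:ℝ) ≤ k := Nat.cast_nonneg k; linarith)
    positivity
  let F : ℕ → ℝ → ℝ := fun k y => co k * (|y| ^ (a + 2 * k) * exp (-(1 / (4 * s)) * y ^ 2))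
  have hb : ∀ k : ℕ, -1 < a + 2 * k := fun k => by have : (0:ℝ) ≤ k := Nat.cast_nonneg k; linarith
  have hβ : 0 < 1 / (4 * s) := by positivity
  have hI : ∀ k, ∫ y, F k y = 2 ^ (1 + a) * exp (-x0 ^ 2 / (4 * s)) * ((x0 ^ 2 / (4 * s)) ^ k / (Nat.factorial k : ℝ)) := by
    intro k
    simp only [F, co]
    rw [integral_const_mul, abs_gauss_integral (hb k) hβ]
    have e1 : (a + 2 * k + 1) / 2 = k + (μ - 1) + 1 := by rw [hμ]; ring
    have hg : 0 < Real.Gamma ((k:ℝ) + (μ - 1) + 1) := Real.Gamma_pos_of_pos (by have : (0:ℝ) ≤ k := Nat.cast_nonneg k; linarith)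
    have e2 : (1 / (4 * s)) ^ (-(a + 2 * k + 1) / 2) = 2 ^ (1 + a) * s ^ μ * (4 * s) ^ k := by
      have e3 : -(a + 2 * k + 1) / 2 = -(μ + k) := by rw [hμ]; ring
      rw [e3, one_div, Real.inv_rpow (by positivity), ← Real.rpow_neg (by positivity), neg_neg,
        Real.rpow_add (by positivity), Real.rpow_natCast, Real.mul_rpow (by norm_num) hs.le]
      have : (4:ℝ) ^ μ = 2 ^ (1 + a) := by
        rw [show (4:ℝ) = 2 ^ (2:ℝ) by norm_num, ← Real.rpow_mul (by norm_num), hμ]; congr 1; ring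
      rw [this]
    have e4 : s ^ (-μ) * s ^ μ = 1 := by rw [← Real.rpow_add hs]; simp
    rw [e1, e2]
    have e5 : ((x0 / (4 * s)) ^ 2) ^ k * (4 * s) ^ k = (x0 ^ 2 / (4 * s)) ^ k := by
      rw [← mul_pow]; congr 1; field_simp
    rw [← e5]
    generalize ((x0 / (4 * s)) ^ 2) ^ k = A
    generalize (4 * s) ^ k = B
    field_simp
    linear_combination A * B * e4
  have hsum := (Real.summable_pow_div_factorial (x0 ^ 2 / (4 * s))).mul_left (2 ^ (1 + a) * exp (-x0 ^ 2 / (4 * s)))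
  have key := hasSum_integral_of_summable_integral_norm (μ := volume) (F := F)
    (fun k => (abs_gauss_integrable (hb k) hβ).const_mul _) (by
      have : (fun k => ∫ y, ‖F k y‖) = fun k => ∫ y, F k y := by
        funext k
        congr 1; funext y
        rw [Real.norm_of_nonneg]
        exact mul_nonneg (hco k) (by positivity)
      rw [this]
      simp only [hI]
      exact hsum)
  simp only [hI] at key
  have hexp0 : HasSum (fun k : ℕ => (x0 ^ 2 / (4 * s)) ^ k / (Nat.factorial k : ℝ)) (exp (x0 ^ 2 / (4 * s))) := by
    rw [Real.exp_eq_exp_ℝ]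
    exact NormedSpace.expSeries_div_hasSum_exp (x0 ^ 2 / (4 * s))
  have hexp := hexp0.mul_left (2 ^ (1 + a) * exp (-x0 ^ 2 / (4 * s)))
  have he := key.unique hexp
  have : ∫ y : ℝ, |y| ^ a * Kf μ x0 y s = ∫ y, ∑' k, F k y := by
    refine integral_congr_ae ?_
    have hne : ∀ᵐ y : ℝ, y ≠ 0 := by simp [ae_iff, measure_singleton]
    filter_upwards [hne] with y hy
    unfold Kf Bs
    rw [← tsum_mul_left, ← tsum_mul_left]
    refine tsum_congr fun k => ?_
    simp only [F, co, eK]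
    have e1 : |y| ^ (a + 2 * k) = |y| ^ a * (y ^ 2) ^ k := by
      rw [Real.rpow_add (abs_pos.2 hy), ← sq_abs, ← pow_mul, ← Real.rpow_natCast]; push_cast; rfl
    have e2 : exp (-(x0 ^ 2 + y ^ 2) / (4 * s)) = exp (-x0 ^ 2 / (4 * s)) * exp (-(1 / (4 * s)) * y ^ 2) := by
      rw [← Real.exp_add]; congr 1; ring
    have e3 : ((x0 * y / (4 * s)) ^ 2) ^ k = ((x0 / (4 * s)) ^ 2) ^ k * (y ^ 2) ^ k := by
      rw [← mul_pow]; congr 1; ring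
    rw [e1, e2, e3]
    ring
  rw [this, he, mul_assoc, ← Real.exp_add]
  ring_nf; simp

lemma kf_nonneg (h1 : -1 < a) (h2 : a < 1) (x0 y : ℝ) {s : ℝ} (hs : 0 < s) : 0 ≤ kf a x0 y s := by
  obtain ⟨C, -, hC⟩ := Fker_bound h1 h2
  rw [← kf_eq h1 h2 hs]
  have := (hC (x0 * y / s)).1
  positivity

lemma kf_even (x0 y s : ℝ) : kf a x0 y s + kf a x0 (-y) s = 2 * Kf ((1+a)/2) x0 y s := by
  unfold kf Kf eK sg
  simp only [neg_sq, abs_neg, mul_neg, neg_div]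
  ring

lemma kf_contY (h1 : -1 < a) (h2 : a < 1) (x0 : ℝ) {s : ℝ} (hs : 0 < s) : Continuous (fun y => kf a x0 y s) := by
  rw [← continuousOn_univ]
  have hf : ContinuousOn (fun y : ℝ => y) univ := by fun_prop
  have hg : ContinuousOn (fun _ : ℝ => s) univ := by fun_prop
  exact (Kf_cont (by linarith) hf hg fun _ _ => hs).add (continuousOn_const.mul
    (((sg_cont (e := -a) (by linarith)).comp_continuousOn hf).mul (Kf_cont (by linarith) hf hg fun _ _ => hs)))

lemma kf_mass (h1 : -1 < a) (h2 : a < 1) (x0 : ℝ) {s : ℝ} (hs : 0 < s) :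
    Integrable (fun y : ℝ => |y| ^ a * kf a x0 y s) ∧ ∫ y : ℝ, |y| ^ a * kf a x0 y s = 2 ^ (1 + a) := by
  have hE := even_mass h1 x0 hs
  have hEi : Integrable (fun y : ℝ => |y| ^ a * Kf ((1 + a) / 2) x0 y s) :=
    Integrable.of_integral_ne_zero (by rw [hE]; positivity)
  have hmeas : AEStronglyMeasurable (fun y : ℝ => |y| ^ a * kf a x0 y s) volume :=
    ((measurable_id.abs.pow_const a).mul (kf_contY h1 h2 x0 hs).measurable).aestronglyMeasurable
  have hi : Integrable (fun y : ℝ => |y| ^ a * kf a x0 y s) := by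
    refine Integrable.mono' (hEi.const_mul 2) hmeas (ae_of_all _ fun y => ?_)
    have n1 := kf_nonneg h1 h2 x0 y hs
    have n2 := kf_nonneg h1 h2 x0 (-y) hs
    rw [Real.norm_of_nonneg (by positivity)]
    have hp : 0 ≤ |y| ^ a := by positivity
    have := kf_even (a := a) x0 y s
    nlinarith
  refine ⟨hi, ?_⟩
  have h3 : ∫ y : ℝ, |y| ^ a * kf a x0 (-y) s = ∫ y : ℝ, |y| ^ a * kf a x0 y s := by
    have := integral_neg_eq_self (fun y : ℝ => |y| ^ a * kf a x0 y s) volume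
    simpa using this
  have hi' : Integrable (fun y : ℝ => |y| ^ a * kf a x0 (-y) s) := by
    have := hi.comp_neg
    simpa using this
  have h4 : ∫ y : ℝ, (|y| ^ a * kf a x0 y s + |y| ^ a * kf a x0 (-y) s) = 2 * 2 ^ (1 + a) := by
    rw [← hE, ← integral_const_mul]
    congr 1; funext y
    rw [← mul_add, kf_even]; ring
  rw [integral_add hi hi', h3] at h4
  linarith

lemma heat_mass (x0 : Fin m → ℝ) {s : ℝ} (hs : 0 < s) :
    ∫ x : Fin m → ℝ, exp (-(∑ i, (x i - x0 i) ^ 2) / (4 * s)) = (4 * π * s) ^ ((m : ℝ) / 2) := by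
  have e : ∀ x : Fin m → ℝ, exp (-(∑ i, (x i - x0 i) ^ 2) / (4 * s)) = ∏ i, exp (-(1 / (4 * s)) * (x i - x0 i) ^ 2) := by
    intro x
    rw [← Real.exp_sum, ← Finset.mul_sum]; congr 1; ring
  simp_rw [e]
  rw [integral_fintype_prod_volume_eq_prod (fun i (v : ℝ) => exp (-(1 / (4 * s)) * (v - x0 i) ^ 2))]
  have : ∀ i, ∫ v : ℝ, exp (-(1 / (4 * s)) * (v - x0 i) ^ 2) = √(4 * π * s) := by
    intro i
    rw [integral_sub_right_eq_self (fun v : ℝ => exp (-(1 / (4 * s)) * v ^ 2)) (x0 i), integral_gaussian]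
    congr 1; field_simp
  simp only [this, Finset.prod_const, Finset.card_univ, Fintype.card_fin]
  rw [Real.sqrt_eq_rpow, ← Real.rpow_natCast, ← Real.rpow_mul (by positivity)]
  congr 1; ring

lemma Gk_mass (h1 : -1 < a) (h2 : a < 1) (ξ : Q m) {τ : ℝ} (hτ : τ < ξ.1.2) :
    Integrable (fun z : (Fin m → ℝ) × ℝ => |z.2| ^ a * Gk a ξ ((z.1, τ), z.2)) ∧
    ∫ z : (Fin m → ℝ) × ℝ, |z.2| ^ a * Gk a ξ ((z.1, τ), z.2) = 1 := by
  have hs : 0 < ξ.1.2 - τ := sub_pos.2 hτ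
  have e : (fun z : (Fin m → ℝ) × ℝ => |z.2| ^ a * Gk a ξ ((z.1, τ), z.2)) =
      fun z => (c0 a m * (ξ.1.2 - τ) ^ (-(m : ℝ) / 2)) * (exp (-(∑ i, (z.1 i - ξ.1.1 i) ^ 2) / (4 * (ξ.1.2 - τ))) *
        (|z.2| ^ a * kf a ξ.2 z.2 (ξ.1.2 - τ))) := by
    funext z
    rw [Gk_eq h1 h2 ξ _ hτ, Eh, rr]; ring
  have hI : ∫ z : (Fin m → ℝ) × ℝ, |z.2| ^ a * Gk a ξ ((z.1, τ), z.2) = 1 := by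
    rw [e, integral_const_mul, Measure.volume_eq_prod,
      integral_prod_mul (fun x : Fin m → ℝ => exp (-(∑ i, (x i - ξ.1.1 i) ^ 2) / (4 * (ξ.1.2 - τ))))
      (fun y : ℝ => |y| ^ a * kf a ξ.2 y (ξ.1.2 - τ)), heat_mass ξ.1.1 hs, (kf_mass h1 h2 ξ.2 hs).2, c0,
      Real.mul_rpow (by positivity) hs.le]
    have e1 : (2:ℝ) ^ (-1 - a) * 2 ^ (1 + a) = 1 := by rw [← Real.rpow_add (by norm_num)]; ring_nf; simp
    have e2 : (4 * π) ^ (-(m:ℝ) / 2) * (4 * π) ^ ((m:ℝ) / 2) = 1 := by rw [← Real.rpow_add (by positivity)]; ring_nf; simp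
    have e3 : (ξ.1.2 - τ) ^ (-(m:ℝ) / 2) * (ξ.1.2 - τ) ^ ((m:ℝ) / 2) = 1 := by rw [← Real.rpow_add hs]; ring_nf; simp
    calc _ = ((2:ℝ) ^ (-1 - a) * 2 ^ (1 + a)) * ((4 * π) ^ (-(m:ℝ) / 2) * (4 * π) ^ ((m:ℝ) / 2)) *
          ((ξ.1.2 - τ) ^ (-(m:ℝ) / 2) * (ξ.1.2 - τ) ^ ((m:ℝ) / 2)) := by ring
      _ = 1 := by rw [e1, e2, e3]; norm_num
  exact ⟨Integrable.of_integral_ne_zero (by rw [hI]; norm_num), hI⟩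

end MV
end

noncomputable section
open Real MeasureTheory Set Filter Topology

namespace MV
variable {m : ℕ} {a : ℝ}

lemma rr_nonneg (ξ q : Q m) : 0 ≤ rr ξ q := Finset.sum_nonneg fun _ _ => sq_nonneg _
lemma d2_eq (ξ q : Q m) : d2 ξ q = rr ξ q + (q.2 - ξ.2) ^ 2 := rfl
lemma d2_nonneg (ξ q : Q m) : 0 ≤ d2 ξ q := add_nonneg (rr_nonneg ξ q) (sq_nonneg _)

lemma Gk_nonneg (h1 : -1 < a) (h2 : a < 1) (ξ q : Q m) : 0 ≤ Gk a ξ q := by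
  by_cases hq : q.1.2 < ξ.1.2
  · have hs : 0 < ξ.1.2 - q.1.2 := sub_pos.2 hq
    rw [Gk_eq h1 h2 ξ q hq]
    have := kf_nonneg h1 h2 ξ.2 q.2 hs
    have := c0_pos (a := a) (m := m)
    unfold Eh
    positivity
  · rw [Gk_zero ξ q (not_lt.1 hq)]

lemma Gk_bound (h1 : -1 < a) (h2 : a < 1) (ξ : Q m) : ∃ C : ℝ, 0 ≤ C ∧ ∀ q : Q m, q.1.2 < ξ.1.2 →
    Gk a ξ q ≤ C * ((ξ.1.2 - q.1.2) ^ (-((m : ℝ) + 1 + a) / 2) * (1 + (ξ.1.2 - q.1.2)⁻¹) *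
      exp (-(d2 ξ q) / (8 * (ξ.1.2 - q.1.2)))) := by
  obtain ⟨C, hC0, hC⟩ := Fker_bound h1 h2
  have hc := c0_pos (a := a) (m := m)
  refine ⟨c0 a m * C * (9 + 2 * ξ.2 ^ 2), by positivity, fun q hq => ?_⟩
  have hs : 0 < ξ.1.2 - q.1.2 := sub_pos.2 hq
  rw [Gk_raw ξ q hq]
  set s := ξ.1.2 - q.1.2
  set x := ξ.2
  set y := q.2
  obtain ⟨-, hF⟩ := hC (x * y / s)
  set D := (y - x) ^ 2 / s with hD
  have hD0 : 0 ≤ D := by positivity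
  have hm : max (-(x * y / s)) 0 / 4 ≤ D / 16 := by
    have : max (-(x * y / s)) 0 ≤ D / 4 := by
      refine max_le ?_ (by positivity)
      rw [hD, div_div, ← neg_div, div_le_div_iff₀ hs (by positivity)]
      nlinarith [sq_nonneg (x + y)]
    linarith
  have habs : 1 + |x * y / s| ≤ 1 + 2 * x ^ 2 / s + D / 2 := by
    have : |x * y / s| ≤ 2 * x ^ 2 / s + D / 2 := by
      rw [abs_div, abs_of_pos hs, hD, div_div, div_add_div _ _ hs.ne' (by positivity), div_le_div_iff₀ hs (by positivity)]
      have : |x * y| ≤ 2 * x ^ 2 + (y-x)^2/2 := by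
        rw [abs_le]; constructor <;> nlinarith [sq_nonneg (x + y), sq_nonneg (x - y), sq_nonneg (y - 2*x), sq_nonneg x, sq_nonneg y]
      nlinarith [mul_le_mul_of_nonneg_right this (show 0 ≤ s * (s * 2) by positivity)]
    linarith
  have hexp : (1 + 2 * x ^ 2 / s + D / 2) ≤ (9 + 2 * x ^ 2) * (1 + s⁻¹) * exp (D / 16) := by
    have e1 : D / 16 + 1 ≤ exp (D / 16) := Real.add_one_le_exp _
    have hx : 2 * x ^ 2 / s = 2 * x ^ 2 * s⁻¹ := by rw [div_eq_mul_inv]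
    have hs' : 0 < s⁻¹ := by positivity
    have e2 : 1 ≤ exp (D / 16) := Real.one_le_exp (by positivity)
    have hD2 : D / 2 ≤ 8 * exp (D / 16) := by linarith
    have : 2 * x ^ 2 * s⁻¹ ≤ 2 * x ^ 2 * s⁻¹ * exp (D/16) := by
      have : 0 ≤ 2 * x ^ 2 * s⁻¹ := by positivity
      nlinarith
    rw [hx]
    have h9 : 0 ≤ (9 * s⁻¹ + 2 * x^2) * exp (D/16) := by positivity
    nlinarith
  have key : exp (-(d2 ξ q) / (4 * s)) * Fker a (x * y / s) ≤
      C * ((9 + 2 * x ^ 2) * (1 + s⁻¹)) * exp (-(d2 ξ q) / (8 * s)) := by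
    calc exp (-(d2 ξ q) / (4 * s)) * Fker a (x * y / s)
        ≤ exp (-(d2 ξ q) / (4 * s)) * (C * ((9 + 2 * x ^ 2) * (1 + s⁻¹) * exp (D / 16)) * exp (D / 16)) := by
          gcongr
          refine hF.trans ?_
          gcongr
          exact habs.trans hexp
      _ = C * ((9 + 2 * x ^ 2) * (1 + s⁻¹)) * exp (-(d2 ξ q) / (4 * s) + D / 16 + D / 16) := by
          rw [Real.exp_add, Real.exp_add]; ring
      _ ≤ _ := by
          gcongr
          rw [d2_eq]
          have : 0 ≤ rr ξ q / s := div_nonneg (rr_nonneg ξ q) hs.le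
          have e1 : -(rr ξ q + (y - x) ^ 2) / (4 * s) = -(rr ξ q / s) / 4 - D / 4 := by rw [hD]; field_simp; ring
          have e2 : -(rr ξ q + (y - x) ^ 2) / (8 * s) = -(rr ξ q / s) / 8 - D / 8 := by rw [hD]; field_simp; ring
          rw [e1, e2]; linarith
  calc _ = c0 a m * s ^ (-((m : ℝ) + 1 + a) / 2) * (exp (-(d2 ξ q) / (4 * s)) * Fker a (x * y / s)) := by ring
    _ ≤ c0 a m * s ^ (-((m : ℝ) + 1 + a) / 2) * (C * ((9 + 2 * x ^ 2) * (1 + s⁻¹)) * exp (-(d2 ξ q) / (8 * s))) := by gcongr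
    _ = _ := by ring

/-- `s^{-N}(1+1/s) e^{-k/s}` -/
def og (N k s : ℝ) : ℝ := s ^ (-N) * (1 + s⁻¹) * exp (-k / s)

lemma og_tendsto (N : ℝ) {k : ℝ} (hk : 0 < k) : Tendsto (og N k) (𝓝[>] 0) (𝓝 0) := by
  have h1 := (tendsto_rpow_mul_exp_neg_mul_atTop_nhds_zero N k hk).comp (tendsto_inv_nhdsGT_zero (𝕜 := ℝ))
  have h2 := (tendsto_rpow_mul_exp_neg_mul_atTop_nhds_zero (N+1) k hk).comp (tendsto_inv_nhdsGT_zero (𝕜 := ℝ))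
  have h3 := h1.add h2
  rw [add_zero] at h3
  refine h3.congr' ?_
  filter_upwards [self_mem_nhdsWithin] with s hs
  have hs' : 0 < s := hs
  simp only [Function.comp_apply, og]
  rw [Real.rpow_add (by positivity), Real.rpow_one, Real.inv_rpow hs'.le, Real.rpow_neg hs'.le]
  rw [show -k * s⁻¹ = -k / s by rw [div_eq_mul_inv]]
  ring

lemma og_nonneg (N k : ℝ) {s : ℝ} (hs : 0 < s) : 0 ≤ og N k s := by unfold og; positivity

lemma Gk_far (h1 : -1 < a) (h2 : a < 1) (ξ : Q m) {ε : ℝ} (hε : 0 < ε) : ∃ o : ℝ → ℝ,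
    Tendsto o (𝓝[>] 0) (𝓝 0) ∧ ∀ q : Q m, q.1.2 < ξ.1.2 → ξ.1.2 - q.1.2 ≤ 1 → ε ≤ d2 ξ q →
      Gk a ξ q ≤ o (ξ.1.2 - q.1.2) * exp (-(d2 ξ q) / 16) := by
  obtain ⟨C, hC0, hC⟩ := Gk_bound h1 h2 ξ
  refine ⟨fun s => C * og (((m : ℝ) + 1 + a) / 2) (ε / 16) s, ?_, fun q hq hq1 hd => ?_⟩
  · simpa using (og_tendsto (((m : ℝ) + 1 + a) / 2) (k := ε / 16) (by positivity)).const_mul C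
  · have hs : 0 < ξ.1.2 - q.1.2 := sub_pos.2 hq
    refine (hC q hq).trans ?_
    set s := ξ.1.2 - q.1.2
    rw [mul_assoc C, og, neg_div]
    have : exp (-(d2 ξ q) / (8 * s)) ≤ exp (-(ε / 16) / s) * exp (-(d2 ξ q) / 16) := by
      rw [← Real.exp_add, Real.exp_le_exp]
      have e1 : -(d2 ξ q) / (8 * s) = -(d2 ξ q / 16 / s) - d2 ξ q / 16 / s := by field_simp; ring
      have e2 : ε / 16 / s ≤ d2 ξ q / 16 / s := by gcongr
      have e3 : d2 ξ q / 16 ≤ d2 ξ q / 16 / s := by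
        rw [le_div_iff₀ hs]; nlinarith [d2_nonneg ξ q]
      rw [e1, neg_div, neg_div]; linarith
    calc _ ≤ C * (s ^ (-(((m : ℝ) + 1 + a) / 2)) * (1 + s⁻¹) * (exp (-(ε / 16) / s) * exp (-(d2 ξ q) / 16))) := by gcongr
      _ = _ := by ring

lemma og_bdd {N k S : ℝ} (hk : 0 < k) : ∃ B : ℝ, 0 ≤ B ∧ ∀ s ∈ Ioc 0 S, og N k s ≤ B := by
  have h2 : ∀ᶠ x in 𝓝[>] (0:ℝ), og N k x < 1 := (og_tendsto N hk).eventually (gt_mem_nhds one_pos)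
  obtain ⟨δ, hδ, hδ2⟩ := mem_nhdsGT_iff_exists_Ioo_subset.1 h2
  have hδ' : 0 < δ := hδ
  have hc : ContinuousOn (fun x => og N k x) (Icc δ S) := by
    have : ∀ x ∈ Icc δ S, x ≠ 0 := fun x hx => (lt_of_lt_of_le hδ' hx.1).ne'
    unfold og
    refine ContinuousOn.mul (ContinuousOn.mul (continuousOn_id.rpow_const fun x hx => Or.inl (this x hx)) ?_) ?_
    · exact continuousOn_const.add (continuousOn_id.inv₀ this)
    · exact (continuousOn_const.div continuousOn_id this).rexp
  obtain ⟨B, hB⟩ := (isCompact_Icc.image_of_continuousOn hc).bddAbove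
  refine ⟨max 1 B, le_max_of_le_left zero_le_one, fun x hx => ?_⟩
  by_cases hxd : x < δ
  · exact (le_of_lt (hδ2 ⟨hx.1, hxd⟩)).trans (le_max_left _ _)
  · exact (hB ⟨x, ⟨not_lt.1 hxd, hx.2⟩, rfl⟩).trans (le_max_right _ _)

lemma Gk_bdd (h1 : -1 < a) (h2 : a < 1) (ξ : Q m) {c : ℝ} (hc : 0 < c) :
    ∃ R : ℝ, ∀ q : Q m, c < Gk a ξ q → q.1.2 < ξ.1.2 ∧ ξ.1.2 - q.1.2 ≤ R ∧ d2 ξ q ≤ R := by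
  obtain ⟨C, hC0, hC⟩ := Gk_bound h1 h2 ξ
  set N := ((m : ℝ) + 1 + a) / 2 with hN
  have hN0 : 0 < N := by
    have : (0:ℝ) ≤ m := Nat.cast_nonneg m
    rw [hN]; linarith
  have hlim : Tendsto (fun s : ℝ => C * (s ^ (-N) * 2)) atTop (𝓝 (C * (0 * 2))) :=
    ((tendsto_rpow_neg_atTop hN0).mul_const 2).const_mul C
  simp only [zero_mul, mul_zero] at hlim
  obtain ⟨S, hS⟩ := eventually_atTop.1 (hlim.eventually (gt_mem_nhds hc))
  set S0 := max S 1
  have hS1 : 1 ≤ S0 := le_max_right _ _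
  obtain ⟨B, hB0, hB⟩ := og_bdd (N := N) (k := 1 / 16) (S := S0) (by norm_num)
  have hlim2 : Tendsto (fun d : ℝ => C * B * exp (-(d / (16 * S0)))) atTop (𝓝 (C * B * 0)) :=
    (Real.tendsto_exp_neg_atTop_nhds_zero.comp (tendsto_id.atTop_div_const (by positivity))).const_mul _
  rw [mul_zero] at hlim2
  obtain ⟨R, hR⟩ := eventually_atTop.1 (hlim2.eventually (gt_mem_nhds hc))
  refine ⟨max S0 (max R 1), fun q hq => ?_⟩
  have hlt : q.1.2 < ξ.1.2 := by
    by_contra h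
    rw [Gk_zero ξ q (not_lt.1 h)] at hq
    linarith
  have hs : 0 < ξ.1.2 - q.1.2 := sub_pos.2 hlt
  have hb := hC q hlt
  set s := ξ.1.2 - q.1.2
  rw [show -((m : ℝ) + 1 + a) / 2 = -N by rw [hN]; ring] at hb
  have hd0 := d2_nonneg ξ q
  have hsS : s ≤ S0 := by
    by_contra h
    push Not at h
    have hs1 : 1 ≤ s := hS1.trans h.le
    have := hS s ((le_max_left _ _).trans h.le)
    have h3 : C * (s ^ (-N) * (1 + s⁻¹) * exp (-(d2 ξ q) / (8 * s))) ≤ C * (s ^ (-N) * 2 * 1) := by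
      gcongr
      · have : s⁻¹ ≤ 1 := inv_le_one_of_one_le₀ hs1
        linarith
      · rw [Real.exp_le_one_iff, neg_div]
        have : 0 ≤ d2 ξ q / (8 * s) := by positivity
        linarith
    linarith
  refine ⟨hlt, hsS.trans (le_max_left _ _), ?_⟩
  by_contra h
  push Not at h
  have hR1 : R ≤ d2 ξ q := ((le_max_left _ _).trans (le_max_right _ _)).trans h.le
  have h11 : 1 ≤ d2 ξ q := ((le_max_right _ _).trans (le_max_right _ _)).trans h.le
  have h4 := hR _ hR1
  have h5 := hB s ⟨hs, hsS⟩
  have : exp (-(d2 ξ q) / (8 * s)) ≤ exp (-(1 / 16) / s) * exp (-(d2 ξ q / (16 * S0))) := by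
    rw [← Real.exp_add, Real.exp_le_exp]
    have e1 : -(d2 ξ q) / (8 * s) = -(d2 ξ q / 16 / s) - d2 ξ q / (16 * s) := by field_simp; ring
    have e2 : 1 / 16 / s ≤ d2 ξ q / 16 / s := by gcongr
    have e3 : d2 ξ q / (16 * S0) ≤ d2 ξ q / (16 * s) := by gcongr
    rw [e1, neg_div]; linarith
  have h6 : C * (s ^ (-N) * (1 + s⁻¹) * exp (-(d2 ξ q) / (8 * s))) ≤ C * B * exp (-(d2 ξ q / (16 * S0))) := by
    calc _ ≤ C * (s ^ (-N) * (1 + s⁻¹) * (exp (-(1 / 16) / s) * exp (-(d2 ξ q / (16 * S0))))) := by gcongr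
      _ = C * (og N (1/16) s) * exp (-(d2 ξ q / (16 * S0))) := by unfold og; ring
      _ ≤ _ := by gcongr
  linarith

end MV
end

noncomputable section
open Real MeasureTheory Set Filter Topology

namespace MV
variable {m : ℕ} {a : ℝ}

/-- the complement of the characteristic hyperplane -/
def Om (m : ℕ) : Set (Q m) := {q | q.2 ≠ 0}

lemma Om_open : IsOpen (Om m) := isOpen_ne_fun continuous_snd continuous_const

instance : (volume : Measure (P m)).IsAddHaarMeasure := by
  rw [Measure.volume_eq_prod]; infer_instance

/-- integration by parts for compactly supported functions -/
lemma ibp {φ φ' ψ ψ' : P m → ℝ} {d : P m} (hφ : Continuous φ) (hφ' : Continuous φ')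
    (hψ : Continuous ψ) (hψ' : Continuous ψ') (sφ : HasCompactSupport φ) (sφ' : HasCompactSupport φ')
    (h : ∀ x, HasLineDerivAt ℝ φ (φ' x) x d) (k : ∀ x, HasLineDerivAt ℝ ψ (ψ' x) x d) :
    ∫ x, φ x * ψ' x = - ∫ x, φ' x * ψ x := by
  have := integral_bilinear_hasLineDerivAt_right_eq_neg_left_of_integrable
    (μ := (volume : Measure (P m))) (f := φ) (f' := φ') (g := ψ) (g' := ψ') (v := d)
    (B := ContinuousLinearMap.mul ℝ ℝ) ?_ ?_ ?_ (fun x _ => h x) (fun x _ => k x)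
  · simpa using this
  · exact (hφ'.mul hψ).integrable_of_hasCompactSupport sφ'.mul_right
  · exact (hφ.mul hψ').integrable_of_hasCompactSupport sφ.mul_right
  · exact (hφ.mul hψ).integrable_of_hasCompactSupport sφ.mul_right

/-- partial convolution in the tangential variables -/
def cv (φ : P m → ℝ) (g : Q m → ℝ) (q : Q m) : ℝ := ∫ p', φ p' * g (q.1 - p', q.2)

lemma cv_contOn {φ : P m → ℝ} {g : Q m → ℝ} (hφ : Continuous φ) (sφ : HasCompactSupport φ)
    (hg : ContinuousOn g (Om m)) : ContinuousOn (cv φ g) (Om m) := by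
  refine continuousOn_integral_of_compact_support (f := fun (q : Q m) (p' : P m) => φ p' * g (q.1 - p', q.2))
    (k := tsupport φ) sφ ?_ ?_
  · refine ContinuousOn.mul (hφ.comp continuous_snd).continuousOn ?_
    refine hg.comp (f := fun z : Q m × P m => ((z.1.1 - z.2, z.1.2) : Q m)) (by fun_prop) ?_
    rintro ⟨q, p'⟩ h
    exact h.1
  · intro q p' _ hp
    rw [image_eq_zero_of_notMem_tsupport hp, zero_mul]

lemma cv_cont {φ : P m → ℝ} {g : Q m → ℝ} (hφ : Continuous φ) (sφ : HasCompactSupport φ)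
    (hg : Continuous g) : Continuous (cv φ g) := by
  rw [← continuousOn_univ]
  refine continuousOn_integral_of_compact_support (f := fun (q : Q m) (p' : P m) => φ p' * g (q.1 - p', q.2))
    (k := tsupport φ) sφ ?_ ?_
  · refine ContinuousOn.mul (hφ.comp continuous_snd).continuousOn ?_
    exact (hg.comp (f := fun z : Q m × P m => ((z.1.1 - z.2, z.1.2) : Q m)) (by fun_prop)).continuousOn
  · intro q p' _ hp
    rw [image_eq_zero_of_notMem_tsupport hp, zero_mul]

lemma slice_cont {g : Q m → ℝ} (hg : ContinuousOn g (Om m)) {y : ℝ} (hy : y ≠ 0) (p : P m) :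
    Continuous (fun p' => g (p - p', y)) := by
  rw [← continuousOn_univ]
  exact hg.comp (f := fun z : P m => ((p - z, y) : Q m)) (by fun_prop) (fun _ _ => hy)

lemma line_shift {E : Type*} [NormedAddCommGroup E] [NormedSpace ℝ E] {g : E → ℝ} {g' : ℝ} {q d : E} {t : ℝ}
    (h : HasLineDerivAt ℝ g g' (q + t • d) d) : HasDerivAt (fun s : ℝ => g (q + s • d)) g' t := by
  have h' : HasDerivAt (fun s : ℝ => g (q + t • d + s • d)) g' (t - t) := by
    rw [sub_self]; exact h
  have := HasDerivAt.comp (h := fun s : ℝ => s - t) t h' ((hasDerivAt_id t).sub_const t)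
  simp only [mul_one] at this
  refine this.congr_of_eventuallyEq (Eventually.of_forall fun s => ?_)
  simp only [Function.comp, id, sub_smul]
  congr 1; abel

lemma cv_line {φ : P m → ℝ} {g g' : Q m → ℝ} {d : Q m} (hφ : Continuous φ) (sφ : HasCompactSupport φ)
    (hg : ContinuousOn g (Om m)) (hg' : ContinuousOn g' (Om m))
    (h : ∀ q ∈ Om m, HasLineDerivAt ℝ g (g' q) q d) : ∀ q ∈ Om m, HasLineDerivAt ℝ (cv φ g) (cv φ g' q) q d := by
  intro q hq
  have hq' : q.2 ≠ 0 := hq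
  have hnear : ∀ᶠ t : ℝ in 𝓝 0, q.2 + t * d.2 ≠ 0 := by
    refine ContinuousAt.eventually_ne (by fun_prop) ?_
    simpa using hq'
  obtain ⟨ε, hε, hb⟩ := Metric.eventually_nhds_iff_ball.1 hnear
  set G : ℝ × P m → ℝ := fun z => φ z.2 * g' (q.1 + z.1 • d.1 - z.2, q.2 + z.1 * d.2) with hG
  have hcomp : IsCompact (Icc (-(ε/2)) (ε/2) ×ˢ tsupport φ) := isCompact_Icc.prod sφ
  have hmem : ∀ t ∈ Icc (-(ε/2)) (ε/2), q.2 + t * d.2 ≠ 0 := by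
    intro t ht
    apply hb
    rw [Metric.mem_ball, Real.dist_eq, sub_zero, abs_lt]
    constructor <;> linarith [ht.1, ht.2]
  have hGc : ContinuousOn G (Icc (-(ε/2)) (ε/2) ×ˢ tsupport φ) := by
    refine ContinuousOn.mul (hφ.comp continuous_snd).continuousOn ?_
    refine hg'.comp (f := fun z : ℝ × P m => ((q.1 + z.1 • d.1 - z.2, q.2 + z.1 * d.2) : Q m)) (by fun_prop) ?_
    rintro ⟨t, p⟩ ht
    exact hmem t ht.1
  obtain ⟨C, hC⟩ := hcomp.exists_bound_of_continuousOn hGc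
  have key := hasDerivAt_integral_of_dominated_loc_of_deriv_le (μ := (volume : Measure (P m)))
    (x₀ := (0:ℝ)) (s := Icc (-(ε/2)) (ε/2))
    (F := fun t p' => φ p' * g (q.1 + t • d.1 - p', q.2 + t * d.2))
    (F' := fun t p' => φ p' * g' (q.1 + t • d.1 - p', q.2 + t * d.2))
    (bound := (tsupport φ).indicator (fun _ => C))
    (Icc_mem_nhds (by linarith) (by linarith)) ?_ ?_ ?_ ?_ ?_ ?_
  · have := key.2
    simp only [zero_smul, add_zero, zero_mul] at this
    exact this
  · filter_upwards [hnear] with t ht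
    exact (hφ.mul (slice_cont hg ht _)).aestronglyMeasurable
  · have : q.2 + 0 * d.2 ≠ 0 := by simpa using hq'
    exact (hφ.mul (slice_cont hg this _)).integrable_of_hasCompactSupport sφ.mul_right
  · have : q.2 + 0 * d.2 ≠ 0 := by simpa using hq'
    exact (hφ.mul (slice_cont hg' this _)).aestronglyMeasurable
  · refine Eventually.of_forall fun p' t ht => ?_
    by_cases hp : p' ∈ tsupport φ
    · rw [indicator_of_mem hp]
      exact hC (t, p') ⟨ht, hp⟩
    · rw [indicator_of_notMem hp, image_eq_zero_of_notMem_tsupport hp]; simp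
  · rw [integrable_indicator_iff sφ.measurableSet]
    exact integrableOn_const sφ.measure_ne_top
  · refine Eventually.of_forall fun p' t ht => ?_
    refine HasDerivAt.const_mul _ ?_
    have h0 := h ((q.1 - p', q.2) + t • d) (by simpa [Om] using hmem t ht)
    have h3 := line_shift h0
    have e : ∀ s : ℝ, (q.1 - p', q.2) + s • d = (q.1 + s • d.1 - p', q.2 + s * d.2) := by
      intro s
      ext1
      · simp [add_sub_right_comm]
      · simp
    simp only [e] at h3
    exact h3

lemma cv_ibp {φ φ' : P m → ℝ} {g g' : Q m → ℝ} {d : P m} (hφ : Continuous φ) (sφ : HasCompactSupport φ)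
    (hφ' : Continuous φ') (sφ' : HasCompactSupport φ') (hd : ∀ x, HasLineDerivAt ℝ φ (φ' x) x d)
    (hg : ContinuousOn g (Om m)) (hg' : ContinuousOn g' (Om m))
    (h : ∀ q ∈ Om m, HasLineDerivAt ℝ g (g' q) q (d, 0)) : ∀ q ∈ Om m, cv φ g' q = cv φ' g q := by
  intro q hq
  have := ibp (d := d) (ψ := fun p' => g (q.1 - p', q.2)) (ψ' := fun p' => - g' (q.1 - p', q.2)) hφ hφ'
    (slice_cont hg hq _) (slice_cont hg' hq _).neg sφ sφ' hd ?_
  · simp only [mul_neg, integral_neg, neg_inj] at this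
    exact this
  · intro x
    have h0 := h (q.1 - x, q.2) hq
    have h3 : HasDerivAt (fun t : ℝ => g ((q.1 - x, q.2) + t • (d, 0))) (g' (q.1 - x, q.2)) (-0) := by
      rw [neg_zero]; exact h0
    have := h3.comp (0:ℝ) (hasDerivAt_neg (0:ℝ))
    simp only [mul_neg, mul_one] at this
    refine this.congr_of_eventuallyEq (Eventually.of_forall fun s => ?_)
    simp only [Function.comp]
    congr 1
    ext1
    · simp [sub_eq_add_neg]; abel
    · simp

/-- `g` is continuous, and `C²` (in a directional sense) off the hyperplane -/
structure Reg (g : Q m → ℝ) (g1 g2 : Q m → Q m → ℝ) : Prop where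
  h1 : ∀ d, ∀ q ∈ Om m, HasLineDerivAt ℝ g (g1 d q) q d
  h2 : ∀ d, ∀ q ∈ Om m, HasLineDerivAt ℝ (g1 d) (g2 d q) q d
  c : Continuous g
  c1 : ∀ d, ContinuousOn (g1 d) (Om m)
  c2 : ∀ d, ContinuousOn (g2 d) (Om m)

def ey : Q m := (0, 1)

def Lop (a : ℝ) (g1 g2 : Q m → Q m → ℝ) (q : Q m) : ℝ :=
  g1 (dt, 0) q - ∑ i, g2 (di i, 0) q - g2 ey q - a / q.2 * g1 ey q

lemma Reg.cv {φ : P m → ℝ} (hφ : Continuous φ) (sφ : HasCompactSupport φ) {g : Q m → ℝ} {g1 g2 : Q m → Q m → ℝ}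
    (h : Reg g g1 g2) : Reg (cv φ g) (fun d => cv φ (g1 d)) (fun d => cv φ (g2 d)) where
  h1 d := cv_line hφ sφ h.c.continuousOn (h.c1 d) (h.h1 d)
  h2 d := cv_line hφ sφ (h.c1 d) (h.c2 d) (h.h2 d)
  c := cv_cont hφ sφ h.c
  c1 d := cv_contOn hφ sφ (h.c1 d)
  c2 d := cv_contOn hφ sφ (h.c2 d)

lemma Reg.add {f g : Q m → ℝ} {f1 f2 g1 g2 : Q m → Q m → ℝ} (hf : Reg f f1 f2) (hg : Reg g g1 g2) :
    Reg (fun q => f q + g q) (fun d q => f1 d q + g1 d q) (fun d q => f2 d q + g2 d q) where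
  h1 d q hq := HasDerivAt.add (hf.h1 d q hq) (hg.h1 d q hq)
  h2 d q hq := HasDerivAt.add (hf.h2 d q hq) (hg.h2 d q hq)
  c := hf.c.add hg.c
  c1 d := (hf.c1 d).add (hg.c1 d)
  c2 d := (hf.c2 d).add (hg.c2 d)

lemma Reg.smul {f : Q m → ℝ} {f1 f2 : Q m → Q m → ℝ} (hf : Reg f f1 f2) (k : ℝ) :
    Reg (fun q => k * f q) (fun d q => k * f1 d q) (fun d q => k * f2 d q) where
  h1 d q hq := HasDerivAt.const_mul k (hf.h1 d q hq)
  h2 d q hq := HasDerivAt.const_mul k (hf.h2 d q hq)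
  c := hf.c.const_mul k
  c1 d := (hf.c1 d).const_mul k
  c2 d := (hf.c2 d).const_mul k

/-- tangential translation -/
lemma Reg.trans {f : Q m → ℝ} {f1 f2 : Q m → Q m → ℝ} (hf : Reg f f1 f2) (p : P m) :
    Reg (fun q => f (q.1 - p, q.2)) (fun d q => f1 d (q.1 - p, q.2)) (fun d q => f2 d (q.1 - p, q.2)) := by
  have e : ∀ (q d : Q m) (t : ℝ), (((q + t • d).1 - p, (q + t • d).2) : Q m) = (q.1 - p, q.2) + t • d := by
    intro q d t
    ext1
    · simp [add_sub_right_comm]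
    · simp
  refine ⟨fun d q hq => ?_, fun d q hq => ?_, hf.c.comp (by fun_prop), fun d => ?_, fun d => ?_⟩
  · have := hf.h1 d (q.1 - p, q.2) hq
    unfold HasLineDerivAt at this ⊢
    simpa only [e] using this
  · have := hf.h2 d (q.1 - p, q.2) hq
    unfold HasLineDerivAt at this ⊢
    simpa only [e] using this
  · exact (hf.c1 d).comp (by fun_prop) (fun q hq => hq)
  · exact (hf.c2 d).comp (by fun_prop) (fun q hq => hq)

/-- reflection -/
def rf (q : Q m) : Q m := (q.1, -q.2)

lemma Reg.refl {f : Q m → ℝ} {f1 f2 : Q m → Q m → ℝ} (hf : Reg f f1 f2) :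
    Reg (fun q => f (rf q)) (fun d q => f1 (rf d) (rf q)) (fun d q => f2 (rf d) (rf q)) := by
  have e : ∀ (q d : Q m) (t : ℝ), rf (q + t • d) = rf q + t • rf d := by
    intro q d t
    ext1
    · simp [rf]
    · simp [rf, add_comm]
  have ho : ∀ q ∈ Om m, rf q ∈ Om m := fun q hq => by simpa [Om, rf] using hq
  have hc : Continuous (rf (m := m)) := by unfold rf; fun_prop
  refine ⟨fun d q hq => ?_, fun d q hq => ?_, hf.c.comp hc, fun d => ?_, fun d => ?_⟩
  · have := hf.h1 (rf d) (rf q) (ho q hq)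
    unfold HasLineDerivAt at this ⊢
    simpa only [e] using this
  · have := hf.h2 (rf d) (rf q) (ho q hq)
    unfold HasLineDerivAt at this ⊢
    simpa only [e] using this
  · exact (hf.c1 _).comp hc.continuousOn ho
  · exact (hf.c2 _).comp hc.continuousOn ho

end MV
end

noncomputable section
open Real MeasureTheory Set Filter Topology

namespace MV
variable {m : ℕ} {a : ℝ}

lemma second_test {f f' : ℝ → ℝ} {f'' : ℝ} (hm : IsLocalMax f 0) (h1 : ∀ᶠ t in 𝓝 0, HasDerivAt f (f' t) t)
    (h2 : HasDerivAt f' f'' 0) : f' 0 = 0 ∧ f'' ≤ 0 := by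
  have h0 : f' 0 = 0 := hm.hasDerivAt_eq_zero h1.self_of_nhds
  refine ⟨h0, ?_⟩
  by_contra hc
  push Not at hc
  have e : deriv f =ᶠ[𝓝 0] f' := h1.mono fun t ht => ht.deriv
  have hd : HasDerivAt (deriv f) f'' 0 := h2.congr_of_eventuallyEq e
  have hmin := isLocalMin_of_deriv_deriv_pos (f := f) (x₀ := 0) (by rw [hd.deriv]; exact hc)
    (by rw [h1.self_of_nhds.deriv, h0]) h1.self_of_nhds.continuousAt
  have hconst : ∀ᶠ t in 𝓝 (0:ℝ), f t = f 0 := by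
    filter_upwards [hm, hmin] with t a b using le_antisymm a b
  have hz : ∀ᶠ t in 𝓝 (0:ℝ), f' t = 0 := by
    filter_upwards [hconst.eventually_nhds, h1] with t ht h
    have : HasDerivAt f 0 t := (hasDerivAt_const t (f 0)).congr_of_eventuallyEq ht
    exact h.unique this
  have : HasDerivAt f' 0 0 := (hasDerivAt_const (0:ℝ) (0:ℝ)).congr_of_eventuallyEq hz
  exact hc.ne' (h2.unique this)

def Nn (p0 p : P m) : ℝ := ∑ i, (p.1 i - p0.1 i) ^ 2 + (p.2 - p0.2) ^ 2

lemma Nn_di (p0 p : P m) (i : Fin m) (t : ℝ) : Nn p0 (p + t • di i) = Nn p0 p + 2 * t * (p.1 i - p0.1 i) + t ^ 2 := by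
  have e : ∀ j, ((p + t • di i).1 j - p0.1 j) ^ 2 = (p.1 j - p0.1 j) ^ 2 + (if j = i then (2 * t * (p.1 j - p0.1 j) + t ^ 2) else 0) := by
    intro j
    by_cases hj : j = i
    · subst hj; simp [di]; ring
    · simp [di, hj]
  unfold Nn
  simp only [e, Finset.sum_add_distrib, Finset.sum_ite_eq', Finset.mem_univ, if_true]
  simp [di]; ring

lemma Nn_dt (p0 p : P m) (t : ℝ) : Nn p0 (p + t • dt) = Nn p0 p + 2 * t * (p.2 - p0.2) + t ^ 2 := by
  unfold Nn; simp [dt]; ring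

lemma Nn_nonneg (p0 p : P m) : 0 ≤ Nn p0 p := add_nonneg (Finset.sum_nonneg fun _ _ => sq_nonneg _) (sq_nonneg _)
lemma Nn_cont (p0 : P m) : Continuous (Nn p0) := by unfold Nn; fun_prop

lemma Nn_ge (p0 p : P m) : dist p p0 ^ 2 ≤ Nn p0 p := by
  have hs : 0 ≤ ∑ i, (p.1 i - p0.1 i) ^ 2 := Finset.sum_nonneg fun _ _ => sq_nonneg _
  have h : dist p p0 ≤ √(Nn p0 p) := by
    rw [Prod.dist_eq]
    refine max_le ?_ ?_
    · rw [dist_pi_le_iff (Real.sqrt_nonneg _)]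
      intro i
      rw [Real.dist_eq]
      apply Real.abs_le_sqrt
      have := Finset.single_le_sum (f := fun i => (p.1 i - p0.1 i) ^ 2) (fun _ _ => sq_nonneg _) (Finset.mem_univ i)
      unfold Nn
      nlinarith [sq_nonneg (p.2 - p0.2)]
    · rw [Real.dist_eq]
      apply Real.abs_le_sqrt
      unfold Nn; linarith
  calc dist p p0 ^ 2 ≤ √(Nn p0 p) ^ 2 := by gcongr
    _ = _ := Real.sq_sqrt (Nn_nonneg _ _)

lemma maxp (h1 : -1 < a) (h2 : a < 1) {D : Q m → ℝ} {D1 D2 : Q m → Q m → ℝ} (hD : Reg D D1 D2)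
    {p0 : P m} {R Y κ ε : ℝ} (hR : 0 < R) (hR1 : R ≤ 1) (hY : 0 < Y) (hκ : 0 < κ)
    (hL : ∀ q : Q m, q.1 ∈ Metric.ball p0 R → 0 < q.2 → q.2 < Y → Lop a D1 D2 q = 0)
    (hf : ∀ p ∈ Metric.ball p0 R, ∀ᶠ y in 𝓝[>] (0:ℝ), κ < y ^ a * D1 ey (p, y))
    (hDε : ∀ q : Q m, q.1 ∈ Metric.closedBall p0 R → q.2 ∈ Icc 0 Y → |D q| ≤ ε)
    (hY1 : ∀ y ∈ Icc 0 Y, (m + 2) / (1 + a) * y ^ 2 ≤ κ / (2 * (1 - a)) * y ^ (1 - a))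
    (hε1 : 2 * ε < R ^ 2) (hε2 : 2 * ε < κ / (2 * (1 - a)) * Y ^ (1 - a)) : False := by
  have hb : 0 < 1 - a := by linarith
  have ha : 0 < 1 + a := by linarith
  set M : ℝ := (m + 2) / (1 + a) with hM
  set Φ : Q m → ℝ := fun q => D q - κ / (1 - a) * q.2 ^ (1 - a) + M * q.2 ^ 2 - Nn p0 q.1 with hΦ
  have hpow : Continuous (fun q : Q m => q.2 ^ (1 - a)) := continuous_snd.rpow_const (fun _ => Or.inr hb.le)
  have hΦc : Continuous Φ :=
    ((hD.c.sub (hpow.const_mul _)).add ((continuous_snd.pow 2).const_mul _)).sub ((Nn_cont p0).comp continuous_fst)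
  have hK : IsCompact (Metric.closedBall p0 R ×ˢ Icc (0:ℝ) Y) := (isCompact_closedBall p0 R).prod isCompact_Icc
  obtain ⟨q, hqK, hmax⟩ := hK.exists_isMaxOn ⟨(p0, 0), ⟨Metric.mem_closedBall_self hR.le, ⟨le_rfl, hY.le⟩⟩⟩ hΦc.continuousOn
  have hmax' : ∀ z : Q m, z.1 ∈ Metric.closedBall p0 R → z.2 ∈ Icc 0 Y → Φ z ≤ Φ q := fun z a b => hmax ⟨a, b⟩
  have hstart : -ε ≤ Φ q := by
    have := hmax' (p0, 0) (Metric.mem_closedBall_self hR.le) ⟨le_rfl, hY.le⟩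
    have h3 := (abs_le.1 (hDε (p0, 0) (Metric.mem_closedBall_self hR.le) ⟨le_rfl, hY.le⟩)).1
    have h4 : Φ (p0, 0) = D (p0, 0) := by
      simp [hΦ, Nn, Real.zero_rpow hb.ne']
    linarith
  have hDq := (abs_le.1 (hDε q hqK.1 hqK.2)).2
  have hyb : 0 ≤ q.2 ^ (1 - a) := Real.rpow_nonneg hqK.2.1 _
  have hYq := hY1 q.2 hqK.2
  have hhalf : κ / (1 - a) = 2 * (κ / (2 * (1 - a))) := by field_simp
  have hk2 : 0 < κ / (2 * (1 - a)) := by positivity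
  have hup : Φ q ≤ ε - κ / (2 * (1 - a)) * q.2 ^ (1 - a) - Nn p0 q.1 := by
    simp only [hΦ]; rw [hhalf]; nlinarith
  have hball : q.1 ∈ Metric.ball p0 R := by
    by_contra hc
    rw [Metric.mem_ball, not_lt] at hc
    have := Nn_ge p0 q.1
    have h5 : R ^ 2 ≤ dist q.1 p0 ^ 2 := by gcongr
    nlinarith [mul_nonneg hk2.le hyb]
  have hyY : q.2 < Y := by
    rcases lt_or_eq_of_le hqK.2.2 with h | h
    · exact h
    · rw [h] at hup
      have := Nn_nonneg p0 q.1
      linarith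
  have hderiv : ∀ p : P m, ∀ y : ℝ, 0 < y → HasDerivAt (fun s => Φ (p, s)) (D1 ey (p, y) - κ * y ^ (-a) + M * (2 * y)) y := by
    intro p y hy
    have hd : HasDerivAt (fun s => D (p, s)) (D1 ey (p, y)) y := by
      have h3 := line_shift (q := ((p, 0) : Q m)) (d := ey) (t := y) (g := D) (g' := D1 ey (p, y)) (by
        have e : ((p, 0) : Q m) + y • ey = (p, y) := by simp [ey]
        rw [e]; exact hD.h1 ey (p, y) hy.ne')
      simpa [ey] using h3
    have hp : HasDerivAt (fun s : ℝ => s ^ (1 - a)) ((1 - a) * y ^ (1 - a - 1)) y :=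
      Real.hasDerivAt_rpow_const (Or.inl hy.ne')
    have h3 := ((hd.sub (hp.const_mul (κ / (1 - a)))).add (((hasDerivAt_id y).pow 2).const_mul M)).sub_const (Nn p0 p)
    refine h3.congr_deriv ?_
    have : (1 - a - 1) = -a := by ring
    rw [this]; simp; field_simp
  rcases eq_or_lt_of_le hqK.2.1 with hy0 | hy0
  · -- boundary point
    obtain ⟨δ, hδ, hev⟩ := mem_nhdsGT_iff_exists_Ioo_subset.1 (hf q.1 hball)
    set z := min (δ / 2) Y with hz
    have hδ' : 0 < δ := hδ
    have hz0 : 0 < z := lt_min (by linarith) hY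
    have hzδ : z < δ := (min_le_left _ _).trans_lt (by linarith)
    have hmono : StrictMonoOn (fun s => Φ (q.1, s)) (Icc 0 z) := by
      refine strictMonoOn_of_deriv_pos (convex_Icc _ _) (hΦc.comp (by fun_prop)).continuousOn ?_
      intro y hy
      rw [interior_Icc] at hy
      rw [(hderiv q.1 y hy.1).deriv]
      have h3 : κ < y ^ a * D1 ey (q.1, y) := hev ⟨hy.1, hy.2.trans hzδ⟩
      have hya : 0 < y ^ a := Real.rpow_pos_of_pos hy.1 a
      have : κ * y ^ (-a) < D1 ey (q.1, y) := by
        rw [Real.rpow_neg hy.1.le, ← div_eq_mul_inv, div_lt_iff₀ hya, mul_comm]; exact h3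
      have hMp : 0 < M := by positivity
      have := hy.1
      have : 0 < M * (2 * y) := by positivity
      linarith
    have h6 := hmono ⟨le_rfl, hz0.le⟩ ⟨hz0.le, le_rfl⟩ hz0
    have h7 := hmax' (q.1, z) hqK.1 ⟨hz0.le, min_le_right _ _⟩
    have h8 : Φ q = Φ (q.1, 0) := by rw [hy0]
    simp only at h6
    linarith
  · -- interior point
    have hloc : IsLocalMax Φ q := by
      have : (Metric.ball p0 R ×ˢ Ioo 0 Y) ∈ 𝓝 q :=
        (Metric.isOpen_ball.prod isOpen_Ioo).mem_nhds ⟨hball, hy0, hyY⟩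
      filter_upwards [this] with z hz
      exact hmax' z (Metric.ball_subset_closedBall hz.1) ⟨hz.2.1.le, hz.2.2.le⟩
    have hlocd : ∀ d : Q m, IsLocalMax (fun t : ℝ => Φ (q + t • d)) 0 := by
      intro d
      have hc : ContinuousAt (fun t : ℝ => q + t • d) 0 := by fun_prop
      have h3 : Tendsto (fun t : ℝ => q + t • d) (𝓝 0) (𝓝 q) := by
        have := hc.tendsto; simpa using this
      have := h3.eventually hloc
      filter_upwards [this] with t ht
      simpa using ht
    have hOm : ∀ d : Q m, ∀ᶠ t : ℝ in 𝓝 0, q + t • d ∈ Om m := by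
      intro d
      have hc : ContinuousAt (fun t : ℝ => q + t • d) 0 := by fun_prop
      apply hc.eventually_mem
      simp only [zero_smul, add_zero]
      exact Om_open.mem_nhds hy0.ne'
    have hτ : D1 (dt, 0) q = 2 * (q.1.2 - p0.2) := by
      have h3 : HasDerivAt (fun t : ℝ => D (q + t • ((dt, 0) : Q m)) - κ / (1 - a) * q.2 ^ (1 - a) + M * q.2 ^ 2
        - (Nn p0 q.1 + 2 * t * (q.1.2 - p0.2) + t ^ 2)) (D1 (dt, 0) q - (2 * (q.1.2 - p0.2))) 0 := by
        have hd : HasDerivAt (fun t : ℝ => D (q + t • ((dt, 0) : Q m))) _ 0 := hD.h1 (dt, 0) q hy0.ne'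
        have hn : HasDerivAt (fun t : ℝ => Nn p0 q.1 + 2 * t * (q.1.2 - p0.2) + t ^ 2) (2 * (q.1.2 - p0.2)) 0 := by
          have := (((((hasDerivAt_id (0:ℝ)).const_mul 2).mul_const (q.1.2 - p0.2)).const_add (Nn p0 q.1)).add ((hasDerivAt_id (0:ℝ)).pow 2))
          refine this.congr_deriv ?_
          simp
        exact ((hd.sub_const _).add_const _).sub hn
      have h4 := hlocd (dt, 0)
      have e : (fun t : ℝ => Φ (q + t • ((dt, 0) : Q m))) = (fun t : ℝ => D (q + t • ((dt, 0) : Q m)) - κ / (1 - a) * q.2 ^ (1 - a) + M * q.2 ^ 2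
        - (Nn p0 q.1 + 2 * t * (q.1.2 - p0.2) + t ^ 2)) := by
        funext t
        simp only [hΦ]
        have : (q + t • ((dt, 0) : Q m)).1 = q.1 + t • dt := rfl
        rw [this, Nn_dt]
        simp
      rw [e] at h4
      have := h4.hasDerivAt_eq_zero h3
      linarith
    have hi : ∀ i, D2 (di i, 0) q ≤ 2 := by
      intro i
      have h4 := hlocd (di i, 0)
      have e : (fun t : ℝ => Φ (q + t • ((di i, 0) : Q m))) = (fun t : ℝ => D (q + t • ((di i, 0) : Q m)) - κ / (1 - a) * q.2 ^ (1 - a) + M * q.2 ^ 2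
        - (Nn p0 q.1 + 2 * t * (q.1.1 i - p0.1 i) + t ^ 2)) := by
        funext t
        simp only [hΦ]
        have : (q + t • ((di i, 0) : Q m)).1 = q.1 + t • di i := rfl
        rw [this, Nn_di]
        simp
      rw [e] at h4
      have h5 := second_test (f' := fun t => D1 (di i, 0) (q + t • ((di i, 0) : Q m)) - (2 * (q.1.1 i - p0.1 i) + 2 * t)) (f'' := D2 (di i, 0) q - 2) h4 ?_ ?_
      · linarith [h5.2]
      · filter_upwards [hOm (di i, 0)] with t ht
        have hd := line_shift (hD.h1 (di i, 0) _ ht)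
        have hn : HasDerivAt (fun t : ℝ => Nn p0 q.1 + 2 * t * (q.1.1 i - p0.1 i) + t ^ 2) (2 * (q.1.1 i - p0.1 i) + 2 * t) t := by
          have := (((((hasDerivAt_id (t:ℝ)).const_mul 2).mul_const (q.1.1 i - p0.1 i)).const_add (Nn p0 q.1)).add ((hasDerivAt_id (t:ℝ)).pow 2))
          refine this.congr_deriv ?_
          simp
        exact ((hd.sub_const _).add_const _).sub hn
      · have hd : HasDerivAt (fun t : ℝ => D1 (di i, 0) (q + t • ((di i, 0) : Q m))) _ 0 := hD.h2 (di i, 0) q hy0.ne'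
        have hn : HasDerivAt (fun t : ℝ => 2 * (q.1.1 i - p0.1 i) + 2 * t) 2 0 := by
          have := (((hasDerivAt_id (0:ℝ)).const_mul 2)).const_add (2 * (q.1.1 i - p0.1 i))
          simpa using this
        exact hd.sub hn
    have hy : D1 ey q - κ * q.2 ^ (-a) + M * (2 * q.2) = 0 ∧ D2 ey q + κ * (a * q.2 ^ (-a) / q.2) + 2 * M ≤ 0 := by
      have h4 := hlocd ey
      have e : (fun t : ℝ => Φ (q + t • ey)) = fun t : ℝ => Φ (q.1, q.2 + t) := by
        funext t; congr 1; ext1 <;> simp [ey]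
      rw [e] at h4
      have hev : ∀ᶠ t : ℝ in 𝓝 0, 0 < q.2 + t := by
        have hc : ContinuousAt (fun t : ℝ => q.2 + t) 0 := by fun_prop
        exact hc.eventually_const_lt (by simpa using hy0)
      have h5 := second_test (f' := fun t => D1 ey (q.1, q.2 + t) - κ * (q.2 + t) ^ (-a) + M * (2 * (q.2 + t)))
        (f'' := D2 ey q - κ * (-a * q.2 ^ (-a-1)) + M * 2) h4 ?_ ?_
      · refine ⟨by simpa using h5.1, ?_⟩
        have h6 := h5.2
        rw [Real.rpow_sub_one hy0.ne'] at h6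
        have : κ * (-a * (q.2 ^ (-a) / q.2)) = - (κ * (a * q.2 ^ (-a) / q.2)) := by ring
        linarith
      · filter_upwards [hev] with t ht
        have := (hderiv q.1 (q.2 + t) ht).comp_const_add q.2 t
        exact this
      · have hd : HasDerivAt (fun t : ℝ => D1 ey (q + t • (ey : Q m))) _ 0 := hD.h2 ey q hy0.ne'
        have e2 : (fun t : ℝ => D1 ey (q + t • (ey : Q m))) = fun t : ℝ => D1 ey (q.1, q.2 + t) := by
          funext t; congr 1; ext1 <;> simp [ey]
        rw [e2] at hd
        have hp : HasDerivAt (fun s : ℝ => (q.2 + s) ^ (-a)) (-a * q.2 ^ (-a - 1)) 0 := by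
          have h7 : HasDerivAt (fun s : ℝ => s ^ (-a)) (-a * q.2 ^ (-a - 1)) (q.2 + 0) := by
            rw [add_zero]; exact Real.hasDerivAt_rpow_const (Or.inl hy0.ne')
          exact h7.comp_const_add q.2 0
        have hl : HasDerivAt (fun s : ℝ => M * (2 * (q.2 + s))) (M * 2) 0 := by
          have := ((((hasDerivAt_id (0:ℝ)).const_add q.2)).const_mul 2).const_mul M
          simpa using this
        exact (hd.sub (hp.const_mul κ)).add hl
    have hLq := hL q hball hy0 hyY
    unfold Lop at hLq
    have hsum : ∑ i, D2 (di i, 0) q ≤ 2 * m := by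
      calc ∑ i, D2 (di i, 0) q ≤ ∑ i : Fin m, (2:ℝ) := Finset.sum_le_sum fun i _ => hi i
        _ = 2 * m := by simp [mul_comm]
    have hdist : |q.1.2 - p0.2| < R := by
      have := Metric.mem_ball.1 hball
      rw [Prod.dist_eq] at this
      exact (le_max_right _ _).trans_lt this
    have hdy : D1 ey q = κ * q.2 ^ (-a) - M * (2 * q.2) := by linarith [hy.1]
    have hay : a / q.2 * D1 ey q = κ * (a * q.2 ^ (-a) / q.2) - 2 * M * a := by
      rw [hdy]; field_simp
    have hMa : M * (1 + a) = m + 2 := by rw [hM]; field_simp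
    have := (abs_lt.1 hdist).1
    nlinarith [hy.2]

end MV
end

noncomputable section
open Real MeasureTheory Set Filter Topology

namespace MV
variable {m : ℕ} {a : ℝ}

lemma Lop_add (f1 f2 g1 g2 : Q m → Q m → ℝ) (q : Q m) (k l : ℝ) :
    Lop a (fun d q => k * f1 d q + l * g1 d q) (fun d q => k * f2 d q + l * g2 d q) q
      = k * Lop a f1 f2 q + l * Lop a g1 g2 q := by
  unfold Lop
  simp only [Finset.sum_add_distrib, ← Finset.mul_sum]
  ring

lemma cv_integrable {φ : P m → ℝ} {g : Q m → ℝ} (hφ : Continuous φ) (sφ : HasCompactSupport φ)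
    (hg : ContinuousOn g (Om m)) {q : Q m} (hq : q ∈ Om m) :
    Integrable (fun p' => φ p' * g (q.1 - p', q.2)) :=
  (hφ.mul (slice_cont hg hq _)).integrable_of_hasCompactSupport sφ.mul_right

lemma Lop_cv {φ : P m → ℝ} (hφ : Continuous φ) (sφ : HasCompactSupport φ) {g : Q m → ℝ} {g1 g2 : Q m → Q m → ℝ}
    (h : Reg g g1 g2) {q : Q m} (hq : q ∈ Om m) :
    Lop a (fun d => cv φ (g1 d)) (fun d => cv φ (g2 d)) q = ∫ p', φ p' * Lop a g1 g2 (q.1 - p', q.2) := by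
  unfold Lop cv
  have i1 := fun d => cv_integrable hφ sφ (h.c1 d) hq
  have i2 := fun d => cv_integrable hφ sφ (h.c2 d) hq
  have e : ∀ p', φ p' * (g1 (dt, 0) (q.1 - p', q.2) - ∑ i, g2 (di i, 0) (q.1 - p', q.2) - g2 ey (q.1 - p', q.2) -
      a / q.2 * g1 ey (q.1 - p', q.2)) = φ p' * g1 (dt, 0) (q.1 - p', q.2) - ∑ i, φ p' * g2 (di i, 0) (q.1 - p', q.2)
      - φ p' * g2 ey (q.1 - p', q.2) - a / q.2 * (φ p' * g1 ey (q.1 - p', q.2)) := by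
    intro p'; rw [← Finset.mul_sum]; ring
  simp only [e]
  have is : Integrable (fun p' => ∑ i : Fin m, φ p' * g2 (di i, 0) (q.1 - p', q.2)) :=
    integrable_finsetSum _ fun i _ => i2 _
  rw [integral_sub, integral_sub, integral_sub, integral_finsetSum, integral_const_mul]
  · exact fun i _ => i2 _
  · exact i1 _
  · exact is
  · exact (i1 _).sub is
  · exact i2 _
  · exact ((i1 _).sub is).sub (i2 _)
  · exact (i1 _).const_mul _

lemma approx {e : Q m → ℝ} {e1 e2 : Q m → Q m → ℝ} (he : Reg e e1 e2) {p0 : P m} {R Y : ℝ} {η : P m → ℝ}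
    (hη : Continuous η) (sη : HasCompactSupport η) (hη0 : ∀ p, 0 ≤ η p) (hη1 : ∫ p, η p = 1)
    (hL : ∀ q : Q m, q.1 ∈ Metric.ball p0 R → 0 < q.2 → q.2 < Y → ∀ p' ∈ tsupport η, Lop a e1 e2 (q.1 - p', q.2) = 0)
    (hf : ∀ p, Tendsto (fun y : ℝ => y ^ a * e1 ey (p, y)) (𝓝[>] 0) (𝓝 0)) {ε : ℝ} (hε : 0 < ε) :
    ∃ E E1 E2, Reg (m := m) E E1 E2 ∧ (∀ q : Q m, q.1 ∈ Metric.ball p0 R → 0 < q.2 → q.2 < Y → Lop a E1 E2 q = 0) ∧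
      (∀ p, Tendsto (fun y : ℝ => y ^ a * E1 ey (p, y)) (𝓝[>] 0) (𝓝 0)) ∧
      ∀ q : Q m, q.1 ∈ Metric.closedBall p0 R → q.2 ∈ Icc 0 Y → |cv η e q - E q| ≤ ε := by
  set K : Set (Q m) := Metric.closedBall p0 R ×ˢ Icc (0:ℝ) Y with hKdef
  have hK : IsCompact K := (isCompact_closedBall p0 R).prod isCompact_Icc
  have : CompactSpace K := isCompact_iff_compactSpace.1 hK
  set A : Set C(K, ℝ) := {f | ∃ E E1 E2, Reg (m := m) E E1 E2 ∧
      (∀ q : Q m, q.1 ∈ Metric.ball p0 R → 0 < q.2 → q.2 < Y → Lop a E1 E2 q = 0) ∧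
      (∀ p, Tendsto (fun y : ℝ => y ^ a * E1 ey (p, y)) (𝓝[>] 0) (𝓝 0)) ∧ ∀ k : K, f k = E k} with hA
  have hconv : Convex ℝ A := by
    rintro f ⟨E, E1, E2, r, l, t, s⟩ g ⟨F, F1, F2, r', l', t', s'⟩ α β _ _ _
    refine ⟨_, _, _, (r.smul α).add (r'.smul β), ?_, ?_, ?_⟩
    · intro q a1 a2 a3
      rw [Lop_add, l q a1 a2 a3, l' q a1 a2 a3]; simp
    · intro p
      have := ((t p).const_mul α).add ((t' p).const_mul β)
      simp only [mul_zero, add_zero] at this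
      refine this.congr fun y => ?_
      ring
    · intro k
      simp [s k, s' k]
  let F2 : C(P m × K, ℝ) := ⟨fun z => e (z.2.1.1 - z.1, z.2.1.2), he.c.comp (by fun_prop)⟩
  let F : C(P m, C(K, ℝ)) := F2.curry
  set μ : Measure (P m) := volume.withDensity (fun p => ENNReal.ofReal (η p)) with hμ
  have hmeas : Measurable (fun p => ENNReal.ofReal (η p)) := hη.measurable.ennreal_ofReal
  have hηi : Integrable η := hη.integrable_of_hasCompactSupport sη
  have : IsProbabilityMeasure μ := by
    constructor
    rw [hμ, withDensity_apply _ MeasurableSet.univ, Measure.restrict_univ,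
      ← ofReal_integral_eq_lintegral_ofReal hηi (Eventually.of_forall hη0), hη1, ENNReal.ofReal_one]
  have hlt : ∀ᵐ p ∂(volume : Measure (P m)), ENNReal.ofReal (η p) < ⊤ := Eventually.of_forall fun p => ENNReal.ofReal_lt_top
  have htr : ∀ p, (ENNReal.ofReal (η p)).toReal = η p := fun p => ENNReal.toReal_ofReal (hη0 p)
  have hFi0 : Integrable (fun p => η p • F p) := by
    refine Continuous.integrable_of_hasCompactSupport (hη.smul F.continuous) ?_
    exact sη.smul_right
  have hFi : Integrable F μ := by
    rw [hμ, integrable_withDensity_iff_integrable_smul' hmeas hlt]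
    simpa only [htr] using hFi0
  have hmem : ∫ p, F p ∂μ ∈ closure A := by
    refine Convex.integral_mem hconv.closure isClosed_closure ?_ hFi
    rw [hμ, ae_withDensity_iff hmeas]
    refine Eventually.of_forall fun p hp => subset_closure ?_
    have hp' : p ∈ tsupport η := by
      apply subset_tsupport
      intro h0; simp [h0] at hp
    refine ⟨_, _, _, he.trans p, ?_, ?_, ?_⟩
    · intro q a1 a2 a3
      exact hL q a1 a2 a3 p hp'
    · intro p1; exact hf (p1 - p)
    · intro k; rfl
  obtain ⟨g, ⟨E, E1, E2, r, l, t, s⟩, hd⟩ := Metric.mem_closure_iff.1 hmem ε hε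
  refine ⟨E, E1, E2, r, l, t, ?_⟩
  intro q a1 a2
  have hk : q ∈ K := ⟨a1, a2⟩
  have h3 := (ContinuousMap.dist_apply_le_dist (f := ∫ p, F p ∂μ) (g := g) (⟨q, hk⟩ : K)).trans hd.le
  rw [ContinuousMap.integral_apply hFi, s, Real.dist_eq] at h3
  rw [hμ, integral_withDensity_eq_integral_toReal_smul hmeas hlt] at h3
  simp only [htr] at h3
  exact h3

lemma no_flux_pos (h1 : -1 < a) (h2 : a < 1) {e : Q m → ℝ} {e1 e2 : Q m → Q m → ℝ} (he : Reg e e1 e2) {p0 : P m} {R Y κ : ℝ} {η : P m → ℝ}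
    (hη : Continuous η) (sη : HasCompactSupport η) (hη0 : ∀ p, 0 ≤ η p) (hη1 : ∫ p, η p = 1)
    (hR : 0 < R) (hY : 0 < Y) (hκ : 0 < κ)
    (hL : ∀ q : Q m, q.1 ∈ Metric.ball p0 R → 0 < q.2 → q.2 < Y → ∀ p' ∈ tsupport η, Lop a e1 e2 (q.1 - p', q.2) = 0)
    (hf : ∀ p, Tendsto (fun y : ℝ => y ^ a * e1 ey (p, y)) (𝓝[>] 0) (𝓝 0))
    (hS : ∀ p ∈ Metric.ball p0 R, ∀ y, 0 < y → y < Y → 2 * κ ≤ y ^ a * cv η (e1 ey) (p, y)) : False := by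
  have hb : 0 < 1 - a := by linarith
  have ha : 0 < 1 + a := by linarith
  set R' := min R 1 with hR'
  have hR'0 : 0 < R' := lt_min hR one_pos
  -- choice of the height
  have hYex : ∃ Y' > 0, Y' ≤ Y ∧ ∀ y ∈ Icc 0 Y', ((m:ℝ) + 2) / (1 + a) * y ^ 2 ≤ κ / (2 * (1 - a)) * y ^ (1 - a) := by
    have hc : Tendsto (fun y : ℝ => ((m:ℝ) + 2) / (1 + a) * y ^ (1 + a)) (𝓝 0) (𝓝 0) := by
      have hc : ContinuousAt (fun y : ℝ => ((m:ℝ) + 2) / (1 + a) * y ^ (1 + a)) 0 :=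
        continuousAt_const.mul (continuousAt_id.rpow_const (Or.inr ha.le))
      have := hc.tendsto
      simpa [Real.zero_rpow ha.ne'] using this
    have hk : 0 < κ / (2 * (1 - a)) := by positivity
    obtain ⟨δ, hδ, hb2⟩ := Metric.eventually_nhds_iff.1 (hc.eventually_lt_const hk)
    refine ⟨min (δ/2) Y, lt_min (by linarith) hY, min_le_right _ _, ?_⟩
    intro y hy
    rcases eq_or_lt_of_le hy.1 with h0 | h0
    · rw [← h0]; simp [Real.zero_rpow hb.ne']
    · have h3 := hb2 (y := y) (by
        rw [Real.dist_eq, sub_zero, abs_of_pos h0]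
        have := hy.2.trans (min_le_left _ _)
        linarith)
      have e : y ^ 2 = y ^ (1 + a) * y ^ (1 - a) := by
        rw [← Real.rpow_add h0, ← Real.rpow_natCast]; congr 1; push_cast; ring
      rw [e, ← mul_assoc]
      have := Real.rpow_nonneg hy.1 (1 - a)
      gcongr
  obtain ⟨Y', hY'0, hY'Y, hY1⟩ := hYex
  have hYp : 0 < κ / (2 * (1 - a)) * Y' ^ (1 - a) := by positivity
  set ε := min (R' ^ 2) (κ / (2 * (1 - a)) * Y' ^ (1 - a)) / 4 with hε
  have hε0 : 0 < ε := by
    have : 0 < min (R' ^ 2) (κ / (2 * (1 - a)) * Y' ^ (1 - a)) := lt_min (by positivity) hYp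
    positivity
  have hsub : Metric.ball p0 R' ⊆ Metric.ball p0 R := Metric.ball_subset_ball (min_le_left _ _)
  obtain ⟨E, E1, E2, r, l, t, s⟩ := approx (a := a) (Y := Y') (R := R') (p0 := p0) he hη sη hη0 hη1
    (fun q a1 a2 a3 => hL q (hsub a1) a2 (a3.trans_le hY'Y)) hf hε0
  have hmin1 := min_le_left (R' ^ 2) (κ / (2 * (1 - a)) * Y' ^ (1 - a))
  have hmin2 := min_le_right (R' ^ 2) (κ / (2 * (1 - a)) * Y' ^ (1 - a))
  have hreg := ((he.cv hη sη).smul 1).add (r.smul (-1))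
  refine maxp (ε := ε) (p0 := p0) h1 h2 hreg hR'0 (min_le_right _ _) hY'0 hκ ?_ ?_ ?_ hY1 ?_ ?_
  · intro q a1 a2 a3
    rw [Lop_add, l q a1 a2 a3, Lop_cv hη sη he a2.ne']
    have : ∀ p', η p' * Lop a e1 e2 (q.1 - p', q.2) = 0 := by
      intro p'
      by_cases hp : p' ∈ tsupport η
      · rw [hL q (hsub a1) a2 (a3.trans_le hY'Y) p' hp, mul_zero]
      · rw [image_eq_zero_of_notMem_tsupport hp, zero_mul]
    simp [this]
  · intro p hp
    have hev := (t p).eventually_lt_const hκ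
    have hpos : ∀ᶠ y : ℝ in 𝓝[>] 0, 0 < y ∧ y < Y := by
      filter_upwards [Ioo_mem_nhdsGT hY] with y hy using hy
    filter_upwards [hev, hpos] with y a1 a2
    have := hS p (hsub hp) y a2.1 a2.2
    rw [one_mul, mul_add]
    linarith
  · intro q a1 a2
    have := s q a1 a2
    rwa [one_mul, neg_one_mul, ← sub_eq_add_neg]
  · rw [hε]; have : 0 < R' ^ 2 := by positivity
    linarith
  · rw [hε]; linarith

end MV
end

noncomputable section
open Real MeasureTheory Set Filter Topology

namespace MV
variable {m : ℕ} {a : ℝ}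

/-- the tangential heat operator applied to the mollifier -/
def fη (η : P m → ℝ) (p : P m) : ℝ :=
  fderiv ℝ η p dt - ∑ i, fderiv ℝ (fun p => fderiv ℝ η p (di i)) p (di i)

section mol
variable {η : P m → ℝ}


lemma mol_d1 (hη : ContDiff ℝ 2 η) (d : P m) : ContDiff ℝ 1 (fun p => fderiv ℝ η p d) := by
  have := hη.fderiv_right (m := 1) (by norm_num)
  exact this.clm_apply contDiff_const

lemma mol_c2 (hη : ContDiff ℝ 2 η) (d : P m) : Continuous (fun p => fderiv ℝ (fun p => fderiv ℝ η p d) p d) :=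
  ((mol_d1 hη d).continuous_fderiv (by norm_num)).clm_apply continuous_const

lemma mol_l1 (hη : ContDiff ℝ 2 η) (d p : P m) : HasLineDerivAt ℝ η (fderiv ℝ η p d) p d :=
  (hη.differentiable (by norm_num) p).hasFDerivAt.hasLineDerivAt d

lemma mol_l2 (hη : ContDiff ℝ 2 η) (d p : P m) : HasLineDerivAt ℝ (fun p => fderiv ℝ η p d) (fderiv ℝ (fun p => fderiv ℝ η p d) p d) p d :=
  ((mol_d1 hη d).differentiable (by norm_num) p).hasFDerivAt.hasLineDerivAt d

lemma fη_cont (hη : ContDiff ℝ 2 η) : Continuous (fη η) :=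
  (mol_d1 hη dt).continuous.sub (continuous_finsetSum _ fun i _ => mol_c2 hη (di i))




lemma mol_s1 (sη : HasCompactSupport η) (d : P m) : HasCompactSupport (fun p => fderiv ℝ η p d) := by
  exact (sη.fderiv ℝ).comp_left (g := fun L : P m →L[ℝ] ℝ => L d) (by simp)

lemma mol_s2 (sη : HasCompactSupport η) (d : P m) : HasCompactSupport (fun p => fderiv ℝ (fun p => fderiv ℝ η p d) p d) := by
  exact ((mol_s1 sη d).fderiv ℝ).comp_left (g := fun L : P m →L[ℝ] ℝ => L d) (by simp)

lemma fη_supp (sη : HasCompactSupport η) : HasCompactSupport (fη η) := by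
  unfold fη
  have : HasCompactSupport (fun p => ∑ i : Fin m, fderiv ℝ (fun p => fderiv ℝ η p (di i)) p (di i)) := by
    refine HasCompactSupport.intro' (K := tsupport η) sη (isClosed_tsupport _) fun x hx => ?_
    refine Finset.sum_eq_zero fun i _ => ?_
    have h0 : (fun p => fderiv ℝ η p (di i)) =ᶠ[𝓝 x] fun _ => 0 := by
      have hx' : ∀ᶠ z in 𝓝 x, z ∉ tsupport η := (isClosed_tsupport η).isOpen_compl.mem_nhds hx
      filter_upwards [hx'] with z hz
      have : z ∉ tsupport (fderiv ℝ η) := fun h => hz (tsupport_fderiv_subset ℝ h)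
      rw [image_eq_zero_of_notMem_tsupport this]; rfl
    rw [h0.fderiv_eq]; simp
  exact (mol_s1 sη dt).sub this


lemma cv_tang (hη : ContDiff ℝ 2 η) (sη : HasCompactSupport η) {w : Q m → ℝ} {w1 w2 : Q m → Q m → ℝ} (h : Reg w w1 w2) {q : Q m} (hq : q ∈ Om m) :
    cv η (w1 (dt, 0)) q - ∑ i, cv η (w2 (di i, 0)) q = cv (fη η) w q := by
  have hc := h.c.continuousOn (s := Om m)
  have e1 := cv_ibp hη.continuous sη (mol_d1 hη dt).continuous (mol_s1 sη dt) (mol_l1 hη dt) hc (h.c1 (dt, 0)) (h.h1 (dt, 0)) q hq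
  have e2 : ∀ i, cv η (w2 (di i, 0)) q = cv (fun p => fderiv ℝ (fun p => fderiv ℝ η p (di i)) p (di i)) w q := by
    intro i
    rw [cv_ibp hη.continuous sη (mol_d1 hη (di i)).continuous (mol_s1 sη (di i)) (mol_l1 hη (di i)) (h.c1 _) (h.c2 (di i, 0)) (h.h2 (di i, 0)) q hq]
    exact cv_ibp (mol_d1 hη (di i)).continuous (mol_s1 sη (di i)) (mol_c2 hη (di i)) (mol_s2 sη (di i)) (mol_l2 hη (di i)) hc (h.c1 (di i, 0)) (h.h1 (di i, 0)) q hq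
  rw [e1]
  simp only [e2]
  unfold cv fη
  have e : ∀ p', (fderiv ℝ η p' dt - ∑ i, fderiv ℝ (fun p => fderiv ℝ η p (di i)) p' (di i)) * w (q.1 - p', q.2)
    = fderiv ℝ η p' dt * w (q.1 - p', q.2) - ∑ i, fderiv ℝ (fun p => fderiv ℝ η p (di i)) p' (di i) * w (q.1 - p', q.2) := by
    intro p'; rw [sub_mul, Finset.sum_mul]
  simp only [e]
  have i2 := fun i => cv_integrable (mol_c2 hη (di i)) (mol_s2 sη (di i)) hc hq
  rw [integral_sub, integral_finsetSum]
  · exact fun i _ => i2 i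
  · exact cv_integrable (mol_d1 hη dt).continuous (mol_s1 sη dt) hc hq
  · exact integrable_finsetSum _ fun i _ => i2 i

lemma Qv_deriv (hη : ContDiff ℝ 2 η) (sη : HasCompactSupport η) {w : Q m → ℝ} {w1 w2 : Q m → Q m → ℝ} (h : Reg w w1 w2) {q : Q m} (hq : q ∈ Om m)
    (hL : ∀ p' ∈ tsupport η, Lop a w1 w2 (q.1 - p', q.2) = 0) :
    HasDerivAt (fun y => |y| ^ a * cv η (w1 ey) (q.1, y)) (|q.2| ^ a * cv (fη η) w q) q.2 := by
  have hr := h.cv hη.continuous sη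
  have hd : HasDerivAt (fun y => cv η (w1 ey) (q.1, y)) (cv η (w2 ey) q) q.2 := by
    have h3 := line_shift (q := ((q.1, 0) : Q m)) (d := ey) (t := q.2) (g := cv η (w1 ey)) (g' := cv η (w2 ey) q) (by
        have e : ((q.1, 0) : Q m) + q.2 • ey = q := by ext1 <;> simp [ey]
        rw [e]; exact hr.h2 ey q hq)
    simpa [ey] using h3
  have hz : Lop a (fun d => cv η (w1 d)) (fun d => cv η (w2 d)) q = 0 := by
    rw [Lop_cv hη.continuous sη h hq]
    have : ∀ p', η p' * Lop a w1 w2 (q.1 - p', q.2) = 0 := by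
      intro p'
      by_cases hp : p' ∈ tsupport η
      · rw [hL p' hp, mul_zero]
      · rw [image_eq_zero_of_notMem_tsupport hp, zero_mul]
    simp [this]
  have ht := cv_tang hη sη h hq
  unfold Lop at hz
  refine ((abs_rpow_deriv a hq).mul hd).congr_deriv ?_
  rw [← ht]
  have : cv η (w1 (dt, 0)) q - ∑ i, cv η (w2 (di i, 0)) q = cv η (w2 ey) q + a / q.2 * cv η (w1 ey) q := by linarith
  rw [this]
  have : cv η (w1 ey) (q.1, q.2) = cv η (w1 ey) q := rfl
  rw [this]; ring

end mol

lemma abs_ii (h1 : -1 < a) {f : ℝ → ℝ} (hf : Continuous f) (x y : ℝ) : IntervalIntegrable (fun s => |s| ^ a * f s) volume x y := by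
  have : IntervalIntegrable (fun s : ℝ => |s| ^ a) volume x y := by
    have hl : LocallyIntegrable (fun s : ℝ => |s| ^ a) := by
      have := abs_gauss_integrable (b := a) (β := 1) h1 one_pos
      have h3 := this.locallyIntegrable
      have h4 : LocallyIntegrableOn (fun s : ℝ => (|s| ^ a * exp (-1 * s ^ 2)) * exp (s ^ 2)) univ := by
        refine LocallyIntegrableOn.mul_continuousOn ?_ (by fun_prop) isClosed_univ.isLocallyClosed
        exact h3.locallyIntegrableOn _
      rw [locallyIntegrableOn_univ] at h4
      refine h4.congr (Eventually.of_forall fun s => ?_)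
      simp only [mul_assoc, ← Real.exp_add]; simp
    exact (hl.integrableOn_isCompact isCompact_uIcc).intervalIntegrable
  exact this.mul_continuousOn hf.continuousOn

lemma half1 (h1 : -1 < a) {f g : ℝ → ℝ} {Y : ℝ} (hf : Continuous f) (hY : 0 < Y)
    (hg : ∀ y ∈ Ioo 0 Y, HasDerivAt g (|y| ^ a * f y) y) :
    ∃ L, ∀ y ∈ Ioo 0 Y, g y = L + ∫ s in (0:ℝ)..y, |s| ^ a * f s := by
  set I : ℝ → ℝ := fun y => ∫ s in (0:ℝ)..y, |s| ^ a * f s with hI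
  have hId : ∀ y ∈ Ioo 0 Y, HasDerivAt I (|y| ^ a * f y) y := by
    intro y hy
    have hc : ContinuousAt (fun s : ℝ => |s| ^ a * f s) y :=
      (continuous_abs.continuousAt.rpow_const (Or.inl (abs_pos.2 hy.1.ne').ne')).mul hf.continuousAt
    refine intervalIntegral.integral_hasDerivAt_right (abs_ii h1 hf 0 y) ?_ hc
    refine ⟨Ioo 0 Y, Ioo_mem_nhds hy.1 hy.2, ?_⟩
    refine ContinuousOn.aestronglyMeasurable ?_ measurableSet_Ioo
    exact (continuous_abs.continuousOn.rpow_const fun s hs => (Or.inl (abs_pos.2 hs.1.ne').ne')).mul hf.continuousOn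
  refine ⟨g (Y/2) - I (Y/2), fun y hy => ?_⟩
  have hconst := isOpen_Ioo.is_const_of_deriv_eq_zero (s := Ioo 0 Y) (f := fun y => g y - I y) isPreconnected_Ioo
    (fun z hz => ((hg z hz).sub (hId z hz)).differentiableAt.differentiableWithinAt)
    (fun z hz => by
      have := ((hg z hz).sub (hId z hz)).deriv
      rw [sub_self] at this
      exact this) hy (⟨by linarith, by linarith⟩ : Y/2 ∈ Ioo 0 Y)
  have e : (∫ s in (0:ℝ)..y, |s| ^ a * f s) = I y := rfl
  rw [e]; linarith

lemma int_bd (h1 : -1 < a) {f : ℝ → ℝ} {y C : ℝ} (hy : 0 < y) (hC : ∀ s ∈ Icc 0 y, |f s| ≤ C) :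
    |∫ s in (0:ℝ)..y, |s| ^ a * f s| ≤ C / (1 + a) * y ^ (1 + a) := by
  have h := intervalIntegral.norm_integral_le_of_norm_le (a := 0) (b := y) (f := fun s => |s| ^ a * f s) (g := fun s => s ^ a * C)
    hy.le ?_ ?_ (μ := volume)
  · rw [intervalIntegral.integral_mul_const, integral_rpow (Or.inl h1), Real.zero_rpow (by linarith), sub_zero] at h
    rw [Real.norm_eq_abs] at h
    refine h.trans (le_of_eq ?_)
    rw [add_comm a 1]; ring
  · refine Eventually.of_forall fun s hs => ?_
    rw [Real.norm_eq_abs, abs_mul, abs_of_pos hs.1, abs_of_nonneg (Real.rpow_nonneg hs.1.le a)]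
    have := Real.rpow_nonneg hs.1.le a
    have := hC s ⟨hs.1.le, hs.2⟩
    gcongr
  · exact (intervalIntegral.intervalIntegrable_rpow' h1).mul_const C

end MV
end

noncomputable section
open Real MeasureTheory Set Filter Topology

namespace MV
variable {m : ℕ} {a : ℝ}

structure Mol (η : P m → ℝ) : Prop where
  s : ContDiff ℝ 2 η
  c : HasCompactSupport η
  p : ∀ x, 0 ≤ η x
  i : ∫ x, η x = 1

lemma pow_small (h1 : -1 < a) (C : ℝ) : Tendsto (fun y : ℝ => C / (1 + a) * y ^ (1 + a)) (𝓝[>] 0) (𝓝 0) := by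
  have ha : 0 < 1 + a := by linarith
  have hc : ContinuousAt (fun y : ℝ => C / (1 + a) * y ^ (1 + a)) 0 :=
    continuousAt_const.mul (continuousAt_id.rpow_const (Or.inr ha.le))
  have := hc.tendsto.mono_left (nhdsWithin_le_nhds (s := Ioi 0))
  simpa [Real.zero_rpow ha.ne'] using this

lemma half_lim (h1 : -1 < a) {f g : ℝ → ℝ} {Y L : ℝ} (hf : Continuous f) (hY : 0 < Y)
    (h : ∀ y ∈ Ioo 0 Y, g y = L + ∫ s in (0:ℝ)..y, |s| ^ a * f s) : Tendsto g (𝓝[>] 0) (𝓝 L) := by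
  obtain ⟨C, hC⟩ := isCompact_Icc.exists_bound_of_continuousOn (s := Icc 0 Y) hf.continuousOn
  have hI : Tendsto (fun y => ∫ s in (0:ℝ)..y, |s| ^ a * f s) (𝓝[>] 0) (𝓝 0) := by
    refine squeeze_zero_norm' ?_ (pow_small h1 C)
    filter_upwards [Ioo_mem_nhdsGT hY] with y hy
    exact int_bd h1 hy.1 fun s hs => hC s ⟨hs.1, hs.2.trans hy.2.le⟩
  have := hI.const_add L
  rw [add_zero] at this
  refine this.congr' ?_
  filter_upwards [Ioo_mem_nhdsGT hY] with y hy
  exact (h y hy).symm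

lemma flux_nonpos (h1 : -1 < a) (h2 : a < 1) {e : Q m → ℝ} {e1 e2 : Q m → Q m → ℝ} (he : Reg e e1 e2) {p0 : P m} {R Y L : ℝ} {η : P m → ℝ}
    (hη : Mol η) (hR : 0 < R) (hY : 0 < Y)
    (hL : ∀ q : Q m, q.1 ∈ Metric.ball p0 R → 0 < q.2 → q.2 < Y → ∀ p' ∈ tsupport η, Lop a e1 e2 (q.1 - p', q.2) = 0)
    (hf : ∀ p, Tendsto (fun y : ℝ => y ^ a * e1 ey (p, y)) (𝓝[>] 0) (𝓝 0))
    (hT : Tendsto (fun y => |y| ^ a * cv η (e1 ey) (p0, y)) (𝓝[>] 0) (𝓝 L)) : L ≤ 0 := by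
  by_contra hc
  push Not at hc
  set κ := L / 5 with hκ
  have hκ0 : 0 < κ := by positivity
  have hfc : Continuous (cv (fη η) e) := cv_cont (fη_cont hη.s) (fη_supp hη.c) he.c
  obtain ⟨C, hC⟩ := ((isCompact_closedBall p0 R).prod (isCompact_Icc (a := (0:ℝ)) (b := Y))).exists_bound_of_continuousOn hfc.continuousOn
  have hev : ∀ᶠ y in 𝓝[>] (0:ℝ), C / (1 + a) * y ^ (1 + a) < κ / 2 ∧ 4 * κ < |y| ^ a * cv η (e1 ey) (p0, y) ∧ y ∈ Ioo 0 Y := by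
    filter_upwards [(pow_small h1 C).eventually_lt_const (show 0 < κ/2 by positivity), hT.eventually_const_lt (show 4 * κ < L by rw [hκ]; linarith), Ioo_mem_nhdsGT hY] with y a1 a2 a3 using ⟨a1, a2, a3⟩
  obtain ⟨y1, b1, b2, b3⟩ := hev.exists
  have hcont : ContinuousAt (fun p => |y1| ^ a * cv η (e1 ey) (p, y1)) p0 := by
    refine continuousAt_const.mul ?_
    have h3 := (he.cv hη.s.continuous hη.c).c1 ey
    have h4 : ContinuousAt (cv η (e1 ey)) (p0, y1) := h3.continuousAt (Om_open.mem_nhds b3.1.ne')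
    exact ContinuousAt.comp (f := fun p : P m => ((p, y1) : Q m)) h4 (by fun_prop)
  obtain ⟨δ, hδ, hδb⟩ := Metric.eventually_nhds_iff_ball.1 (hcont.eventually_const_lt b2)
  have ha : 0 < 1 + a := by linarith
  have hC0 : 0 ≤ C := (norm_nonneg _).trans (hC (p0, 0) ⟨Metric.mem_closedBall_self hR.le, le_rfl, hY.le⟩)
  refine no_flux_pos (R := min R δ) (Y := y1) (p0 := p0) h1 h2 he hη.s.continuous hη.c hη.p hη.i (lt_min hR hδ) b3.1 hκ0 ?_ hf ?_
  · intro q a1 a2 a3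
    exact hL q (Metric.ball_subset_ball (min_le_left _ _) a1) a2 (a3.trans b3.2)
  · intro p hp y hy hyy
    have hpR := Metric.ball_subset_ball (min_le_left _ _) hp
    have hfp : Continuous (fun s => cv (fη η) e (p, s)) := hfc.comp (by fun_prop)
    obtain ⟨Lp, hLp⟩ := half1 (g := fun y => |y| ^ a * cv η (e1 ey) (p, y)) h1 hfp hY (fun y hy =>
      Qv_deriv hη.s hη.c he (q := (p, y)) hy.1.ne' (hL (p, y) hpR hy.1 hy.2))
    have e1' := hLp y1 b3
    have e2' := hLp y ⟨hy, hyy.trans b3.2⟩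
    have i1 := int_bd h1 (f := fun s => cv (fη η) e (p, s)) b3.1 (C := C) (fun s hs => hC (p, s) ⟨Metric.ball_subset_closedBall hpR, hs.1, hs.2.trans b3.2.le⟩)
    have i2 := int_bd h1 (f := fun s => cv (fη η) e (p, s)) hy (C := C) (fun s hs => hC (p, s) ⟨Metric.ball_subset_closedBall hpR, hs.1, hs.2.trans (hyy.trans b3.2).le⟩)
    have i3 : C / (1 + a) * y ^ (1 + a) ≤ C / (1 + a) * y1 ^ (1 + a) := by gcongr
    have h5 := hδb p (Metric.ball_subset_ball (min_le_right _ _) hp)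
    rw [abs_of_pos hy] at e2'
    have := (abs_le.1 i1).2
    have := (abs_le.1 i2).1
    linarith

lemma Reg.neg1 {f : Q m → ℝ} {f1 f2 : Q m → Q m → ℝ} (hf : Reg f f1 f2) (d : Q m) {q : Q m} (hq : q ∈ Om m) :
    f1 (-d) q = - f1 d q := by
  have h3 := (hf.h1 d q hq).smul (-1)
  rw [neg_one_smul, neg_one_smul] at h3
  have h4 := hf.h1 (-d) q hq
  exact HasDerivAt.unique h4 h3

lemma Reg.neg2 {f : Q m → ℝ} {f1 f2 : Q m → Q m → ℝ} (hf : Reg f f1 f2) (d : Q m) {q : Q m} (hq : q ∈ Om m) :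
    f2 (-d) q = f2 d q := by
  have h3 := (hf.h2 d q hq).smul (-1)
  rw [neg_one_smul, neg_one_smul] at h3
  have h4 := hf.h2 (-d) q hq
  have h5 : HasDerivAt (fun t : ℝ => f1 (-d) (q + t • (-d))) (- - f2 d q) 0 := by
    have h6 : HasDerivAt (fun t : ℝ => - f1 d (q + t • (-d))) (- - f2 d q) 0 := HasDerivAt.neg h3
    refine h6.congr_of_eventuallyEq ?_
    have hc : ContinuousAt (fun t : ℝ => q + t • (-d)) 0 := by fun_prop
    have : ∀ᶠ t : ℝ in 𝓝 0, q + t • (-d) ∈ Om m := by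
      apply hc.eventually_mem
      simp only [zero_smul, add_zero]
      exact Om_open.mem_nhds hq
    filter_upwards [this] with t ht
    exact hf.neg1 d ht
  rw [neg_neg] at h5
  exact HasDerivAt.unique h4 h5

lemma rf_ey : rf (ey : Q m) = -ey := by ext1 <;> simp [rf, ey]
lemma rf_d (d : P m) : rf ((d, 0) : Q m) = (d, 0) := by ext1 <;> simp [rf]
lemma rf_Om {q : Q m} (hq : q ∈ Om m) : rf q ∈ Om m := by
  simpa [Om, rf] using hq

lemma flux_match (h1 : -1 < a) (h2 : a < 1) {w : Q m → ℝ} {w1 w2 : Q m → Q m → ℝ} (hw : Reg w w1 w2) {p0 : P m} {R Y : ℝ} {η : P m → ℝ}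
    (hη : Mol η) (hR : 0 < R) (hY : 0 < Y)
    (hL : ∀ q : Q m, q.1 ∈ Metric.ball p0 R → q ∈ Om m → |q.2| < Y → ∀ p' ∈ tsupport η, Lop a w1 w2 (q.1 - p', q.2) = 0)
    (hf : ∀ p, ∃ L, Tendsto (fun y : ℝ => |y| ^ a * w1 ey (p, y)) (𝓝[>] 0) (𝓝 L) ∧
      Tendsto (fun y : ℝ => |y| ^ a * w1 ey (p, y)) (𝓝[<] 0) (𝓝 L)) :
    ∃ L, Tendsto (fun y => |y| ^ a * cv η (w1 ey) (p0, y)) (𝓝[≠] 0) (𝓝 L) := by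
  have hneg : Tendsto (fun y : ℝ => -y) (𝓝[>] 0) (𝓝[<] 0) := by
    have := tendsto_neg_nhdsGT (a := (0:ℝ)); simpa using this
  have hneg' : Tendsto (fun y : ℝ => -y) (𝓝[<] 0) (𝓝[>] 0) := by
    have := tendsto_neg_nhdsLT (a := (0:ℝ)); simpa using this
  have he := hw.add hw.refl
  set e1 : Q m → Q m → ℝ := fun d q => w1 d q + w1 (rf d) (rf q) with he1
  set e2 : Q m → Q m → ℝ := fun d q => w2 d q + w2 (rf d) (rf q) with he2
  have hLe : ∀ q ∈ Om m, Lop a e1 e2 q = Lop a w1 w2 q + Lop a w1 w2 (rf q) := by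
    intro q hq
    simp only [Lop, he1, he2, rf_d, rf_ey, hw.neg1 ey (rf_Om hq), hw.neg2 ey (rf_Om hq), Finset.sum_add_distrib]
    simp only [rf]
    rw [div_neg]; ring
  have hee : ∀ q ∈ Om m, e1 ey q = w1 ey q - w1 ey (rf q) := by
    intro q hq
    simp only [he1, rf_ey, hw.neg1 ey (rf_Om hq)]; ring
  have hLe0 : ∀ q : Q m, q.1 ∈ Metric.ball p0 R → 0 < q.2 → q.2 < Y → ∀ p' ∈ tsupport η, Lop a e1 e2 (q.1 - p', q.2) = 0 := by
    intro q a1 a2 a3 p' hp'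
    rw [hLe (q.1 - p', q.2) a2.ne', hL q a1 a2.ne' (by rwa [abs_of_pos a2]) p' hp']
    have := hL (rf q) a1 (rf_Om a2.ne') (by simp only [rf, abs_neg]; rwa [abs_of_pos a2]) p' hp'
    simpa [rf] using this
  have hfe : ∀ p, Tendsto (fun y : ℝ => y ^ a * e1 ey (p, y)) (𝓝[>] 0) (𝓝 0) := by
    intro p
    obtain ⟨L, l1, l2⟩ := hf p
    have h3 := l1.sub (l2.comp hneg)
    rw [sub_self] at h3
    refine h3.congr' ?_
    filter_upwards [self_mem_nhdsWithin] with y hy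
    have hy' : 0 < y := hy
    rw [hee (p, y) hy'.ne']
    simp only [Function.comp, abs_neg, abs_of_pos hy', rf]; ring
  have hcve : ∀ q ∈ Om m, cv η (e1 ey) q = cv η (w1 ey) q - cv η (w1 ey) (rf q) := by
    intro q hq
    unfold cv
    rw [← integral_sub]
    · refine integral_congr_ae (Eventually.of_forall fun p' => ?_)
      simp only [hee (q.1 - p', q.2) hq]
      simp only [rf]; ring
    · exact cv_integrable hη.s.continuous hη.c (hw.c1 ey) hq
    · exact cv_integrable hη.s.continuous hη.c (hw.c1 ey) (rf_Om hq)
  have hlim : ∀ {g : Q m → ℝ} {g1 g2 : Q m → Q m → ℝ}, Reg g g1 g2 → (∀ q : Q m, q.1 ∈ Metric.ball p0 R → 0 < q.2 → q.2 < Y → ∀ p' ∈ tsupport η, Lop a g1 g2 (q.1 - p', q.2) = 0) →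
      ∃ L, Tendsto (fun y => |y| ^ a * cv η (g1 ey) (p0, y)) (𝓝[>] 0) (𝓝 L) := by
    intro g g1 g2 hg hgL
    have hfc : Continuous (cv (fη η) g) := cv_cont (fη_cont hη.s) (fη_supp hη.c) hg.c
    have hfp : Continuous (fun s => cv (fη η) g (p0, s)) := hfc.comp (by fun_prop)
    obtain ⟨Lp, hLp⟩ := half1 (g := fun y => |y| ^ a * cv η (g1 ey) (p0, y)) h1 hfp hY (fun y hy =>
      Qv_deriv hη.s hη.c hg (q := (p0, y)) hy.1.ne' (hgL (p0, y) (Metric.mem_ball_self hR) hy.1 hy.2))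
    exact ⟨Lp, half_lim h1 hfp hY hLp⟩
  obtain ⟨L, hT⟩ := hlim hw (fun q a1 a2 a3 => hL q a1 a2.ne' (by rwa [abs_of_pos a2]))
  obtain ⟨Z, hZ⟩ := hlim he hLe0
  have hZ1 : Z ≤ 0 := flux_nonpos h1 h2 he hη hR hY hLe0 hfe hZ
  have hZ2 : -Z ≤ 0 := by
    refine flux_nonpos (p0 := p0) h1 h2 (he.smul (-1)) hη hR hY ?_ ?_ ?_
    · intro q a1 a2 a3 p' hp'
      have h5 := Lop_add (a := a) e1 e2 e1 e2 (q.1 - p', q.2) (-1) 0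
      simp only [zero_mul, add_zero] at h5
      rw [h5, hLe0 q a1 a2 a3 p' hp', mul_zero]
    · intro p
      have := (hfe p).const_mul (-1)
      rw [mul_zero] at this
      refine this.congr fun y => ?_
      ring
    · have := hZ.neg
      refine this.congr fun y => ?_
      unfold cv
      simp only [mul_left_comm _ (-1 : ℝ), integral_const_mul]; ring
  have hZ0 : Z = 0 := by linarith
  rw [hZ0] at hZ
  refine ⟨L, ?_⟩
  rw [← nhdsLT_sup_nhdsGT, tendsto_sup]
  refine ⟨?_, hT⟩
  have h6 := (hT.sub hZ).comp hneg'
  rw [sub_zero] at h6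
  refine h6.congr' ?_
  filter_upwards [self_mem_nhdsWithin] with y hy
  have hy' : y < 0 := hy
  have hO : ((p0, -y) : Q m) ∈ Om m := by simp [Om, hy'.ne]
  simp only [Function.comp]
  rw [hcve _ hO]
  simp only [rf, neg_neg, abs_neg]; ring

end MV
end

noncomputable section
open Real MeasureTheory Set Filter Topology
namespace MV
variable {m : ℕ} {a : ℝ}

/-- integrability of a weighted compactly supported continuous function -/
lemma wint {e : ℝ} (he : -1 < e) {f : Q m → ℝ} (hf : Continuous f) (sf : HasCompactSupport f) :
    Integrable (fun q : Q m => |q.2| ^ e * f q) := by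
  obtain ⟨R, hR⟩ := sf.isCompact.isBounded.subset_closedBall (0 : Q m)
  obtain ⟨C, hC⟩ := hf.bounded_above_of_compact_support sf
  have i1 : Integrable (fun p : P m => (Metric.closedBall (0 : P m) R).indicator (fun _ => C) p) :=
    (integrable_indicator_iff Metric.isClosed_closedBall.measurableSet).2
      (integrableOn_const (isCompact_closedBall _ _).measure_lt_top.ne)
  have i2 : Integrable (fun y : ℝ => (Icc (-|R|) |R|).indicator (fun y => |y| ^ e) y) := by
    rw [integrable_indicator_iff measurableSet_Icc, integrableOn_Icc_iff_integrableOn_Ioc]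
    have := abs_ii he (f := fun _ => (1 : ℝ)) continuous_const (-|R|) |R|
    rw [intervalIntegrable_iff_integrableOn_Ioc_of_le (by linarith [abs_nonneg R])] at this
    simpa using this
  have i3 := i1.mul_prod i2
  rw [← Measure.volume_eq_prod] at i3
  refine i3.mono' ?_ (Eventually.of_forall fun q => ?_)
  · refine AEStronglyMeasurable.mul ?_ hf.aestronglyMeasurable
    exact (by fun_prop : Measurable fun q : Q m => |q.2| ^ e).aestronglyMeasurable
  · by_cases hq : f q = 0
    · simp only [hq, mul_zero, norm_zero]
      have hC0 : 0 ≤ C := (norm_nonneg _).trans (hC q)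
      exact mul_nonneg (indicator_nonneg (fun _ _ => hC0) _) (indicator_nonneg (fun _ _ => by positivity) _)
    · have h1 := hR (subset_tsupport f hq)
      rw [mem_closedBall_zero_iff, Prod.norm_def, max_le_iff] at h1
      have h3 : q.2 ∈ Icc (-|R|) |R| := by
        have := (Real.norm_eq_abs q.2 ▸ h1.2).trans (le_abs_self R)
        exact ⟨(abs_le.1 this).1, (abs_le.1 this).2⟩
      rw [indicator_of_mem (mem_closedBall_zero_iff.2 h1.1), indicator_of_mem h3, norm_mul,
        Real.norm_of_nonneg (by positivity : 0 ≤ |q.2| ^ e), mul_comm]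
      gcongr
      exact hC q

/-- admissible test data -/
structure Tst (a : ℝ) (K : Set (Q m)) (Ψ Ψt qΨ A B : Q m → ℝ) (Ψi Ψii : Fin m → Q m → ℝ) : Prop where
  kc : IsCompact K
  c0 : Continuous Ψ
  c1 : Continuous Ψt
  c2 : Continuous qΨ
  c3 : Continuous A
  c4 : Continuous B
  c5 : ∀ i, Continuous (Ψi i)
  c6 : ∀ i, Continuous (Ψii i)
  z0 : ∀ q, q ∉ K → Ψ q = 0
  z1 : ∀ q, q ∉ K → Ψt q = 0
  z2 : ∀ q, q ∉ K → qΨ q = 0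
  z3 : ∀ q, q ∉ K → A q = 0
  z4 : ∀ q, q ∉ K → B q = 0
  z5 : ∀ i q, q ∉ K → Ψi i q = 0
  z6 : ∀ i q, q ∉ K → Ψii i q = 0
  l1 : ∀ q ∈ Om m, HasLineDerivAt ℝ (fun p => Ψ (p, q.2)) (Ψt q) q.1 dt
  l2 : ∀ i, ∀ q ∈ Om m, HasLineDerivAt ℝ (fun p => Ψ (p, q.2)) (Ψi i q) q.1 (di i)
  l3 : ∀ i, ∀ q ∈ Om m, HasLineDerivAt ℝ (fun p => Ψi i (p, q.2)) (Ψii i q) q.1 (di i)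
  d1 : ∀ q ∈ Om m, HasDerivAt (fun y => Ψ (q.1, y)) (|q.2| ^ (-a) * qΨ q) q.2
  d2 : ∀ q ∈ Om m, HasDerivAt (fun y => qΨ (q.1, y)) (|q.2| ^ a * A q + |q.2| ^ (-a) * B q) q.2

lemma supp_of {K : Set (Q m)} (hK : IsCompact K) {f : Q m → ℝ} (h : ∀ q, q ∉ K → f q = 0) :
    HasCompactSupport f := HasCompactSupport.intro hK h

lemma supp_slice {K : Set (Q m)} (hK : IsCompact K) {f : Q m → ℝ} (h : ∀ q, q ∉ K → f q = 0) (y : ℝ) :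
    HasCompactSupport (fun p => f (p, y)) := by
  refine HasCompactSupport.intro (hK.image continuous_fst) (fun p hp => h _ fun hq => hp ⟨_, hq, rfl⟩)

lemma cv_slice {φ : P m → ℝ} {g g' : Q m → ℝ} {d : P m} (hφ : Continuous φ) (sφ : HasCompactSupport φ)
    (hg : ContinuousOn g (Om m)) (hg' : ContinuousOn g' (Om m))
    (h : ∀ q ∈ Om m, HasLineDerivAt ℝ g (g' q) q (d, 0)) {y : ℝ} (hy : y ≠ 0) (p : P m) :
    HasLineDerivAt ℝ (fun p => cv φ g (p, y)) (cv φ g' (p, y)) p d := by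
  have := cv_line hφ sφ hg hg' h (p, y) hy
  simpa [HasLineDerivAt] using this

lemma green1 {η : P m → ℝ} (hη : Mol η) {w : Q m → ℝ} {w1 w2 : Q m → Q m → ℝ} (hw : Reg w w1 w2)
    {K : Set (Q m)} {Ψ Ψt qΨ A B : Q m → ℝ} {Ψi Ψii : Fin m → Q m → ℝ} (T : Tst a K Ψ Ψt qΨ A B Ψi Ψii)
    {y : ℝ} (hy : y ≠ 0) :
    ∫ p, cv η w (p, y) * (Ψt (p, y) + ∑ i, Ψii i (p, y)) + cv (fη η) w (p, y) * Ψ (p, y) = 0 := by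
  have hc := hη.s.continuous
  have sl : ∀ {g : Q m → ℝ}, ContinuousOn g (Om m) → Continuous (fun p => cv η g (p, y)) := by
    intro g hg
    have := cv_contOn hc hη.c hg
    exact this.comp_continuous (by fun_prop) (fun p => hy)
  have sc : ∀ {g : Q m → ℝ}, Continuous g → Continuous (fun p : P m => g (p, y)) := fun hg => hg.comp (by fun_prop)
  have j1 := ibp (sc T.c0) (sc T.c1) (sl hw.c.continuousOn) (sl (hw.c1 (dt, 0))) (supp_slice T.kc T.z0 y)
    (supp_slice T.kc T.z1 y) (fun p => T.l1 (p, y) hy)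
    (fun p => cv_slice hc hη.c hw.c.continuousOn (hw.c1 _) (hw.h1 (dt, 0)) hy p)
  have j2 : ∀ i, ∫ p, Ψ (p, y) * cv η (w2 (di i, 0)) (p, y) = ∫ p, Ψii i (p, y) * cv η w (p, y) := by
    intro i
    have k1 := ibp (sc T.c0) (sc (T.c5 i)) (sl (hw.c1 (di i, 0))) (sl (hw.c2 (di i, 0))) (supp_slice T.kc T.z0 y)
      (supp_slice T.kc (T.z5 i) y) (fun p => T.l2 i (p, y) hy)
      (fun p => cv_slice hc hη.c (hw.c1 _) (hw.c2 _) (hw.h2 (di i, 0)) hy p)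
    have k2 := ibp (sc (T.c5 i)) (sc (T.c6 i)) (sl hw.c.continuousOn) (sl (hw.c1 (di i, 0))) (supp_slice T.kc (T.z5 i) y)
      (supp_slice T.kc (T.z6 i) y) (fun p => T.l3 i (p, y) hy)
      (fun p => cv_slice hc hη.c hw.c.continuousOn (hw.c1 _) (hw.h1 (di i, 0)) hy p)
    rw [k1, k2, neg_neg]
  have I1 : Integrable (fun p => Ψ (p, y) * cv η (w1 (dt, 0)) (p, y)) :=
    ((sc T.c0).mul (sl (hw.c1 _))).integrable_of_hasCompactSupport (supp_slice T.kc T.z0 y).mul_right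
  have I2 : ∀ i, Integrable (fun p => Ψ (p, y) * cv η (w2 (di i, 0)) (p, y)) := fun i =>
    ((sc T.c0).mul (sl (hw.c2 _))).integrable_of_hasCompactSupport (supp_slice T.kc T.z0 y).mul_right
  have I3 : Integrable (fun p => Ψt (p, y) * cv η w (p, y)) :=
    ((sc T.c1).mul (sl hw.c.continuousOn)).integrable_of_hasCompactSupport (supp_slice T.kc T.z1 y).mul_right
  have I4 : ∀ i, Integrable (fun p => Ψii i (p, y) * cv η w (p, y)) := fun i =>
    ((sc (T.c6 i)).mul (sl hw.c.continuousOn)).integrable_of_hasCompactSupport (supp_slice T.kc (T.z6 i) y).mul_right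
  have e : ∀ p, cv η w (p, y) * (Ψt (p, y) + ∑ i, Ψii i (p, y)) + cv (fη η) w (p, y) * Ψ (p, y)
      = (Ψt (p, y) * cv η w (p, y) + ∑ i, Ψii i (p, y) * cv η w (p, y))
        + (Ψ (p, y) * cv η (w1 (dt, 0)) (p, y) - ∑ i, Ψ (p, y) * cv η (w2 (di i, 0)) (p, y)) := by
    intro p
    rw [← cv_tang hη.s hη.c hw (q := (p, y)) hy, ← Finset.sum_mul, ← Finset.mul_sum]; ring
  simp_rw [e]
  have I5 : Integrable (fun p => Ψt (p, y) * cv η w (p, y) + ∑ i, Ψii i (p, y) * cv η w (p, y)) :=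
    I3.add (integrable_finsetSum _ fun i _ => I4 i)
  have I6 : Integrable (fun p => Ψ (p, y) * cv η (w1 (dt, 0)) (p, y) - ∑ i, Ψ (p, y) * cv η (w2 (di i, 0)) (p, y)) :=
    I1.sub (integrable_finsetSum _ fun i _ => I2 i)
  rw [integral_add I5 I6,
    integral_add I3 (integrable_finsetSum _ fun i _ => I4 i), integral_sub I1 (integrable_finsetSum _ fun i _ => I2 i),
    integral_finsetSum _ (fun i _ => I4 i), integral_finsetSum _ (fun i _ => I2 i), j1]
  simp_rw [j2]; ring

lemma green2 (h1 : -1 < a) (h2 : a < 1) {η : P m → ℝ} (hη : Mol η) {w : Q m → ℝ} {w1 w2 : Q m → Q m → ℝ} (hw : Reg w w1 w2)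
    (hf : ∀ p : P m, ∃ L, Tendsto (fun y => |y| ^ a * w1 ey (p, y)) (𝓝[>] 0) (𝓝 L) ∧
      Tendsto (fun y => |y| ^ a * w1 ey (p, y)) (𝓝[<] 0) (𝓝 L))
    {K : Set (Q m)} {Ψ Ψt qΨ A B : Q m → ℝ} {Ψi Ψii : Fin m → Q m → ℝ} (T : Tst a K Ψ Ψt qΨ A B Ψi Ψii)
    {δ : ℝ} (hδ : 0 < δ)
    (hL : ∀ q ∈ Metric.cthickening δ K, q ∈ Om m → ∀ p' ∈ tsupport η, Lop a w1 w2 (q.1 - p', q.2) = 0) (p : P m) :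
    ∫ y, (|y| ^ a * (cv η w (p, y) * A (p, y) - cv (fη η) w (p, y) * Ψ (p, y)) + |y| ^ (-a) * (cv η w (p, y) * B (p, y))) = 0 := by
  have hc := hη.s.continuous
  have sc : ∀ {g : Q m → ℝ}, Continuous g → Continuous (fun y : ℝ => g (p, y)) := fun hg => hg.comp (by fun_prop)
  set N : ℝ → ℝ := fun y => cv η w (p, y) * qΨ (p, y) - |y| ^ a * cv η (w1 ey) (p, y) * Ψ (p, y) with hN
  set S : ℝ → ℝ := fun y => |y| ^ a * (cv η w (p, y) * A (p, y) - cv (fη η) w (p, y) * Ψ (p, y)) + |y| ^ (-a) * (cv η w (p, y) * B (p, y)) with hS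
  have hNz : ∀ y, (p, y) ∉ K → N y = 0 := fun y hy => by simp [hN, T.z0 _ hy, T.z2 _ hy]
  have hSz : ∀ y, (p, y) ∉ K → S y = 0 := fun y hy => by simp [hS, T.z0 _ hy, T.z3 _ hy, T.z4 _ hy]
  have hKo : ∀ y, (p, y) ∉ K → ∀ᶠ s in 𝓝 y, (p, s) ∉ K := fun y hy =>
    (by fun_prop : Continuous fun s : ℝ => (p, s)).continuousAt.eventually (T.kc.isClosed.isOpen_compl.mem_nhds hy)
  have hd : ∀ y, y ≠ 0 → HasDerivAt N (S y) y := by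
    intro y hy
    by_cases hK : (p, y) ∈ K
    · have b1 := T.d1 (p, y) hy
      have b2 := T.d2 (p, y) hy
      have b3 := Qv_deriv hη.s hη.c hw (q := (p, y)) hy (hL _ (Metric.self_subset_cthickening K hK) hy)
      have b4 : HasDerivAt (fun y => cv η w (p, y)) (cv η (w1 ey) (p, y)) y := by
        have := line_shift (g := cv η w) (q := (p, 0)) (d := ey) (t := y) (g' := cv η (w1 ey) (p, y)) (by
          have := cv_line hc hη.c hw.c.continuousOn (hw.c1 ey) (hw.h1 ey) (p, y) hy
          simpa [ey] using this)
        simpa [ey] using this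
      have := (b4.mul b2).sub (b3.mul b1)
      refine this.congr_deriv ?_
      simp only [hS]
      have := abs_rpow_mul_neg a hy
      linear_combination (- cv η (w1 ey) (p, y) * qΨ (p, y)) * this
    · rw [hSz y hK]
      exact (hasDerivAt_const y (0 : ℝ)).congr_of_eventuallyEq ((hKo y hK).mono fun s hs => hNz s hs)
  have hlim : ∃ L, Tendsto N (𝓝[≠] 0) (𝓝 L) := by
    by_cases hK : (p, (0 : ℝ)) ∈ K
    · obtain ⟨L, hl⟩ := flux_match h1 h2 hw (p0 := p) hη hδ hδ (by
        intro q q1 q2 q3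
        refine hL q (Metric.mem_cthickening_of_dist_le q _ δ K hK ?_) q2
        rw [Prod.dist_eq, max_le_iff]
        exact ⟨(Metric.mem_ball.1 q1).le, by rw [Real.dist_eq]; simpa using q3.le⟩) hf
      have u1 := ((sc (cv_cont hc hη.c hw.c)).mul (sc T.c2)).tendsto 0
      have u2 := (sc T.c0).tendsto 0
      exact ⟨_, (u1.mono_left nhdsWithin_le_nhds).sub (hl.mul (u2.mono_left nhdsWithin_le_nhds))⟩
    · refine ⟨0, Tendsto.congr' ?_ tendsto_const_nhds⟩
      exact nhdsWithin_le_nhds ((hKo 0 hK).mono fun s hs => (hNz s hs).symm)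
  obtain ⟨L, hl⟩ := hlim
  obtain ⟨R, hR⟩ := T.kc.isBounded.subset_closedBall (0 : Q m)
  have hRy : ∀ y, (p, y) ∈ K → |y| ≤ |R| := by
    intro y hy
    have := hR hy
    rw [mem_closedBall_zero_iff, Prod.norm_def, max_le_iff] at this
    exact this.2.trans (le_abs_self R)
  set M := |R| + 1 with hM
  have hM0 : 0 < M := by positivity
  have hS0 : ∀ y, M ≤ |y| → (p, y) ∉ K := fun y hy hk => by have := hRy y hk; linarith
  have hN0 : ∀ y, y ≠ 0 → Function.update N 0 L =ᶠ[𝓝 y] N := by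
    intro y hy
    filter_upwards [isOpen_ne.mem_nhds hy] with s hs
    exact Function.update_of_ne hs _ _
  have key := MeasureTheory.integral_eq_of_hasDerivAt_off_countable (a := -M) (b := M) (Function.update N 0 L) S (s := {0}) (countable_singleton 0) (by
      intro y _
      refine ContinuousAt.continuousWithinAt ?_
      by_cases hy : y = 0
      · subst hy; exact continuousAt_update_same.2 hl
      · exact (hd y hy).continuousAt.congr (hN0 y hy).symm)
    (fun y hy => (hd y hy.2).congr_of_eventuallyEq (hN0 y hy.2)) (by
      have hcw := sc (cv_cont hc hη.c hw.c)
      have hcf := sc (cv_cont (fη_cont hη.s) (fη_supp hη.c) hw.c)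
      exact (abs_ii h1 ((hcw.mul (sc T.c3)).sub (hcf.mul (sc T.c0))) _ _).add
        (abs_ii (by linarith) (hcw.mul (sc T.c4)) _ _))
  rw [Function.update_of_ne hM0.ne', Function.update_of_ne (by linarith), hNz M (hS0 M (le_abs_self M)), hNz (-M) (hS0 (-M) (by rw [abs_neg]; exact le_abs_self M)), sub_zero] at key
  rw [← key]
  symm
  apply intervalIntegral.integral_eq_integral_of_support_subset
  intro y hy
  have : |y| < M := by
    by_contra h
    exact hy (hSz y (hS0 y (not_lt.1 h)))
  exact ⟨(abs_lt.1 this).1, (abs_lt.1 this).2.le⟩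

lemma green3 (h1 : -1 < a) (h2 : a < 1) {η : P m → ℝ} (hη : Mol η) {w : Q m → ℝ} {w1 w2 : Q m → Q m → ℝ} (hw : Reg w w1 w2)
    (hf : ∀ p : P m, ∃ L, Tendsto (fun y => |y| ^ a * w1 ey (p, y)) (𝓝[>] 0) (𝓝 L) ∧
      Tendsto (fun y => |y| ^ a * w1 ey (p, y)) (𝓝[<] 0) (𝓝 L))
    {K : Set (Q m)} {Ψ Ψt qΨ A B : Q m → ℝ} {Ψi Ψii : Fin m → Q m → ℝ} (T : Tst a K Ψ Ψt qΨ A B Ψi Ψii)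
    {δ : ℝ} (hδ : 0 < δ)
    (hL : ∀ q ∈ Metric.cthickening δ K, q ∈ Om m → ∀ p' ∈ tsupport η, Lop a w1 w2 (q.1 - p', q.2) = 0) :
    ∫ q, cv η w q * (|q.2| ^ a * (Ψt q + ∑ i, Ψii i q + A q) + |q.2| ^ (-a) * B q) = 0 := by
  have hc := hη.s.continuous
  have hcw := cv_cont hc hη.c hw.c
  have hcf := cv_cont (fη_cont hη.s) (fη_supp hη.c) hw.c
  have cD : Continuous (fun q => Ψt q + ∑ i, Ψii i q) := T.c1.add (continuous_finsetSum _ fun i _ => T.c6 i)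
  have i1 : Integrable (fun q : Q m => |q.2| ^ a * (cv η w q * (Ψt q + ∑ i, Ψii i q) + cv (fη η) w q * Ψ q)) := by
    refine wint h1 ((hcw.mul cD).add (hcf.mul T.c0)) (supp_of T.kc fun q hq => ?_)
    simp [T.z0 q hq, T.z1 q hq, T.z6 _ q hq]
  have i2 : Integrable (fun q : Q m => |q.2| ^ a * (cv η w q * A q - cv (fη η) w q * Ψ q) + |q.2| ^ (-a) * (cv η w q * B q)) := by
    refine (wint h1 ((hcw.mul T.c3).sub (hcf.mul T.c0)) (supp_of T.kc fun q hq => ?_)).add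
      (wint (by linarith) (hcw.mul T.c4) (supp_of T.kc fun q hq => ?_))
    · simp [T.z0 q hq, T.z3 q hq]
    · simp [T.z4 q hq]
  have e1 : ∫ q : Q m, |q.2| ^ a * (cv η w q * (Ψt q + ∑ i, Ψii i q) + cv (fη η) w q * Ψ q) = 0 := by
    rw [Measure.volume_eq_prod] at i1 ⊢
    rw [integral_prod_symm _ i1]
    refine integral_eq_zero_of_ae ?_
    have : ∀ᵐ y : ℝ, y ≠ 0 := by simp [ae_iff]
    filter_upwards [this] with y hy
    simp only [integral_const_mul, green1 hη hw T hy, mul_zero, Pi.zero_apply]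
  have e2 : ∫ q : Q m, |q.2| ^ a * (cv η w q * A q - cv (fη η) w q * Ψ q) + |q.2| ^ (-a) * (cv η w q * B q) = 0 := by
    rw [Measure.volume_eq_prod] at i2 ⊢
    rw [integral_prod _ i2]
    refine integral_eq_zero_of_ae (Eventually.of_forall fun p => ?_)
    exact green2 h1 h2 hη hw hf T hδ hL p
  have := integral_add i1 i2
  rw [e1, e2, add_zero] at this
  rw [← this]
  congr 1; funext q; ring

lemma mol_exists {ρ : ℝ} (hρ : 0 < ρ) : ∃ η : P m → ℝ, Mol η ∧ tsupport η ⊆ Metric.closedBall 0 ρ := by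
  let f : ContDiffBump (0 : P m) := ⟨ρ / 2, ρ, by positivity, by linarith⟩
  refine ⟨f.normed volume, ⟨f.contDiff_normed, f.hasCompactSupport_normed, f.nonneg_normed, f.integral_normed⟩, ?_⟩
  rw [f.tsupport_normed_eq]

/-- Green identity for solutions against admissible test data -/
theorem green (h1 : -1 < a) (h2 : a < 1) {w : Q m → ℝ} {w1 w2 : Q m → Q m → ℝ} (hw : Reg w w1 w2)
    (hf : ∀ p : P m, ∃ L, Tendsto (fun y => |y| ^ a * w1 ey (p, y)) (𝓝[>] 0) (𝓝 L) ∧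
      Tendsto (fun y => |y| ^ a * w1 ey (p, y)) (𝓝[<] 0) (𝓝 L))
    {K U : Set (Q m)} (hU : IsOpen U) (hKU : K ⊆ U) (hL : ∀ q ∈ U, q ∈ Om m → Lop a w1 w2 q = 0)
    {Ψ Ψt qΨ A B : Q m → ℝ} {Ψi Ψii : Fin m → Q m → ℝ} (T : Tst a K Ψ Ψt qΨ A B Ψi Ψii) :
    ∫ q, w q * (|q.2| ^ a * (Ψt q + ∑ i, Ψii i q + A q) + |q.2| ^ (-a) * B q) = 0 := by
  obtain ⟨δ, hδ, hδU⟩ := T.kc.exists_cthickening_subset_open hU hKU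
  set S : Q m → ℝ := fun q => |q.2| ^ a * (Ψt q + ∑ i, Ψii i q + A q) + |q.2| ^ (-a) * B q with hS
  have cD : Continuous (fun q => Ψt q + ∑ i, Ψii i q + A q) := (T.c1.add (continuous_finsetSum _ fun i _ => T.c6 i)).add T.c3
  have hI : ∀ v : Q m → ℝ, Continuous v → Integrable (fun q => v q * S q) := by
    intro v hv
    have := (wint (m := m) h1 (hv.mul cD) (supp_of T.kc fun q hq => by simp [T.z1 q hq, T.z6 _ q hq, T.z3 q hq])).add
      (wint (m := m) (e := -a) (by linarith) (hv.mul T.c4) (supp_of T.kc fun q hq => by simp [T.z4 q hq]))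
    refine this.congr (Eventually.of_forall fun q => ?_)
    simp only [hS, Pi.add_apply, Pi.mul_apply]; ring
  have hI1 : Integrable S := by simpa using hI (fun _ => 1) continuous_const
  have hSz : ∀ q, q ∉ K → S q = 0 := fun q hq => by simp [hS, T.z1 q hq, T.z6 _ q hq, T.z3 q hq, T.z4 q hq]
  by_contra hne
  set c := |∫ q, w q * S q| with hcdef
  have hc : 0 < c := abs_pos.2 hne
  set ε := c / (2 * (∫ q, |S q|) + 1) with hε
  have hSi : 0 ≤ ∫ q, |S q| := integral_nonneg fun q => abs_nonneg _
  have hε0 : 0 < ε := by positivity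
  have hu := T.kc.uniformContinuousAt_of_continuousAt w (fun q _ => hw.c.continuousAt) (Metric.dist_mem_uniformity hε0)
  obtain ⟨ρ, hρ, hρ2⟩ := Metric.mem_uniformity_dist.1 hu
  obtain ⟨η, hη, sη⟩ := mol_exists (m := m) (ρ := min (ρ / 2) (δ / 2)) (by positivity)
  have hg := green3 h1 h2 hη hw hf T (half_pos hδ) (by
    intro q hq hqo p' hp'
    refine hL _ (hδU ?_) hqo
    have hp2 : ‖p'‖ ≤ δ / 2 := (mem_closedBall_zero_iff.1 (sη hp')).trans (min_le_right _ _)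
    have : (q.1 - p', q.2) ∈ Metric.cthickening (δ / 2) (Metric.cthickening (δ / 2) K) := by
      refine Metric.mem_cthickening_of_dist_le _ q _ _ hq ?_
      rw [Prod.dist_eq, max_le_iff]
      exact ⟨by simpa using hp2, by simpa using (half_pos hδ).le⟩
    have := Metric.cthickening_cthickening_subset (half_pos hδ).le (half_pos hδ).le K this
    rwa [add_halves] at this)
  have hcl : ∀ q ∈ K, |w q - cv η w q| ≤ ε := by
    intro q hq
    have hi : Integrable (fun p' => η p' * w (q.1 - p', q.2)) :=
      (hη.s.continuous.mul (hw.c.comp (by fun_prop))).integrable_of_hasCompactSupport hη.c.mul_right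
    have hi0 : Integrable η := hη.s.continuous.integrable_of_hasCompactSupport hη.c
    have : w q - cv η w q = ∫ p', η p' * (w q - w (q.1 - p', q.2)) := by
      simp_rw [mul_sub]
      rw [integral_sub (hi0.mul_const _) hi, integral_mul_const, hη.i, one_mul]; rfl
    rw [this, ← Real.norm_eq_abs]
    refine (norm_integral_le_of_norm_le (hi0.mul_const ε) (Eventually.of_forall fun p' => ?_)).trans
      (by rw [integral_mul_const, hη.i, one_mul])
    rw [norm_mul, Real.norm_of_nonneg (hη.p p')]
    by_cases hp' : p' ∈ tsupport η
    · refine mul_le_mul_of_nonneg_left ?_ (hη.p p')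
      have hp2 : ‖p'‖ ≤ ρ / 2 := (mem_closedBall_zero_iff.1 (sη hp')).trans (min_le_left _ _)
      have := @hρ2 q (q.1 - p', q.2) (by
        rw [Prod.dist_eq, max_lt_iff]
        simp only [dist_self, hρ, and_true, dist_eq_norm, sub_sub_cancel]; linarith) hq
      exact (le_of_lt this)
    · simp [image_eq_zero_of_notMem_tsupport hp']
  have hcv := cv_cont hη.s.continuous hη.c hw.c
  have : ∫ q, w q * S q = ∫ q, (w q - cv η w q) * S q := by
    simp_rw [sub_mul]
    rw [integral_sub (hI w hw.c) (hI _ hcv)]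
    rw [hg, sub_zero]
  have h3 : c ≤ ε * ∫ q, |S q| := by
    rw [hcdef, this, ← Real.norm_eq_abs, ← integral_const_mul]
    refine norm_integral_le_of_norm_le (hI1.abs.const_mul ε) (Eventually.of_forall fun q => ?_)
    rw [norm_mul, Real.norm_eq_abs, Real.norm_eq_abs]
    by_cases hq : q ∈ K
    · exact mul_le_mul_of_nonneg_right (hcl q hq) (abs_nonneg _)
    · simp [hSz q hq]
  have h4 : ε * (2 * (∫ q, |S q|) + 1) = c := by rw [hε]; field_simp
  nlinarith
end MV
end

noncomputable section
open Real MeasureTheory Set Filter Topology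
namespace MV
variable {m : ℕ} {a : ℝ}

/-- profile data: `H'' = h` -/
structure Prof (h : ℝ → ℝ) (c M : ℝ) : Prop where
  hc : Continuous h
  h0 : ∀ v, 0 ≤ h v
  c0 : 0 < c
  cM : c ≤ M
  zc : ∀ v, v ≤ c → h v = 0
  zM : ∀ v, M ≤ v → h v = 0

def H1 (h : ℝ → ℝ) (v : ℝ) : ℝ := ∫ s in (0 : ℝ)..v, h s
def H2 (h : ℝ → ℝ) (v : ℝ) : ℝ := ∫ s in (0 : ℝ)..v, H1 h s

section prof
variable {h : ℝ → ℝ} {c M : ℝ}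

lemma Prof.d1 (p : Prof h c M) (v : ℝ) : HasDerivAt (H1 h) (h v) v :=
  (p.hc.integral_hasStrictDerivAt 0 v).hasDerivAt

lemma Prof.c1 (p : Prof h c M) : Continuous (H1 h) :=
  continuous_iff_continuousAt.2 fun v => (p.d1 v).continuousAt

lemma Prof.d2 (p : Prof h c M) (v : ℝ) : HasDerivAt (H2 h) (H1 h v) v :=
  (p.c1.integral_hasStrictDerivAt 0 v).hasDerivAt

lemma Prof.c2 (p : Prof h c M) : Continuous (H2 h) :=
  continuous_iff_continuousAt.2 fun v => (p.d2 v).continuousAt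

lemma int_zero_of_le {f : ℝ → ℝ} {c v : ℝ} (hc : 0 < c) (hf : ∀ s, s ≤ c → f s = 0) (hv : v ≤ c) :
    ∫ s in (0 : ℝ)..v, f s = 0 := by
  apply intervalIntegral.integral_zero_ae
  refine Eventually.of_forall fun s hs => hf s ?_
  have := hs.2
  exact this.trans (max_le hc.le hv)

lemma Prof.z1 (p : Prof h c M) {v : ℝ} (hv : v ≤ c) : H1 h v = 0 := int_zero_of_le p.c0 p.zc hv
lemma Prof.z2 (p : Prof h c M) {v : ℝ} (hv : v ≤ c) : H2 h v = 0 := int_zero_of_le p.c0 (fun _ hs => p.z1 hs) hv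

lemma Prof.mono (p : Prof h c M) : Monotone (H1 h) :=
  monotone_of_hasDerivAt_nonneg p.d1 p.h0

lemma Prof.nn (p : Prof h c M) (v : ℝ) : 0 ≤ H1 h v := by
  rcases le_total v c with hv | hv
  · rw [p.z1 hv]
  · rw [← p.z1 le_rfl]; exact p.mono hv

lemma Prof.top (p : Prof h c M) {v : ℝ} (hv : M ≤ v) : H1 h v = H1 h M := by
  unfold H1
  rw [← intervalIntegral.integral_add_adjacent_intervals (p.hc.intervalIntegrable 0 M) (p.hc.intervalIntegrable M v)]
  have : ∫ s in M..v, h s = 0 := by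
    apply intervalIntegral.integral_zero_ae
    refine Eventually.of_forall fun s hs => p.zM s ?_
    rw [uIoc_of_le hv] at hs
    exact hs.1.le
  rw [this, add_zero]

lemma Prof.le (p : Prof h c M) (v : ℝ) : H1 h v ≤ H1 h M := by
  rcases le_total v M with hv | hv
  · exact p.mono hv
  · rw [p.top hv]

lemma Prof.mono2 (p : Prof h c M) : Monotone (H2 h) :=
  monotone_of_hasDerivAt_nonneg p.d2 p.nn

lemma Prof.nn2 (p : Prof h c M) (v : ℝ) : 0 ≤ H2 h v := by
  rcases le_total v c with hv | hv
  · rw [p.z2 hv]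
  · rw [← p.z2 le_rfl]; exact p.mono2 hv

lemma Prof.gmono (p : Prof h c M) : Monotone (fun v => H1 h M * v - H2 h v) := by
  refine monotone_of_hasDerivAt_nonneg (f' := fun v => H1 h M * 1 - H1 h v) (fun v => ((hasDerivAt_id v).const_mul _).sub (p.d2 v)) (fun v => ?_)
  have := p.le v
  simp; linarith

lemma Prof.le2 (p : Prof h c M) {v : ℝ} (hv : 0 ≤ v) : H2 h v ≤ H1 h M * v := by
  have := p.gmono hv
  simp only [mul_zero, p.z2 p.c0.le] at this
  linarith

lemma Prof.gap (p : Prof h c M) (v : ℝ) : H1 h M * v - H2 h v ≤ H1 h M * M := by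
  have hM := p.nn M
  have hMM := p.nn2 M
  rcases le_total v M with hv | hv
  · have := p.gmono hv; simp only at this; linarith
  · have hanti : AntitoneOn (fun v => H1 h M * v - H2 h v) (Ici M) := by
      refine antitoneOn_of_hasDerivWithinAt_nonpos (f' := fun v => H1 h M * 1 - H1 h v) (convex_Ici M)
        (by have := p.c2; fun_prop) (fun v _ => (((hasDerivAt_id v).const_mul _).sub (p.d2 v)).hasDerivWithinAt) (fun v hv => ?_)
      rw [interior_Ici] at hv
      rw [p.top (le_of_lt hv)]; simp
    have := hanti (mem_Ici.2 le_rfl) (mem_Ici.2 hv) hv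
    simp only at this; linarith

lemma Prof.kappa (p : Prof h c M) : H1 h M = ∫ s, h s := by
  unfold H1
  apply intervalIntegral.integral_eq_integral_of_support_subset
  intro s hs
  constructor
  · by_contra h'; exact hs (p.zc s ((not_lt.1 h').trans p.c0.le))
  · by_contra h'; exact hs (p.zM s (not_le.1 h').le)
end prof

/-- time cut-off data -/
structure Cut (θ θ' : ℝ → ℝ) (t1 : ℝ) : Prop where
  d : ∀ t, HasDerivAt θ (θ' t) t
  c : Continuous θ'
  z : ∀ t, t1 ≤ t → θ t = 0
  z' : ∀ t, t1 ≤ t → θ' t = 0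

lemma Cut.cc {θ θ' : ℝ → ℝ} {t1 : ℝ} (C : Cut θ θ' t1) : Continuous θ :=
  continuous_iff_continuousAt.2 fun v => (C.d v).continuousAt

lemma glue {t0 t1 : ℝ} (ht : t1 < t0) {θ : ℝ → ℝ} (hθ : Continuous θ) (hz : ∀ t, t1 ≤ t → θ t = 0)
    {f : Q m → ℝ} (hf : ContinuousOn f {q : Q m | q.1.2 < t0}) : Continuous (fun q : Q m => θ q.1.2 * f q) := by
  rw [continuous_iff_continuousAt]
  intro q
  rcases lt_or_ge q.1.2 t0 with h | h
  · have o : IsOpen {q : Q m | q.1.2 < t0} := isOpen_lt (by fun_prop) continuous_const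
    exact (hθ.comp (by fun_prop : Continuous fun q : Q m => q.1.2)).continuousAt.mul (hf.continuousAt (o.mem_nhds h))
  · have o : IsOpen {q : Q m | t1 < q.1.2} := isOpen_lt continuous_const (by fun_prop)
    refine (continuousAt_const (y := (0 : ℝ))).congr ?_
    filter_upwards [o.mem_nhds (show t1 < q.1.2 by linarith)] with s hs
    rw [hz _ (le_of_lt hs), zero_mul]

lemma glue_line {t0 t1 : ℝ} (ht : t1 < t0) {θ θ' : ℝ → ℝ} (C : Cut θ θ' t1) {f : Q m → ℝ} {f' : ℝ} {q : Q m} {d : P m}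
    (h : q.1.2 < t0 → HasLineDerivAt ℝ (fun p => f (p, q.2)) f' q.1 d) :
    HasLineDerivAt ℝ (fun p : P m => θ p.2 * f (p, q.2)) (θ' q.1.2 * d.2 * f q + θ q.1.2 * f') q.1 d := by
  rcases lt_or_ge q.1.2 t0 with hq | hq
  · have k1 := h hq
    have k2 : HasDerivAt (fun s : ℝ => θ (q.1.2 + s * d.2)) (θ' q.1.2 * d.2) 0 := by
      have e : HasDerivAt (fun s : ℝ => q.1.2 + s * d.2) d.2 0 := by
        simpa using ((hasDerivAt_id (0 : ℝ)).mul_const d.2).const_add q.1.2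
      have := HasDerivAt.comp (h₂ := θ) (h₂' := θ' q.1.2) 0 (by simpa using C.d q.1.2) e
      exact this
    have := k2.fun_mul k1
    simpa [HasLineDerivAt] using this
  · rw [C.z _ (by linarith), C.z' _ (by linarith)]
    simp only [zero_mul, add_zero]
    unfold HasLineDerivAt
    refine (hasDerivAt_const (0 : ℝ) (0 : ℝ)).congr_of_eventuallyEq ?_
    have o : Continuous (fun s : ℝ => (q.1 + s • d).2) := by fun_prop
    have := (o.tendsto 0).eventually (lt_mem_nhds (show t1 < (q.1 + (0 : ℝ) • d).2 by simpa using by linarith))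
    filter_upwards [this] with s hs
    rw [C.z _ (le_of_lt hs), zero_mul]

lemma glue_y {t0 t1 : ℝ} (ht : t1 < t0) {θ θ' : ℝ → ℝ} (C : Cut θ θ' t1) {f : Q m → ℝ} {f' : ℝ} {q : Q m}
    (h : q.1.2 < t0 → HasDerivAt (fun y => f (q.1, y)) f' q.2) :
    HasDerivAt (fun y => θ q.1.2 * f (q.1, y)) (θ q.1.2 * f') q.2 := by
  rcases lt_or_ge q.1.2 t0 with hq | hq
  · exact (h hq).const_mul _
  · rw [C.z _ (by linarith)]; simpa using hasDerivAt_const q.2 (0 : ℝ)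

lemma box_compact (ξ : Q m) (R : ℝ) : IsCompact {q : Q m | q.1.2 ∈ Icc (ξ.1.2 - R) ξ.1.2 ∧ d2 ξ q ≤ R} := by
  have hd : Continuous (fun q : Q m => d2 ξ q) := by unfold d2; fun_prop
  refine (isCompact_closedBall ξ (R + 1)).of_isClosed_subset ?_ ?_
  · exact (isClosed_Icc.preimage (by fun_prop : Continuous fun q : Q m => q.1.2)).inter (isClosed_le hd continuous_const)
  · rintro q ⟨⟨h1, h2⟩, h3⟩
    have hR : 0 ≤ R := (d2_nonneg ξ q).trans h3
    have sq : ∀ x : ℝ, x ^ 2 ≤ R → |x| ≤ R + 1 := fun x hx => abs_le_of_sq_le_sq (by nlinarith) (by linarith)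
    have h4 : ∀ i, (q.1.1 i - ξ.1.1 i) ^ 2 ≤ R := by
      intro i
      have := Finset.single_le_sum (f := fun i => (q.1.1 i - ξ.1.1 i) ^ 2) (fun i _ => sq_nonneg _) (Finset.mem_univ i)
      unfold d2 at h3
      nlinarith [sq_nonneg (q.2 - ξ.2)]
    have h5 : (q.2 - ξ.2) ^ 2 ≤ R := by
      have := rr_nonneg ξ q; rw [d2_eq] at h3; linarith
    rw [Metric.mem_closedBall, Prod.dist_eq, Prod.dist_eq, max_le_iff, max_le_iff]
    refine ⟨⟨(dist_pi_le_iff (by linarith)).2 fun i => ?_, ?_⟩, ?_⟩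
    · exact sq _ (h4 i)
    · rw [Real.dist_eq, abs_le]; constructor <;> linarith
    · exact sq _ h5

lemma K_compact (h1 : -1 < a) (h2 : a < 1) (ξ : Q m) {c t1 : ℝ} (hc : 0 < c) (ht : t1 < ξ.1.2) :
    IsCompact {q : Q m | q.1.2 ≤ t1 ∧ c ≤ Gk a ξ q} := by
  obtain ⟨R, hR⟩ := Gk_bdd h1 h2 ξ (half_pos hc)
  refine (box_compact ξ R).of_isClosed_subset ?_ ?_
  · have c1 : ContinuousOn (fun q => Gk a ξ q) {q : Q m | q.1.2 ≤ t1} := (Gk_cont h1 h2 ξ).mono fun q hq => lt_of_le_of_lt hq ht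
    exact c1.preimage_isClosed_of_isClosed (isClosed_le (by fun_prop) continuous_const) isClosed_Ici
  · rintro q ⟨-, hq⟩
    obtain ⟨k1, k2, k3⟩ := hR q (by linarith)
    exact ⟨⟨by linarith, k1.le⟩, k3⟩

/-- the admissible test data built from the kernel -/
lemma test_data (h1 : -1 < a) (h2 : a < 1) (ξ : Q m) {h : ℝ → ℝ} {c M : ℝ} (p : Prof h c M) {θ θ' : ℝ → ℝ} {t1 : ℝ}
    (ht : t1 < ξ.1.2) (C : Cut θ θ' t1) :
    Tst a {q : Q m | q.1.2 ≤ t1 ∧ c ≤ Gk a ξ q} (fun q => θ q.1.2 * H2 h (Gk a ξ q))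
      (fun q => θ' q.1.2 * H2 h (Gk a ξ q) + θ q.1.2 * (H1 h (Gk a ξ q) * Gt a ξ q))
      (fun q => θ q.1.2 * (H1 h (Gk a ξ q) * Gq a ξ q))
      (fun q => θ q.1.2 * (-(H1 h (Gk a ξ q) * (Gt a ξ q + ∑ i, Gii a ξ i q))))
      (fun q => θ q.1.2 * (h (Gk a ξ q) * Gq a ξ q ^ 2))
      (fun i q => θ q.1.2 * (H1 h (Gk a ξ q) * Gi a ξ i q))
      (fun i q => θ q.1.2 * (h (Gk a ξ q) * Gi a ξ i q ^ 2 + H1 h (Gk a ξ q) * Gii a ξ i q)) := by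
  have gc := Gk_cont h1 h2 ξ
  have gct := Gt_cont h1 h2 ξ
  have gci := Gi_cont h1 h2 ξ
  have gcii := Gii_cont h1 h2 ξ
  have gcq := Gq_cont h1 h2 ξ
  have k0 := p.hc.comp_continuousOn gc
  have k1 := p.c1.comp_continuousOn gc
  have k2 := p.c2.comp_continuousOn gc
  have hz : ∀ q : Q m, q ∉ {q : Q m | q.1.2 ≤ t1 ∧ c ≤ Gk a ξ q} →
      (θ q.1.2 = 0 ∧ θ' q.1.2 = 0) ∨ (h (Gk a ξ q) = 0 ∧ H1 h (Gk a ξ q) = 0 ∧ H2 h (Gk a ξ q) = 0) := by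
    intro q hq
    rw [mem_ofPred_eq, not_and_or, not_le, not_le] at hq
    rcases hq with hq | hq
    · exact Or.inl ⟨C.z _ hq.le, C.z' _ hq.le⟩
    · exact Or.inr ⟨p.zc _ hq.le, p.z1 hq.le, p.z2 hq.le⟩
  have dl1 : ∀ q : Q m, ∀ d : P m, ∀ g', HasLineDerivAt ℝ (fun p => Gk a ξ (p, q.2)) g' q.1 d →
      HasLineDerivAt ℝ (fun p => H2 h (Gk a ξ (p, q.2))) (H1 h (Gk a ξ q) * g') q.1 d := by
    intro q d g' hg
    unfold HasLineDerivAt at hg ⊢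
    exact HasDerivAt.comp (h₂ := H2 h) 0 (by simpa using p.d2 _) hg
  have dl2 : ∀ q : Q m, ∀ d : P m, ∀ g', HasLineDerivAt ℝ (fun p => Gk a ξ (p, q.2)) g' q.1 d →
      HasLineDerivAt ℝ (fun p => H1 h (Gk a ξ (p, q.2))) (h (Gk a ξ q) * g') q.1 d := by
    intro q d g' hg
    unfold HasLineDerivAt at hg ⊢
    exact HasDerivAt.comp (h₂ := H1 h) 0 (by simpa using p.d1 _) hg
  refine ⟨K_compact h1 h2 ξ p.c0 ht, glue ht C.cc C.z k2, (glue ht C.c C.z' k2).add (glue ht C.cc C.z (k1.mul gct)),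
    glue ht C.cc C.z (k1.mul gcq), glue ht C.cc C.z (k1.mul (gct.add (continuousOn_finsetSum _ fun i _ => gcii i))).neg,
    glue ht C.cc C.z (k0.mul (gcq.pow 2)), fun i => glue ht C.cc C.z (k1.mul (gci i)),
    fun i => glue ht C.cc C.z ((k0.mul ((gci i).pow 2)).add (k1.mul (gcii i))), ?_, ?_, ?_, ?_, ?_, ?_, ?_, ?_, ?_, ?_, ?_, ?_⟩
  iterate 5
    · intro q hq
      rcases hz q hq with ⟨e1, e2⟩ | ⟨e1, e2, e3⟩ <;> simp [*]
  iterate 2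
    · intro i q hq
      rcases hz q hq with ⟨e1, e2⟩ | ⟨e1, e2, e3⟩ <;> simp [*]
  · intro q hq
    have := glue_line (q := q) (d := dt) ht C (f := fun q => H2 h (Gk a ξ q)) (fun hq => dl1 q dt _ (Gk_line_t h1 h2 ξ q hq))
    simpa [dt] using this
  · intro i q hq
    have := glue_line (q := q) (d := di i) ht C (f := fun q => H2 h (Gk a ξ q)) (fun hq => dl1 q (di i) _ (Gk_line h1 h2 ξ q hq i))
    simpa [di] using this
  · intro i q hq
    have := glue_line (q := q) (d := di i) ht C (f := fun q => H1 h (Gk a ξ q) * Gi a ξ i q)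
      (f' := h (Gk a ξ q) * Gi a ξ i q * Gi a ξ i q + H1 h (Gk a ξ q) * Gii a ξ i q) (fun hq => by
      have e1 := dl2 q (di i) _ (Gk_line h1 h2 ξ q hq i)
      have e2 := Gi_line h1 h2 ξ q hq i
      unfold HasLineDerivAt at e1 e2 ⊢
      simpa using e1.fun_mul e2)
    have e0 : (di i : P m).2 = 0 := rfl
    simp only [e0, mul_zero, zero_mul, zero_add] at this
    convert this using 1
    ring
  · intro q hq
    have := glue_y (q := q) ht C (f := fun q => H2 h (Gk a ξ q)) (fun hτ =>
      HasDerivAt.comp (h₂ := H2 h) q.2 (p.d2 _) (Gk_deriv_y h1 h2 ξ q hτ hq))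
    refine this.congr_deriv ?_
    ring
  · intro q hq
    have := glue_y (q := q) ht C (f := fun q => H1 h (Gk a ξ q) * Gq a ξ q) (fun hτ =>
      (HasDerivAt.comp (h₂ := H1 h) q.2 (p.d1 _) (Gk_deriv_y h1 h2 ξ q hτ hq)).mul (Gq_deriv_y h1 h2 ξ q hτ hq))
    refine this.congr_deriv ?_
    simp only [Function.comp, Prod.mk.eta]
    ring

/-- weighted squared gradient of the kernel -/
def Dg (a : ℝ) (ξ q : Q m) : ℝ := |q.2| ^ a * ∑ i, Gi a ξ i q ^ 2 + |q.2| ^ (-a) * Gq a ξ q ^ 2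

lemma cut_integrable (h1 : -1 < a) (h2 : a < 1) (ξ : Q m) {h : ℝ → ℝ} {c M : ℝ} (p : Prof h c M) {θ θ' : ℝ → ℝ} {t1 : ℝ}
    (ht : t1 < ξ.1.2) (C : Cut θ θ' t1) {w : Q m → ℝ} (hw : Continuous w) :
    Integrable (fun q => w q * (θ q.1.2 * (h (Gk a ξ q) * Dg a ξ q))) ∧
    Integrable (fun q => |q.2| ^ a * (θ' q.1.2 * (w q * H2 h (Gk a ξ q)))) := by
  have T := test_data h1 h2 ξ p ht C
  have gc := Gk_cont h1 h2 ξ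
  have gci := Gi_cont h1 h2 ξ
  have k0 := p.hc.comp_continuousOn gc
  have k2 := p.c2.comp_continuousOn gc
  have e1 := wint h1 (glue ht C.c C.z' (hw.continuousOn.mul k2)) (supp_of T.kc fun q hq => by
    rw [mem_ofPred_eq, not_and_or, not_le, not_le] at hq
    rcases hq with hq | hq
    · rw [C.z' _ hq.le, zero_mul]
    · simp [p.z2 hq.le])
  refine ⟨?_, e1⟩
  have e2 := wint h1 (glue ht C.cc C.z (hw.continuousOn.mul (k0.mul (continuousOn_finsetSum Finset.univ fun i _ => (gci i).pow 2)))) (supp_of T.kc fun q hq => by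
    rw [mem_ofPred_eq, not_and_or, not_le, not_le] at hq
    rcases hq with hq | hq
    · rw [C.z _ hq.le, zero_mul]
    · simp [p.zc _ hq.le])
  have e3 := wint (e := -a) (by linarith) (hw.mul T.c4) (supp_of T.kc fun q hq => by simp only [Pi.mul_apply, T.z4 q hq, mul_zero])
  refine (e2.add e3).congr (Eventually.of_forall fun q => ?_)
  simp only [Pi.add_apply, Pi.mul_apply, Pi.pow_apply, Function.comp, Dg]
  ring

lemma cut_identity (h1 : -1 < a) (h2 : a < 1) (ξ : Q m) {h : ℝ → ℝ} {c M : ℝ} (p : Prof h c M) {θ θ' : ℝ → ℝ} {t1 : ℝ}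
    (ht : t1 < ξ.1.2) (C : Cut θ θ' t1) {w : Q m → ℝ} {w1 w2 : Q m → Q m → ℝ} (hw : Reg w w1 w2)
    (hf : ∀ p : P m, ∃ L, Tendsto (fun y => |y| ^ a * w1 ey (p, y)) (𝓝[>] 0) (𝓝 L) ∧
      Tendsto (fun y => |y| ^ a * w1 ey (p, y)) (𝓝[<] 0) (𝓝 L))
    {U : Set (Q m)} (hU : IsOpen U) (hKU : {q | c ≤ Gk a ξ q} ⊆ U) (hL : ∀ q ∈ U, q ∈ Om m → Lop a w1 w2 q = 0) :
    ∫ q, w q * (θ q.1.2 * (h (Gk a ξ q) * Dg a ξ q)) = - ∫ q : Q m, |q.2| ^ a * (θ' q.1.2 * (w q * H2 h (Gk a ξ q))) := by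
  obtain ⟨i1, i2⟩ := cut_integrable h1 h2 ξ p ht C hw.c
  have g := green h1 h2 hw hf hU (fun q hq => hKU hq.2) hL (test_data h1 h2 ξ p ht C)
  rw [← add_eq_zero_iff_eq_neg, ← integral_add i1 i2, ← g]
  congr 1; funext q
  simp only [Dg, Finset.sum_add_distrib, ← Finset.mul_sum]
  ring
end MV
end

noncomputable section
open Real MeasureTheory Set Filter Topology
namespace MV
variable {m : ℕ} {a : ℝ}

abbrev Z (m : ℕ) := (Fin m → ℝ) × ℝ
/-- point at time τ -/
abbrev emb (τ : ℝ) (z : Z m) : Q m := ((z.1, τ), z.2)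

lemma W_integrable (h1 : -1 < a) (ξ : Q m) (τ : ℝ) : Integrable (fun z : Z m => |z.2| ^ a * exp (-d2 ξ (emb τ z) / 16)) := by
  have i1 : Integrable (fun x : Fin m → ℝ => exp (-(∑ i, (x i - ξ.1.1 i) ^ 2) / 16)) := by
    by_contra h
    have := heat_mass ξ.1.1 (s := 4) (by norm_num)
    norm_num at this
    rw [integral_undef h] at this
    have h3 : (0 : ℝ) < (4 * π * 4) ^ ((m : ℝ) / 2) := by positivity
    norm_num at this h3
    linarith
  have i2 : Integrable (fun y : ℝ => |y| ^ a * exp (-(y - ξ.2) ^ 2 / 16)) := by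
    refine ((abs_gauss_integrable h1 (β := 1 / 32) (by norm_num)).const_mul (exp (ξ.2 ^ 2 / 16))).mono' ?_ (Eventually.of_forall fun y => ?_)
    · exact (by fun_prop : Measurable fun y : ℝ => |y| ^ a * exp (-(y - ξ.2) ^ 2 / 16)).aestronglyMeasurable
    · rw [Real.norm_of_nonneg (by positivity), mul_left_comm, ← Real.exp_add]
      gcongr
      nlinarith [sq_nonneg (y - 2 * ξ.2)]
  have := i1.mul_prod i2
  rw [← Measure.volume_eq_prod] at this
  refine this.congr (Eventually.of_forall fun z => ?_)
  simp only [d2, emb]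
  rw [mul_left_comm, ← Real.exp_add]
  congr 2; ring

lemma V_small (h1 : -1 < a) (ξ : Q m) (τ : ℝ) :
    Tendsto (fun k : ℕ => ∫ z : Z m, |z.2| ^ a * {z : Z m | d2 ξ (emb τ z) ≤ 1 / ((k : ℝ) + 1)}.indicator 1 z) atTop (𝓝 0) := by
  have hd : Measurable (fun z : Z m => d2 ξ (emb τ z)) := by unfold d2 emb; fun_prop
  have key := tendsto_integral_of_dominated_convergence (μ := (volume : Measure (Z m)))
    (F := fun (k : ℕ) (z : Z m) => |z.2| ^ a * {z : Z m | d2 ξ (emb τ z) ≤ 1 / ((k : ℝ) + 1)}.indicator 1 z)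
    (f := fun _ => (0 : ℝ)) (fun z => exp 1 * (|z.2| ^ a * exp (-d2 ξ (emb τ z) / 16))) (fun k => by
      refine Measurable.aestronglyMeasurable (Measurable.mul (by fun_prop) ?_)
      exact measurable_one.indicator (measurableSet_le hd measurable_const)) ((W_integrable h1 ξ τ).const_mul _) (fun k => Eventually.of_forall fun z => by
      rw [norm_mul, Real.norm_of_nonneg (by positivity : 0 ≤ |z.2| ^ a), mul_left_comm]
      gcongr
      by_cases hz : d2 ξ (emb τ z) ≤ 1 / ((k : ℝ) + 1)
      · rw [indicator_of_mem (by exact hz), ← Real.exp_add]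
        simp only [Pi.one_apply, norm_one]
        apply Real.one_le_exp
        have : 1 / ((k : ℝ) + 1) ≤ 1 := by
          rw [div_le_one (by positivity)]; linarith [(Nat.cast_nonneg k : (0 : ℝ) ≤ k)]
        linarith
      · rw [indicator_of_notMem (by exact hz), norm_zero]; positivity) (by
      have : ∀ᵐ z : Z m, z ≠ (ξ.1.1, ξ.2) := by
        rw [ae_iff]; simp only [not_not]
        rw [show {z : Z m | z = (ξ.1.1, ξ.2)} = {(ξ.1.1, ξ.2)} from rfl, Measure.volume_eq_prod]
        rw [← singleton_prod_singleton, Measure.prod_prod]; simp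
      filter_upwards [this] with z hz
      have hpos : 0 < d2 ξ (emb τ z) := by
        refine lt_of_le_of_ne (d2_nonneg _ _) fun h0 => hz ?_
        have e0 : ∑ i, (z.1 i - ξ.1.1 i) ^ 2 + (z.2 - ξ.2) ^ 2 = 0 := h0.symm
        have e1 : 0 ≤ ∑ i, (z.1 i - ξ.1.1 i) ^ 2 := Finset.sum_nonneg fun _ _ => sq_nonneg _
        have e2 : ∑ i, (z.1 i - ξ.1.1 i) ^ 2 = 0 := by nlinarith [sq_nonneg (z.2 - ξ.2)]
        have e3 : (z.2 - ξ.2) ^ 2 = 0 := by linarith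
        rw [Finset.sum_eq_zero_iff_of_nonneg (fun _ _ => sq_nonneg _)] at e2
        refine Prod.ext (funext fun i => ?_) (by simpa [sub_eq_zero] using e3)
        simpa [sub_eq_zero] using e2 i (Finset.mem_univ i)
      refine tendsto_const_nhds.congr' ?_
      have := (tendsto_one_div_add_atTop_nhds_zero_nat (𝕜 := ℝ)).eventually (gt_mem_nhds hpos)
      filter_upwards [this] with k hk
      rw [indicator_of_notMem (by simpa using hk), mul_zero])
  simpa using key

lemma near_of_d2 (ξ : Q m) {δ : ℝ} (hδ : 0 < δ) (q : Q m) (hd : d2 ξ q < δ ^ 2) (ht : |q.1.2 - ξ.1.2| < δ) : dist q ξ < δ := by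
  have sq : ∀ x : ℝ, x ^ 2 < δ ^ 2 → |x| < δ := fun x hx => abs_lt_of_sq_lt_sq hx hδ.le
  have h4 : ∀ i, (q.1.1 i - ξ.1.1 i) ^ 2 < δ ^ 2 := by
    intro i
    have := Finset.single_le_sum (f := fun i => (q.1.1 i - ξ.1.1 i) ^ 2) (fun i _ => sq_nonneg _) (Finset.mem_univ i)
    unfold d2 at hd
    nlinarith [sq_nonneg (q.2 - ξ.2)]
  have h5 : (q.2 - ξ.2) ^ 2 < δ ^ 2 := by
    have := rr_nonneg ξ q; rw [d2_eq] at hd; linarith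
  rw [Prod.dist_eq, Prod.dist_eq, max_lt_iff, max_lt_iff]
  exact ⟨⟨(dist_pi_lt_iff hδ).2 fun i => sq _ (h4 i), ht⟩, sq _ h5⟩

lemma w_bdd (h1 : -1 < a) (h2 : a < 1) (ξ : Q m) {c : ℝ} (hc : 0 < c) {w : Q m → ℝ} (hw : Continuous w) :
    ∃ C, 0 ≤ C ∧ ∀ q, c < Gk a ξ q → |w q| ≤ C := by
  obtain ⟨R, hR⟩ := Gk_bdd h1 h2 ξ hc
  obtain ⟨C, hC⟩ := (box_compact ξ R).exists_bound_of_continuousOn hw.continuousOn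
  refine ⟨max C 0, le_max_right _ _, fun q hq => ?_⟩
  obtain ⟨k1, k2, k3⟩ := hR q hq
  exact (hC q ⟨⟨by linarith, k1.le⟩, k3⟩).trans (le_max_left _ _)

lemma wH_bound (h1 : -1 < a) (h2 : a < 1) (ξ : Q m) {h : ℝ → ℝ} {c M C : ℝ} (p : Prof h c M) {w : Q m → ℝ}
    (hC0 : 0 ≤ C) (hC : ∀ q, c < Gk a ξ q → |w q| ≤ C) (q : Q m) : |w q * H2 h (Gk a ξ q)| ≤ C * H1 h M * Gk a ξ q := by
  have hG := Gk_nonneg h1 h2 ξ q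
  have hk := p.nn M
  rcases le_or_gt (Gk a ξ q) c with h' | h'
  · rw [p.z2 h', mul_zero, abs_zero]; positivity
  · rw [abs_mul, abs_of_nonneg (p.nn2 _), mul_assoc]
    exact mul_le_mul (hC q h') (p.le2 hG) (p.nn2 _) hC0

lemma slice_int (h1 : -1 < a) (h2 : a < 1) (ξ : Q m) {h : ℝ → ℝ} {c M : ℝ} (p : Prof h c M) {w : Q m → ℝ} (hw : Continuous w)
    {τ : ℝ} (hτ : τ < ξ.1.2) :
    Integrable (fun z : Z m => |z.2| ^ a * (w (emb τ z) * H2 h (Gk a ξ (emb τ z)))) := by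
  obtain ⟨C, hC0, hC⟩ := w_bdd h1 h2 ξ p.c0 hw
  have hc : Continuous (fun z : Z m => Gk a ξ (emb τ z)) :=
    (Gk_cont h1 h2 ξ).comp_continuous (by fun_prop) (fun z => hτ)
  refine ((Gk_mass h1 h2 ξ hτ).1.const_mul (C * H1 h M)).mono' ?_ (Eventually.of_forall fun z => ?_)
  · refine AEStronglyMeasurable.mul (by fun_prop : Measurable fun z : Z m => |z.2| ^ a).aestronglyMeasurable ?_
    exact ((hw.comp (by fun_prop)).mul (p.c2.comp hc)).aestronglyMeasurable
  · rw [norm_mul, Real.norm_of_nonneg (by positivity : 0 ≤ |z.2| ^ a), mul_left_comm]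
    gcongr
    exact wH_bound h1 h2 ξ p hC0 hC _

/-- concentration of the kernel at the pole -/
lemma slice_lim (h1 : -1 < a) (h2 : a < 1) (ξ : Q m) {h : ℝ → ℝ} {c M : ℝ} (p : Prof h c M) {w : Q m → ℝ} (hw : Continuous w) :
    Tendsto (fun τ => ∫ z : Z m, |z.2| ^ a * (w (emb τ z) * H2 h (Gk a ξ (emb τ z)))) (𝓝[<] ξ.1.2) (𝓝 (H1 h M * w ξ)) := by
  obtain ⟨C, hC0, hC⟩ := w_bdd h1 h2 ξ p.c0 hw
  set κ := H1 h M with hκ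
  have hk : 0 ≤ κ := p.nn M
  have hM : 0 ≤ M := p.c0.le.trans p.cM
  rw [Metric.tendsto_nhds]
  intro ε' hε'
  set Kc := κ + |w ξ| * κ * M + 1 with hKc
  have hKc0 : 0 < Kc := by positivity
  set ε := ε' / (2 * Kc) with hε
  have hε0 : 0 < ε := by positivity
  obtain ⟨δ, hδ, hδw⟩ := Metric.continuousAt_iff.1 (hw.continuousAt (x := ξ)) ε hε0
  have hV := (V_small h1 ξ 0).eventually (gt_mem_nhds hε0)
  have hk2 := (tendsto_one_div_add_atTop_nhds_zero_nat (𝕜 := ℝ)).eventually (gt_mem_nhds (show 0 < δ ^ 2 by positivity))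
  obtain ⟨k, hVk, hkk⟩ := (hV.and hk2).exists
  set e1 := 1 / ((k : ℝ) + 1) with he1
  have he10 : 0 < e1 := by positivity
  obtain ⟨o, ho, hof⟩ := Gk_far h1 h2 ξ he10
  set IW := ∫ z : Z m, |z.2| ^ a * exp (-d2 ξ (emb 0 z) / 16) with hIW
  have hIW0 : 0 ≤ IW := integral_nonneg fun z => by positivity
  have hshift : Tendsto (fun τ => ξ.1.2 - τ) (𝓝[<] ξ.1.2) (𝓝[>] 0) := by
    refine tendsto_nhdsWithin_iff.2 ⟨?_, ?_⟩
    · have : Tendsto (fun τ => ξ.1.2 - τ) (𝓝 ξ.1.2) (𝓝 (ξ.1.2 - ξ.1.2)) := (continuous_const.sub continuous_id).tendsto _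
      rw [sub_self] at this
      exact this.mono_left nhdsWithin_le_nhds
    · filter_upwards [self_mem_nhdsWithin] with τ hτ
      exact sub_pos.2 (mem_Iio.1 hτ)
  have ho2 : Tendsto (fun τ => (C + |w ξ|) * κ * (o (ξ.1.2 - τ) * IW)) (𝓝[<] ξ.1.2) (𝓝 0) := by
    simpa using ((ho.comp hshift).mul_const IW).const_mul ((C + |w ξ|) * κ)
  have hτ1 : ∀ᶠ τ in 𝓝[<] ξ.1.2, ξ.1.2 - min δ 1 < τ :=
    nhdsWithin_le_nhds (lt_mem_nhds (by have : 0 < min δ 1 := by positivity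
                                        linarith))
  filter_upwards [self_mem_nhdsWithin, ho2.eventually (gt_mem_nhds hε0), hτ1] with τ hτ hoτ hτδ
  have hτ0 : τ < ξ.1.2 := hτ
  have ht1 : ξ.1.2 - τ ≤ 1 := by have := min_le_right δ 1; linarith
  have ht2 : |τ - ξ.1.2| < δ := by
    rw [abs_lt]; have := min_le_left δ 1; constructor <;> linarith
  obtain ⟨mi, mm⟩ := Gk_mass h1 h2 ξ hτ0
  have si := slice_int h1 h2 ξ p hw hτ0
  have wi := W_integrable h1 ξ 0
  have vi : Integrable (fun z : Z m => |z.2| ^ a * {z : Z m | d2 ξ (emb 0 z) ≤ e1}.indicator 1 z) := by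
    have hd : Measurable (fun z : Z m => d2 ξ (emb 0 z)) := by unfold d2 emb; fun_prop
    refine (wi.const_mul (exp e1)).mono' (Measurable.aestronglyMeasurable (Measurable.mul (by fun_prop)
      (measurable_one.indicator (measurableSet_le hd measurable_const)))) (Eventually.of_forall fun z => ?_)
    rw [norm_mul, Real.norm_of_nonneg (by positivity : 0 ≤ |z.2| ^ a), mul_left_comm]
    gcongr
    by_cases hz : d2 ξ (emb 0 z) ≤ e1
    · rw [indicator_of_mem (by exact hz), ← Real.exp_add]
      simp only [Pi.one_apply, norm_one]
      apply Real.one_le_exp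
      linarith [d2_nonneg ξ (emb 0 z)]
    · rw [indicator_of_notMem (by exact hz), norm_zero]; positivity
  have hdiff : (∫ z : Z m, |z.2| ^ a * (w (emb τ z) * H2 h (Gk a ξ (emb τ z)))) - κ * w ξ
      = ∫ z : Z m, (|z.2| ^ a * (w (emb τ z) * H2 h (Gk a ξ (emb τ z))) - κ * w ξ * (|z.2| ^ a * Gk a ξ (emb τ z))) := by
    rw [integral_sub si (mi.const_mul _), integral_const_mul, mm, mul_one]
  have hbd : ∀ z : Z m, ‖|z.2| ^ a * (w (emb τ z) * H2 h (Gk a ξ (emb τ z))) - κ * w ξ * (|z.2| ^ a * Gk a ξ (emb τ z))‖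
      ≤ ε * κ * (|z.2| ^ a * Gk a ξ (emb τ z)) + |w ξ| * κ * M * (|z.2| ^ a * {z : Z m | d2 ξ (emb 0 z) ≤ e1}.indicator 1 z)
        + (C + |w ξ|) * κ * o (ξ.1.2 - τ) * (|z.2| ^ a * exp (-d2 ξ (emb 0 z) / 16)) := by
    intro z
    set G := Gk a ξ (emb τ z) with hG
    have hG0 : 0 ≤ G := Gk_nonneg h1 h2 ξ _
    set H := H2 h G with hH
    have hH0 : 0 ≤ H := p.nn2 G
    have hHk : H ≤ κ * G := p.le2 hG0
    have hgap : κ * G - H ≤ κ * M := p.gap G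
    have hy : 0 ≤ |z.2| ^ a := by positivity
    have hwb := wH_bound h1 h2 ξ p hC0 hC (emb τ z)
    rw [show |z.2| ^ a * (w (emb τ z) * H) - κ * w ξ * (|z.2| ^ a * G) = |z.2| ^ a * (w (emb τ z) * H - κ * w ξ * G) by ring,
      norm_mul, Real.norm_of_nonneg hy, Real.norm_eq_abs]
    rw [show ε * κ * (|z.2| ^ a * G) + |w ξ| * κ * M * (|z.2| ^ a * {z : Z m | d2 ξ (emb 0 z) ≤ e1}.indicator 1 z)
        + (C + |w ξ|) * κ * o (ξ.1.2 - τ) * (|z.2| ^ a * exp (-d2 ξ (emb 0 z) / 16)) =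
        |z.2| ^ a * (ε * κ * G + |w ξ| * κ * M * {z : Z m | d2 ξ (emb 0 z) ≤ e1}.indicator 1 z
        + (C + |w ξ|) * κ * (o (ξ.1.2 - τ) * exp (-d2 ξ (emb 0 z) / 16))) by ring]
    refine mul_le_mul_of_nonneg_left ?_ hy
    have hfar : e1 ≤ d2 ξ (emb 0 z) → G ≤ o (ξ.1.2 - τ) * exp (-d2 ξ (emb 0 z) / 16) := fun hh => hof (emb τ z) hτ0 ht1 hh
    have hn0 : 0 ≤ o (ξ.1.2 - τ) * exp (-d2 ξ (emb 0 z) / 16) := by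
      have big : ∃ z' : Z m, e1 ≤ d2 ξ (emb 0 z') := by
        refine ⟨(ξ.1.1, ξ.2 + 1), ?_⟩
        simp only [d2, emb, sub_self]
        have : e1 ≤ 1 := by
          rw [he1, div_le_one (by positivity)]; linarith [(Nat.cast_nonneg k : (0 : ℝ) ≤ k)]
        simpa using this
      obtain ⟨z', hz'⟩ := big
      have := (Gk_nonneg h1 h2 ξ (emb τ z')).trans (hof (emb τ z') hτ0 ht1 hz')
      have := nonneg_of_mul_nonneg_left this (Real.exp_pos _)
      positivity
    have hn1 : 0 ≤ (C + |w ξ|) * κ := by positivity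
    rcases le_or_gt e1 (d2 ξ (emb 0 z)) with hz | hz
    · have g1 := hfar hz
      have : |w (emb τ z) * H - κ * w ξ * G| ≤ (C + |w ξ|) * κ * G := by
        refine (abs_sub _ _).trans ?_
        have : |κ * w ξ * G| = |w ξ| * κ * G := by
          rw [abs_mul, abs_mul, abs_of_nonneg hk, abs_of_nonneg hG0]; ring
        rw [this]
        have e : (C + |w ξ|) * κ * G = C * κ * G + |w ξ| * κ * G := by ring
        rw [e]; gcongr
      have g2 := mul_le_mul_of_nonneg_left g1 hn1
      have g3 : 0 ≤ ε * κ * G := by positivity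
      have g4 : 0 ≤ |w ξ| * κ * M * {z : Z m | d2 ξ (emb 0 z) ≤ e1}.indicator 1 z := by
        refine mul_nonneg (by positivity) (indicator_nonneg (fun _ _ => by simp) _)
      linarith
    · have hww : |w (emb τ z) - w ξ| ≤ ε := by
        have := hδw (near_of_d2 ξ hδ (emb τ z) (lt_trans hz hkk) ht2)
        exact (le_of_lt this)
      have e : w (emb τ z) * H - κ * w ξ * G = (w (emb τ z) - w ξ) * H - w ξ * (κ * G - H) := by ring
      have : |w (emb τ z) * H - κ * w ξ * G| ≤ ε * κ * G + |w ξ| * κ * M := by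
        rw [e]
        refine (abs_sub _ _).trans ?_
        rw [abs_mul, abs_mul, abs_of_nonneg hH0, abs_of_nonneg (sub_nonneg.2 hHk), mul_assoc, mul_assoc]
        gcongr
      rw [indicator_of_mem (by exact hz.le), Pi.one_apply, mul_one]
      have := mul_nonneg hn1 hn0
      linarith
  rw [Real.dist_eq, hdiff, ← Real.norm_eq_abs]
  have ib := ((mi.const_mul (ε * κ)).add (vi.const_mul (|w ξ| * κ * M))).add (wi.const_mul ((C + |w ξ|) * κ * o (ξ.1.2 - τ)))
  refine lt_of_le_of_lt (norm_integral_le_of_norm_le ib (Eventually.of_forall hbd)) ?_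
  have ei : ∫ z : Z m, (((fun z : Z m => ε * κ * (|z.2| ^ a * Gk a ξ ((z.1, τ), z.2))) + fun z : Z m => |w ξ| * κ * M * (|z.2| ^ a * {z : Z m | d2 ξ (emb 0 z) ≤ e1}.indicator 1 z)) + fun z : Z m => (C + |w ξ|) * κ * o (ξ.1.2 - τ) * (|z.2| ^ a * exp (-d2 ξ (emb 0 z) / 16))) z
     = ε * κ + |w ξ| * κ * M * (∫ z : Z m, |z.2| ^ a * {z : Z m | d2 ξ (emb 0 z) ≤ e1}.indicator 1 z) + (C + |w ξ|) * κ * o (ξ.1.2 - τ) * IW := by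
    rw [integral_add' ((mi.const_mul (ε * κ)).add (vi.const_mul (|w ξ| * κ * M))) (wi.const_mul ((C + |w ξ|) * κ * o (ξ.1.2 - τ))),
      integral_add' (mi.const_mul (ε * κ)) (vi.const_mul (|w ξ| * κ * M)), integral_const_mul, integral_const_mul, integral_const_mul, mm, mul_one]
  rw [ei]
  have l1 : |w ξ| * κ * M * (∫ z : Z m, |z.2| ^ a * {z : Z m | d2 ξ (emb 0 z) ≤ e1}.indicator 1 z) ≤ |w ξ| * κ * M * ε := by gcongr
  have l2 : ε * Kc = ε' / 2 := by rw [hε]; field_simp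
  have l3 : ε * Kc = ε * κ + |w ξ| * κ * M * ε + ε := by rw [hKc]; ring
  linarith
end MV
end

noncomputable section
open Real MeasureTheory Set Filter Topology
namespace MV
variable {m : ℕ} {a : ℝ}

/-- time cut-off -/
def th (t0 j t : ℝ) : ℝ := Real.smoothTransition (j * (t0 - t) - 1)
def th' (t0 j t : ℝ) : ℝ := deriv Real.smoothTransition (j * (t0 - t) - 1) * (-j)

lemma st_d (x : ℝ) : HasDerivAt Real.smoothTransition (deriv Real.smoothTransition x) x :=
  ((Real.smoothTransition.contDiff (n := 1)).differentiable (by norm_num) x).hasDerivAt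

lemma st_c : Continuous (deriv Real.smoothTransition) :=
  (Real.smoothTransition.contDiff (n := 1)).continuous_deriv (by norm_num)

lemma st_neg {x : ℝ} (hx : x < 0) : deriv Real.smoothTransition x = 0 := by
  have : Real.smoothTransition =ᶠ[𝓝 x] fun _ => 0 := by
    filter_upwards [gt_mem_nhds hx] with s hs
    exact Real.smoothTransition.zero_of_nonpos hs.le
  rw [this.deriv_eq]; simp

lemma st_gt {x : ℝ} (hx : 1 < x) : deriv Real.smoothTransition x = 0 := by
  have : Real.smoothTransition =ᶠ[𝓝 x] fun _ => 1 := by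
    filter_upwards [lt_mem_nhds hx] with s hs
    exact Real.smoothTransition.one_of_one_le hs.le
  rw [this.deriv_eq]; simp

lemma st_nn (x : ℝ) : 0 ≤ deriv Real.smoothTransition x := Real.smoothTransition.monotone.deriv_nonneg

lemma th_d (t0 j t : ℝ) : HasDerivAt (th t0 j) (th' t0 j t) t := by
  have e : HasDerivAt (fun t => j * (t0 - t) - 1) (-j) t := by
    simpa using (((hasDerivAt_id t).const_sub t0).const_mul j).sub_const 1
  exact HasDerivAt.comp (h₂ := Real.smoothTransition) t (st_d _) e

lemma th_cut (t0 : ℝ) {j : ℝ} (hj : 0 < j) : Cut (th t0 j) (th' t0 j) (t0 - 1 / (2 * j)) := by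
  have hx : ∀ t, t0 - 1 / (2 * j) ≤ t → j * (t0 - t) - 1 < 0 := by
    intro t ht
    have : j * (t0 - t) ≤ j * (1 / (2 * j)) := by gcongr; linarith
    have e : j * (1 / (2 * j)) = 1 / 2 := by field_simp
    linarith
  refine ⟨th_d t0 j, ?_, fun t ht => Real.smoothTransition.zero_of_nonpos (hx t ht).le, fun t ht => ?_⟩
  · unfold th'
    exact (st_c.comp (by fun_prop)).mul continuous_const
  · unfold th'; rw [st_neg (hx t ht), zero_mul]

lemma th'_np (t0 : ℝ) {j : ℝ} (hj : 0 < j) (t : ℝ) : th' t0 j t ≤ 0 := by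
  unfold th'; have := st_nn (j * (t0 - t) - 1); nlinarith

lemma th'_far (t0 : ℝ) {j : ℝ} (hj : 0 < j) {t : ℝ} (ht : t ≤ t0 - 3 / j) : th' t0 j t = 0 := by
  unfold th'
  rw [st_gt, zero_mul]
  have : j * (3 / j) ≤ j * (t0 - t) := by gcongr; linarith
  have e : j * (3 / j) = 3 := by field_simp
  linarith

lemma th'_int (t0 : ℝ) {j : ℝ} (hj : 0 < j) : Integrable (th' t0 j) ∧ ∫ t, th' t0 j t = -1 := by
  have C := th_cut t0 hj
  have hsupp : Function.support (th' t0 j) ⊆ Ioc (t0 - 3 / j) t0 := by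
    intro t ht
    constructor
    · by_contra h; exact ht (th'_far t0 hj (not_lt.1 h))
    · by_contra h
      have : 0 < 1 / (2 * j) := by positivity
      exact ht (C.z' t (by linarith [not_le.1 h]))
  constructor
  · refine C.c.integrable_of_hasCompactSupport (HasCompactSupport.intro (isCompact_Icc (a := t0 - 3 / j) (b := t0)) fun t ht => ?_)
    by_contra h
    exact ht (Ioc_subset_Icc_self (hsupp h))
  · rw [← intervalIntegral.integral_eq_integral_of_support_subset hsupp,
      intervalIntegral.integral_eq_sub_of_hasDerivAt (fun t _ => th_d t0 j t) (C.c.intervalIntegrable _ _)]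
    have e1 : th t0 j t0 = 0 := Real.smoothTransition.zero_of_nonpos (by simp)
    have e2 : th t0 j (t0 - 3 / j) = 1 := Real.smoothTransition.one_of_one_le (by
      have : j * (3 / j) = 3 := by field_simp
      rw [sub_sub_cancel, this]; norm_num)
    rw [e1, e2]; ring

lemma th_lim (t0 : ℝ) {t : ℝ} (ht : t < t0) : Tendsto (fun k : ℕ => th t0 (k + 1) t) atTop (𝓝 1) := by
  obtain ⟨n, hn⟩ := exists_nat_gt (2 / (t0 - t))
  refine tendsto_const_nhds.congr' ?_
  filter_upwards [eventually_ge_atTop n] with k hk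
  refine (Real.smoothTransition.one_of_one_le ?_).symm
  have h0 : 0 < t0 - t := sub_pos.2 ht
  have h1 : 2 / (t0 - t) < (k : ℝ) + 1 := by
    have : (n : ℝ) ≤ k := by exact_mod_cast hk
    linarith
  rw [div_lt_iff₀ h0] at h1
  linarith

lemma th_nn (t0 j t : ℝ) : 0 ≤ th t0 j t := Real.smoothTransition.nonneg _
lemma th_le (t0 j t : ℝ) : th t0 j t ≤ 1 := Real.smoothTransition.le_one _

/-- reordering of variables -/
def reQ (m : ℕ) : ℝ × Z m ≃ᵐ Q m :=
  (MeasurableEquiv.prodAssoc (α := ℝ) (β := Fin m → ℝ) (γ := ℝ)).symm.trans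
    (MeasurableEquiv.prodCongr MeasurableEquiv.prodComm (MeasurableEquiv.refl ℝ))

lemma reQ_apply (s : ℝ × Z m) : reQ m s = emb s.1 s.2 := rfl

lemma reQ_mp : MeasurePreserving (reQ m) volume volume := by
  have e1 : MeasurePreserving (MeasurableEquiv.prodAssoc (α := ℝ) (β := Fin m → ℝ) (γ := ℝ)).symm volume volume :=
    (volume_preserving_prodAssoc).symm _
  have e2 : MeasurePreserving (Prod.map (Prod.swap : ℝ × (Fin m → ℝ) → P m) (id : ℝ → ℝ)) volume volume := by
    simp only [Measure.volume_eq_prod]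
    exact Measure.measurePreserving_swap.prod (MeasurePreserving.id _)
  exact e2.comp e1

lemma fub {F : Q m → ℝ} (hF : Integrable F) :
    ∫ q, F q = ∫ τ : ℝ, ∫ z : Z m, F (emb τ z) := by
  rw [← reQ_mp.integral_comp (reQ m).measurableEmbedding, Measure.volume_eq_prod, integral_prod]
  · rfl
  · rw [← Measure.volume_eq_prod]
    exact (reQ_mp.integrable_comp_emb (reQ m).measurableEmbedding).2 hF

lemma fub_int {F : Q m → ℝ} (hF : Integrable F) : Integrable (fun τ : ℝ => ∫ z : Z m, F (emb τ z)) := by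
  have : Integrable (F ∘ reQ m) := (reQ_mp.integrable_comp_emb (reQ m).measurableEmbedding).2 hF
  rw [Measure.volume_eq_prod] at this
  exact this.integral_prod_left

lemma time_lim (h1 : -1 < a) (h2 : a < 1) (ξ : Q m) {h : ℝ → ℝ} {c M : ℝ} (p : Prof h c M) {w : Q m → ℝ} (hw : Continuous w) :
    Tendsto (fun k : ℕ => - ∫ q : Q m, |q.2| ^ a * (th' ξ.1.2 (k + 1) q.1.2 * (w q * H2 h (Gk a ξ q)))) atTop (𝓝 (H1 h M * w ξ)) := by
  set J : ℝ → ℝ := fun τ => ∫ z : Z m, |z.2| ^ a * (w (emb τ z) * H2 h (Gk a ξ (emb τ z))) with hJ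
  have hl := slice_lim h1 h2 ξ p hw
  rw [Metric.tendsto_nhds] at hl
  rw [Metric.tendsto_nhds]
  intro ε hε
  obtain ⟨t, ht, hts⟩ := (mem_nhdsLT_iff_exists_Ioo_subset).1 (hl (ε / 2) (half_pos hε))
  obtain ⟨n, hn⟩ := exists_nat_gt (3 / (ξ.1.2 - t))
  filter_upwards [eventually_ge_atTop n] with k hk
  have hj : (0 : ℝ) < (k : ℝ) + 1 := by positivity
  set j : ℝ := (k : ℝ) + 1
  have htj : t ≤ ξ.1.2 - 3 / j := by
    have h0 : 0 < ξ.1.2 - t := sub_pos.2 ht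
    have h1 : 3 / (ξ.1.2 - t) < j := by
      have : (n : ℝ) ≤ k := by exact_mod_cast hk
      simp only [j]; linarith
    rw [div_lt_iff₀ h0] at h1
    have : 3 / j ≤ ξ.1.2 - t := by rw [div_le_iff₀ hj]; linarith
    linarith
  have ht1 : ξ.1.2 - 1 / (2 * j) < ξ.1.2 := by have : 0 < 1 / (2 * j) := by positivity
                                               linarith
  have C := th_cut ξ.1.2 hj
  have hi := (cut_integrable h1 h2 ξ p ht1 C hw).2
  have hfi := fub_int hi
  have e1 : ∀ τ, ∫ z : Z m, |(emb τ z).2| ^ a * (th' ξ.1.2 j (emb τ z).1.2 * (w (emb τ z) * H2 h (Gk a ξ (emb τ z)))) = th' ξ.1.2 j τ * J τ := by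
    intro τ
    rw [hJ, ← integral_const_mul]
    congr 1; funext z; simp only [emb]; ring
  simp_rw [e1] at hfi
  obtain ⟨ti, tm⟩ := th'_int ξ.1.2 hj
  rw [fub hi]
  simp_rw [e1]
  have : - (∫ τ, th' ξ.1.2 j τ * J τ) - H1 h M * w ξ = ∫ τ, th' ξ.1.2 j τ * (H1 h M * w ξ - J τ) := by
    simp_rw [mul_sub]
    rw [integral_sub (ti.mul_const _) hfi, integral_mul_const, tm]; ring
  rw [Real.dist_eq, this, ← Real.norm_eq_abs]
  refine lt_of_le_of_lt (norm_integral_le_of_norm_le (ti.neg.mul_const (ε / 2)) (Eventually.of_forall fun τ => ?_)) ?_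
  · rw [norm_mul, Real.norm_eq_abs, abs_of_nonpos (th'_np _ hj τ), Pi.neg_apply]
    by_cases hz : th' ξ.1.2 j τ = 0
    · rw [hz]; simp
    · refine mul_le_mul_of_nonneg_left ?_ (neg_nonneg.2 (th'_np _ hj τ))
      have hτ : τ ∈ Ioo t ξ.1.2 := by
        constructor
        · by_contra h'; exact hz (th'_far _ hj ((not_lt.1 h').trans htj))
        · by_contra h'; exact hz (C.z' _ (by linarith [not_lt.1 h']))
      have := hts hτ
      rw [Real.norm_eq_abs, abs_sub_comm]
      exact (le_of_lt this)
  · rw [integral_mul_const]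
    simp only [Pi.neg_apply]
    rw [integral_neg, tm]; linarith

/-- limit lemma: nonnegative increasing-type approximations -/
lemma lim_id {f : ℕ → Q m → ℝ} {g w : Q m → ℝ} {L L' C : ℝ} (h0 : ∀ k q, 0 ≤ f k q) (hi : ∀ k, Integrable (f k))
    (hl : ∀ q, Tendsto (fun k => f k q) atTop (𝓝 (g q))) (hle : ∀ k q, f k q ≤ g q)
    (hL : Tendsto (fun k => ∫ q, f k q) atTop (𝓝 L)) (hw : Continuous w) (hC : ∀ q, g q ≠ 0 → |w q| ≤ C)
    (hL' : Tendsto (fun k => ∫ q, w q * f k q) atTop (𝓝 L')) : Integrable g ∧ ∫ q, w q * g q = L' := by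
  have hg : Integrable g := by
    refine ⟨aestronglyMeasurable_of_tendsto_ae _ (fun k => (hi k).aestronglyMeasurable) (Eventually.of_forall hl), ?_⟩
    have e : ∫⁻ x, ‖g x‖ₑ ≤ liminf (fun n => ∫⁻ x, ‖f n x‖ₑ) atTop :=
      lintegral_congr_ae (Eventually.of_forall fun x => (hl x).enorm.liminf_eq) ▸
        (lintegral_liminf_le' fun k => (hi k).aestronglyMeasurable.aemeasurable.enorm)
    have e2 : ∀ n, ∫⁻ x, ‖f n x‖ₑ = ENNReal.ofReal (∫ x, f n x) := by
      intro n
      rw [ofReal_integral_eq_lintegral_ofReal (hi n) (Eventually.of_forall (h0 n))]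
      refine lintegral_congr fun x => ?_
      rw [Real.enorm_of_nonneg (h0 n x)]
    simp_rw [e2] at e
    have e3 : Tendsto (fun n => ENNReal.ofReal (∫ x, f n x)) atTop (𝓝 (ENNReal.ofReal L)) := ENNReal.tendsto_ofReal hL
    rw [e3.liminf_eq] at e
    exact lt_of_le_of_lt e ENNReal.ofReal_lt_top
  refine ⟨hg, tendsto_nhds_unique (tendsto_integral_of_dominated_convergence (fun q => C * g q)
    (fun k => hw.aestronglyMeasurable.mul (hi k).aestronglyMeasurable) (hg.const_mul C) (fun k => Eventually.of_forall fun q => ?_)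
    (Eventually.of_forall fun q => (hl q).const_mul _)) hL'⟩
  show ‖w q * f k q‖ ≤ _
  rw [norm_mul, Real.norm_eq_abs, Real.norm_of_nonneg (h0 k q)]
  by_cases hq : g q = 0
  · have : f k q = 0 := le_antisymm (hq ▸ hle k q) (h0 k q)
    rw [this, hq]; simp
  · exact mul_le_mul (hC q hq) (hle k q) (h0 k q) ((abs_nonneg _).trans (hC q hq))

lemma Dg_nonneg (ξ q : Q m) : 0 ≤ Dg a ξ q := by
  unfold Dg
  have : 0 ≤ ∑ i, Gi a ξ i q ^ 2 := Finset.sum_nonneg fun _ _ => sq_nonneg _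
  positivity

lemma reg_one : Reg (fun _ : Q m => (1 : ℝ)) (fun _ _ => 0) (fun _ _ => 0) :=
  ⟨fun d q _ => by simpa [HasLineDerivAt] using hasDerivAt_const (0 : ℝ) (1 : ℝ),
    fun d q _ => by simpa [HasLineDerivAt] using hasDerivAt_const (0 : ℝ) (0 : ℝ),
    continuous_const, fun _ => continuousOn_const, fun _ => continuousOn_const⟩

section core
variable (h1 : -1 < a) (h2 : a < 1) (ξ : Q m) {w : Q m → ℝ} {w1 w2 : Q m → Q m → ℝ}

lemma pre_core (h1 : -1 < a) (h2 : a < 1) (ξ : Q m) {w : Q m → ℝ} {w1 w2 : Q m → Q m → ℝ} (hw : Reg w w1 w2)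
    (hf : ∀ p : P m, ∃ L, Tendsto (fun y => |y| ^ a * w1 ey (p, y)) (𝓝[>] 0) (𝓝 L) ∧
      Tendsto (fun y => |y| ^ a * w1 ey (p, y)) (𝓝[<] 0) (𝓝 L))
    {U : Set (Q m)} (hU : IsOpen U) {h : ℝ → ℝ} {c M : ℝ} (p : Prof h c M)
    (hKU : {q | c ≤ Gk a ξ q} ⊆ U) (hL : ∀ q ∈ U, q ∈ Om m → Lop a w1 w2 q = 0) :
    Tendsto (fun k : ℕ => ∫ q, w q * (th ξ.1.2 (k + 1) q.1.2 * (h (Gk a ξ q) * Dg a ξ q))) atTop (𝓝 (H1 h M * w ξ)) := by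
  refine (time_lim h1 h2 ξ p hw.c).congr fun k => ?_
  have hj : (0 : ℝ) < (k : ℝ) + 1 := by positivity
  have : 0 < 1 / (2 * ((k : ℝ) + 1)) := by positivity
  exact (cut_identity h1 h2 ξ p (by linarith) (th_cut ξ.1.2 hj) hw hf hU hKU hL).symm

lemma core (h1 : -1 < a) (h2 : a < 1) (ξ : Q m) {w : Q m → ℝ} {w1 w2 : Q m → Q m → ℝ} (hw : Reg w w1 w2)
    (hf : ∀ p : P m, ∃ L, Tendsto (fun y => |y| ^ a * w1 ey (p, y)) (𝓝[>] 0) (𝓝 L) ∧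
      Tendsto (fun y => |y| ^ a * w1 ey (p, y)) (𝓝[<] 0) (𝓝 L))
    {U : Set (Q m)} (hU : IsOpen U) {h : ℝ → ℝ} {c M : ℝ} (p : Prof h c M)
    (hKU : {q | c ≤ Gk a ξ q} ⊆ U) (hL : ∀ q ∈ U, q ∈ Om m → Lop a w1 w2 q = 0) :
    Integrable (fun q => h (Gk a ξ q) * Dg a ξ q) ∧ ∫ q, w q * (h (Gk a ξ q) * Dg a ξ q) = H1 h M * w ξ := by
  obtain ⟨C, hC0, hC⟩ := w_bdd h1 h2 ξ p.c0 hw.c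
  have hone := pre_core h1 h2 ξ (reg_one (m := m)) (fun p => ⟨0, by simp, by simp⟩) isOpen_univ p (subset_univ _)
    (fun q _ _ => by simp [Lop])
  simp only [one_mul, mul_one] at hone
  have hnn : ∀ q, 0 ≤ h (Gk a ξ q) * Dg a ξ q := fun q => mul_nonneg (p.h0 _) (Dg_nonneg ξ q)
  refine lim_id (C := C) (fun k q => mul_nonneg (th_nn _ _ _) (hnn q)) (fun k => ?_) (fun q => ?_) (fun k q => ?_) hone hw.c (fun q hq => ?_)
    (pre_core h1 h2 ξ hw hf hU p hKU hL)
  · have hj : (0 : ℝ) < (k : ℝ) + 1 := by positivity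
    have : 0 < 1 / (2 * ((k : ℝ) + 1)) := by positivity
    simpa using (cut_integrable h1 h2 ξ p (by linarith) (th_cut ξ.1.2 hj) (continuous_const (y := (1 : ℝ)))).1
  · rcases lt_or_ge q.1.2 ξ.1.2 with hq | hq
    · simpa using (th_lim ξ.1.2 hq).mul_const (h (Gk a ξ q) * Dg a ξ q)
    · rw [Gk_zero ξ q hq, p.zc 0 p.c0.le]; simp
  · exact mul_le_of_le_one_left (hnn q) (th_le _ _ _)
  · refine hC q (lt_of_not_ge fun h' => hq ?_)
    rw [p.zc _ h', zero_mul]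
end core

/-- approximating profiles -/
def clip (x : ℝ) : ℝ := max 0 (min 1 x)
lemma clip_c : Continuous clip := by unfold clip; fun_prop
lemma clip_nn (x : ℝ) : 0 ≤ clip x := le_max_left _ _
lemma clip_le (x : ℝ) : clip x ≤ 1 := max_le zero_le_one (min_le_left _ _)
lemma clip_z {x : ℝ} (hx : x ≤ 0) : clip x = 0 := max_eq_left ((min_le_right _ _).trans hx)
lemma clip_1 {x : ℝ} (hx : 1 ≤ x) : clip x = 1 := by unfold clip; rw [min_eq_left hx]; simp

def hk (c : ℝ) (k : ℕ) (v : ℝ) : ℝ := c / (max v c) ^ 2 * (clip ((k + 1) * (v - c) - 1) * clip (c + k + 1 - v))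
def hl (c : ℝ) (v : ℝ) : ℝ := if c < v then c / v ^ 2 else 0

section hk
variable {c : ℝ} (hc : 0 < c)

lemma hk_prof {c : ℝ} (hc : 0 < c) (k : ℕ) : Prof (hk c k) (c + 1 / ((k : ℝ) + 1)) (c + k + 1) := by
  have hk0 : (0 : ℝ) < (k : ℝ) + 1 := by positivity
  have hmx : ∀ v, 0 < max v c := fun v => lt_max_of_lt_right hc
  refine ⟨?_, fun v => ?_, by positivity, ?_, fun v hv => ?_, fun v hv => ?_⟩
  · unfold hk
    have := clip_c
    refine (continuous_const.div (by fun_prop) (fun v => (pow_pos (hmx v) 2).ne')).mul ((clip_c.comp (by fun_prop)).mul (clip_c.comp (by fun_prop)))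
  · unfold hk
    have := clip_nn; have := hmx v
    exact mul_nonneg (by positivity) (mul_nonneg (clip_nn _) (clip_nn _))
  · have : 1 / ((k : ℝ) + 1) ≤ 1 := by
      rw [div_le_one hk0]; linarith [(Nat.cast_nonneg k : (0 : ℝ) ≤ k)]
    linarith [(Nat.cast_nonneg k : (0 : ℝ) ≤ k)]
  · unfold hk
    rw [clip_z (x := (k + 1) * (v - c) - 1)]
    · ring
    · have : ((k : ℝ) + 1) * (v - c) ≤ (k + 1) * (1 / (k + 1)) := by gcongr; linarith
      rw [mul_one_div_cancel hk0.ne'] at this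
      linarith
  · unfold hk
    rw [clip_z (x := c + k + 1 - v) (by linarith)]; ring

lemma hl_nn {c : ℝ} (hc : 0 < c) (v : ℝ) : 0 ≤ hl c v := by
  unfold hl; split_ifs <;> positivity

lemma hk_le {c : ℝ} (hc : 0 < c) (k : ℕ) (v : ℝ) : hk c k v ≤ hl c v := by
  rcases lt_or_ge c v with h | h
  · unfold hk hl
    rw [if_pos h, max_eq_left h.le]
    exact mul_le_of_le_one_right (by positivity) (mul_le_one₀ (clip_le _) (clip_nn _) (clip_le _))
  · rw [(hk_prof hc k).zc v (by have : 0 < 1 / ((k : ℝ) + 1) := by positivity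
                                linarith)]
    exact hl_nn hc v

lemma hk_lim {c : ℝ} (hc : 0 < c) (v : ℝ) : Tendsto (fun k => hk c k v) atTop (𝓝 (hl c v)) := by
  rcases lt_or_ge c v with h | h
  · refine tendsto_const_nhds.congr' ?_
    obtain ⟨n, hn⟩ := exists_nat_gt (2 / (v - c) + v)
    filter_upwards [eventually_ge_atTop n] with k hk1
    have hnk : (n : ℝ) ≤ k := by exact_mod_cast hk1
    have h0 : 0 < v - c := sub_pos.2 h
    have h3 : 2 / (v - c) < (k : ℝ) + 1 := by linarith
    rw [div_lt_iff₀ h0] at h3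
    have h4 : 0 < 2 / (v - c) := by positivity
    unfold hk hl
    rw [if_pos h, max_eq_left h.le, clip_1 (by linarith), clip_1 (by linarith), mul_one, mul_one]
  · refine tendsto_const_nhds.congr fun k => ?_
    rw [(hk_prof hc k).zc v (by have : 0 < 1 / ((k : ℝ) + 1) := by positivity
                                linarith)]
    unfold hl; rw [if_neg (not_lt.2 h)]

lemma kappa_lim {c : ℝ} (hc : 0 < c) : Tendsto (fun k : ℕ => H1 (hk c k) (c + k + 1)) atTop (𝓝 1) := by
  have e : hl c = (Ioi c).indicator (fun v => c * v ^ (-2 : ℝ)) := by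
    funext v
    unfold hl indicator
    by_cases h : c < v
    · rw [if_pos h, if_pos (by exact h)]
      show c / v ^ 2 = c * v ^ (-2 : ℝ)
      rw [Real.rpow_neg (hc.trans h).le, div_eq_mul_inv]; norm_cast
    · rw [if_neg h, if_neg (by exact h)]
  have i1 : Integrable (hl c) := by
    rw [e, integrable_indicator_iff measurableSet_Ioi]
    exact (integrableOn_Ioi_rpow_of_lt (by norm_num) hc).const_mul c
  have e1 : ∫ v, hl c v = 1 := by
    rw [e, integral_indicator measurableSet_Ioi, integral_const_mul, integral_Ioi_rpow_of_lt (by norm_num) hc]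
    norm_num
    rw [Real.rpow_neg_one]; field_simp
  have : (fun k : ℕ => H1 (hk c k) (c + k + 1)) = fun k => ∫ v, hk c k v := by
    funext k; exact (hk_prof hc k).kappa
  rw [this, ← e1]
  refine tendsto_integral_of_dominated_convergence (hl c) (fun k => (hk_prof hc k).hc.aestronglyMeasurable) i1
    (fun k => Eventually.of_forall fun v => ?_) (Eventually.of_forall fun v => hk_lim hc v)
  rw [Real.norm_of_nonneg ((hk_prof hc k).h0 v)]
  exact hk_le hc k v
end hk

/-- mean value formula in split coordinates -/
theorem mean_value_split (h1 : -1 < a) (h2 : a < 1) (ξ : Q m) {w : Q m → ℝ} {w1 w2 : Q m → Q m → ℝ} (hw : Reg w w1 w2)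
    (hf : ∀ p : P m, ∃ L, Tendsto (fun y => |y| ^ a * w1 ey (p, y)) (𝓝[>] 0) (𝓝 L) ∧
      Tendsto (fun y => |y| ^ a * w1 ey (p, y)) (𝓝[<] 0) (𝓝 L))
    {U : Set (Q m)} (hU : IsOpen U) {c : ℝ} (hc : 0 < c)
    (hKU : {q | c < Gk a ξ q} ⊆ U) (hL : ∀ q ∈ U, q ∈ Om m → Lop a w1 w2 q = 0) :
    ∫ q, w q * (hl c (Gk a ξ q) * Dg a ξ q) = w ξ := by
  obtain ⟨C, hC0, hC⟩ := w_bdd h1 h2 ξ hc hw.c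
  have hpos : ∀ k : ℕ, 0 < 1 / ((k : ℝ) + 1) := fun k => by positivity
  have A := fun k => core h1 h2 ξ hw hf hU (hk_prof hc k) (fun q hq => hKU (show c < Gk a ξ q from lt_of_lt_of_le (lt_add_of_pos_right c (hpos k)) hq)) hL
  have B := fun k => core h1 h2 ξ (reg_one (m := m)) (fun p => ⟨0, by simp, by simp⟩) isOpen_univ (hk_prof hc k) (subset_univ _)
    (fun q _ _ => by simp [Lop])
  have kl := kappa_lim hc
  refine (lim_id (C := C) (L := 1) (f := fun k q => hk c k (Gk a ξ q) * Dg a ξ q) (fun k q => mul_nonneg ((hk_prof hc k).h0 _) (Dg_nonneg ξ q)) (fun k => (A k).1)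
    (fun q => (hk_lim hc _).mul_const _) (fun k q => mul_le_mul_of_nonneg_right (hk_le hc k _) (Dg_nonneg ξ q)) ?_ hw.c (fun q hq => ?_) ?_).2
  · refine kl.congr fun k => ?_
    have := (B k).2
    simp only [one_mul, mul_one] at this
    exact this.symm
  · refine hC q ?_
    by_contra h'
    apply hq
    unfold hl; rw [if_neg h', zero_mul]
  · have := kl.mul_const (w ξ)
    rw [one_mul] at this
    exact this.congr fun k => (A k).2.symm
end MV
end

noncomputable section
open Real MeasureTheory Set Filter Topology
namespace MV
variable {m : ℕ} {a : ℝ}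

/-- the linear change of coordinates -/
def SL (m : ℕ) : Q m →ₗ[ℝ] (Fin (m + 1) → ℝ) × ℝ where
  toFun q := (Fin.snoc (α := fun _ => ℝ) q.1.1 q.2, q.1.2)
  map_add' p q := by
    refine Prod.ext ?_ rfl
    funext i
    refine Fin.lastCases ?_ (fun j => ?_) i <;> simp
  map_smul' c q := by
    refine Prod.ext ?_ rfl
    funext i
    refine Fin.lastCases ?_ (fun j => ?_) i <;> simp

lemma SL_apply (q : Q m) : SL m q = (Fin.snoc (α := fun _ => ℝ) q.1.1 q.2, q.1.2) := rfl

lemma SL_di (i : Fin m) : SL m (di i, 0) = (Pi.single i.castSucc 1, 0) := by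
  refine Prod.ext ?_ rfl
  funext j
  refine Fin.lastCases ?_ (fun j => ?_) j
  · simp [SL_apply, Pi.single_apply]
  · simp [SL_apply, Pi.single_apply, di]

lemma SL_ey : SL m ey = (Pi.single (Fin.last m) 1, 0) := by
  refine Prod.ext ?_ rfl
  funext j
  refine Fin.lastCases ?_ (fun j => ?_) j
  · simp [SL_apply, ey]
  · simp [SL_apply, ey, Pi.single_apply]

lemma SL_dt : SL m (dt, 0) = (0, 1) := by
  refine Prod.ext ?_ rfl
  funext j
  refine Fin.lastCases ?_ (fun j => ?_) j
  · simp [SL_apply, dt]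
  · simp [SL_apply, dt]

lemma SL_contDiff : ContDiff ℝ 2 (SL m) := (LinearMap.toContinuousLinearMap (SL m)).contDiff
lemma SL_cont : Continuous (SL m) := LinearMap.continuous_of_finiteDimensional _

lemma pd_of {n : ℕ} {i : Fin n} {f : (Fin n → ℝ) → ℝ} {X : Fin n → ℝ} {v : ℝ}
    (h : HasDerivAt (fun t : ℝ => f (X + t • Pi.single i 1)) v 0) : pd i f X = v := by
  unfold pd
  refine HasDerivAt.deriv ?_
  have h2 : HasDerivAt (fun s : ℝ => s - X i) 1 (X i) := (hasDerivAt_id _).sub_const _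
  have h3 := HasDerivAt.comp (X i) (h₂ := fun t : ℝ => f (X + t • Pi.single i 1)) (h := fun s : ℝ => s - X i)
    (by simpa using h) h2
  rw [mul_one] at h3
  refine h3.congr_of_eventuallyEq (Eventually.of_forall fun s => ?_)
  simp only [Function.comp]
  congr 1
  funext j
  by_cases hj : j = i
  · subst hj; simp
  · simp [hj]

section w
variable {u : (Fin (m + 1) → ℝ) → ℝ → ℝ}

/-- pulled back function -/
def wu (u : (Fin (m + 1) → ℝ) → ℝ → ℝ) (q : Q m) : ℝ := u (SL m q).1 (SL m q).2

lemma wu_cd (hu : memHa a m u) (q : Q m) (hq : q ∈ Om m) : ContDiffAt ℝ 2 (wu u) q := by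
  have h := hu.2.1 (SL m q).1 (SL m q).2 (by simpa [SL_apply] using (show q.2 ≠ 0 from hq))
  exact ContDiffAt.comp q (g := fun p : (Fin (m + 1) → ℝ) × ℝ => u p.1 p.2) (f := SL m) h SL_contDiff.contDiffAt

lemma wu_d2 (hu : memHa a m u) (q : Q m) (hq : q ∈ Om m) (d : Q m) :
    ContDiffAt ℝ 1 (fun q => fderiv ℝ (wu u) q d) q :=
  ((wu_cd hu q hq).fderiv_right (m := 1) (by norm_num)).clm_apply contDiffAt_const

lemma wu_reg (hu : memHa a m u) :
    Reg (wu u) (fun d q => fderiv ℝ (wu u) q d) (fun d q => fderiv ℝ (fun q => fderiv ℝ (wu u) q d) q d) where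
  h1 d q hq := ((wu_cd hu q hq).differentiableAt (by norm_num)).hasFDerivAt.hasLineDerivAt d
  h2 d q hq := ((wu_d2 hu q hq d).differentiableAt (by norm_num)).hasFDerivAt.hasLineDerivAt d
  c := hu.1.comp SL_cont
  c1 d q hq := (wu_d2 hu q hq d).continuousAt.continuousWithinAt
  c2 d q hq := by
    have h : ContDiffAt ℝ 0 (fun q => fderiv ℝ (fun q => fderiv ℝ (wu u) q d) q d) q :=
      ((wu_d2 hu q hq d).fderiv_right (m := 0) (by norm_num)).clm_apply contDiffAt_const
    exact h.continuousAt.continuousWithinAt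

lemma wu_pd (hu : memHa a m u) (q : Q m) (hq : q ∈ Om m) {i : Fin (m + 1)} {D : Q m} (hD : SL m D = (Pi.single i 1, 0)) :
    pd i (fun Z => u Z (SL m q).2) (SL m q).1 = fderiv ℝ (wu u) q D := by
  refine pd_of ?_
  have := (wu_reg hu).h1 D q hq
  unfold HasLineDerivAt at this
  refine this.congr_of_eventuallyEq (Eventually.of_forall fun t => ?_)
  simp [wu, map_add, map_smul, hD]

lemma wu_pd2 (hu : memHa a m u) (q : Q m) (hq : q ∈ Om m) {i : Fin (m + 1)} {D : Q m} (hD : SL m D = (Pi.single i 1, 0)) :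
    pd i (pd i (fun Z => u Z (SL m q).2)) (SL m q).1 = fderiv ℝ (fun q => fderiv ℝ (wu u) q D) q D := by
  refine pd_of ?_
  have := (wu_reg hu).h2 D q hq
  unfold HasLineDerivAt at this
  refine this.congr_of_eventuallyEq ?_
  have hc : ContinuousAt (fun t : ℝ => q + t • D) 0 := by fun_prop
  have := hc.preimage_mem_nhds (Om_open.mem_nhds (by simpa using hq))
  filter_upwards [this] with t ht
  have h := wu_pd hu (q + t • D) ht hD
  rw [map_add, map_smul, hD] at h
  simpa using h

lemma wu_dt (hu : memHa a m u) (q : Q m) (hq : q ∈ Om m) :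
    deriv (fun s => u (SL m q).1 s) (SL m q).2 = fderiv ℝ (wu u) q (dt, 0) := by
  refine HasDerivAt.deriv ?_
  have h := (wu_reg hu).h1 (dt, 0) q hq
  unfold HasLineDerivAt at h
  have h2 : HasDerivAt (fun s : ℝ => s - (SL m q).2) 1 (SL m q).2 := (hasDerivAt_id _).sub_const _
  have h3 := HasDerivAt.comp (SL m q).2 (h₂ := fun t : ℝ => wu u (q + t • (dt, 0))) (h := fun s : ℝ => s - (SL m q).2)
    (by simpa using h) h2
  rw [mul_one] at h3
  refine h3.congr_of_eventuallyEq (Eventually.of_forall fun s => ?_)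
  simp only [Function.comp, wu]
  rw [map_add, map_smul, SL_dt]
  simp

lemma wu_flux (hu : memHa a m u) (p : P m) : ∃ L, Tendsto (fun y => |y| ^ a * fderiv ℝ (wu u) (p, y) ey) (𝓝[>] 0) (𝓝 L) ∧
      Tendsto (fun y => |y| ^ a * fderiv ℝ (wu u) (p, y) ey) (𝓝[<] 0) (𝓝 L) := by
  obtain ⟨L, hL1, hL2⟩ := hu.2.2 (SL m (p, 0)).1 p.2
  have e : ∀ y : ℝ, y ≠ 0 → pd (Fin.last m) (fun Z => u Z p.2) (Function.update (SL m (p, 0)).1 (Fin.last m) y)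
      = fderiv ℝ (wu u) (p, y) ey := by
    intro y hy
    rw [← wu_pd hu (p, y) hy SL_ey]
    simp [SL_apply, Fin.update_snoc_last]
  refine ⟨L, hL1.congr' ?_, hL2.congr' ?_⟩
  · filter_upwards [self_mem_nhdsWithin] with y hy
    rw [e y (ne_of_gt hy)]
  · filter_upwards [self_mem_nhdsWithin] with y hy
    rw [e y (ne_of_lt hy)]

lemma wu_L (hu : memHa a m u) (q : Q m) (hq : q ∈ Om m)
    (h : deriv (fun s => u (SL m q).1 s) (SL m q).2 - (∑ i, pd i (pd i (fun Z => u Z (SL m q).2)) (SL m q).1) -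
        a / (SL m q).1 (Fin.last m) * pd (Fin.last m) (fun Z => u Z (SL m q).2) (SL m q).1 = 0) :
    Lop a (fun d q => fderiv ℝ (wu u) q d) (fun d q => fderiv ℝ (fun q => fderiv ℝ (wu u) q d) q d) q = 0 := by
  rw [Fin.sum_univ_castSucc, wu_dt hu q hq, wu_pd hu q hq SL_ey, wu_pd2 hu q hq SL_ey,
    Finset.sum_congr rfl fun i _ => wu_pd2 hu q hq (SL_di i)] at h
  have e : (SL m q).1 (Fin.last m) = q.2 := by simp [SL_apply]
  rw [e] at h
  unfold Lop
  linarith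
end w
end MV
end

noncomputable section
open Real MeasureTheory Set Filter Topology
namespace MV
variable {m : ℕ} {a : ℝ}

lemma SL_inj : Function.Injective (SL m) := by
  intro p q h
  rw [SL_apply, SL_apply, Prod.mk.injEq] at h
  obtain ⟨h1, h2⟩ := h
  refine Prod.ext (Prod.ext (funext fun i => ?_) h2) ?_
  · simpa using congrFun h1 i.castSucc
  · simpa using congrFun h1 (Fin.last m)

lemma SL_emb : MeasurableEmbedding (SL m) := SL_cont.measurableEmbedding SL_inj

lemma SL_mp : MeasurePreserving (SL m) volume volume := by
  have s1 : MeasurePreserving (MeasurableEquiv.prodAssoc : ((Fin m → ℝ) × ℝ) × ℝ ≃ᵐ _) volume volume := volume_preserving_prodAssoc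
  have s2 : MeasurePreserving (Prod.map (id : (Fin m → ℝ) → (Fin m → ℝ)) (Prod.swap : ℝ × ℝ → ℝ × ℝ)) volume volume :=
    (MeasurePreserving.id volume).prod Measure.measurePreserving_swap
  have s3 : MeasurePreserving (MeasurableEquiv.prodAssoc : ((Fin m → ℝ) × ℝ) × ℝ ≃ᵐ _).symm volume volume := s1.symm
  have s4 : MeasurePreserving (Prod.map (Prod.swap : (Fin m → ℝ) × ℝ → _) (id : ℝ → ℝ)) volume volume :=
    Measure.measurePreserving_swap.prod (MeasurePreserving.id volume)
  have s5 : MeasurePreserving (Prod.map (MeasurableEquiv.piFinSuccAbove (fun _ : Fin (m + 1) => ℝ) (Fin.last m)).symm (id : ℝ → ℝ)) volume volume :=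
    (volume_preserving_piFinSuccAbove (fun _ : Fin (m + 1) => ℝ) (Fin.last m)).symm.prod (MeasurePreserving.id volume)
  have := s5.comp (s4.comp (s3.comp (s2.comp s1)))
  convert this using 1
  funext q
  refine Prod.ext ?_ rfl
  show Fin.snoc (α := fun _ => ℝ) q.1.1 q.2 = Fin.insertNth (Fin.last m) q.2 q.1.1
  rw [Fin.insertNth_last]
  rfl

lemma Om_ae : ∀ᵐ q : Q m, q.2 ≠ 0 := by
  have : (volume : Measure ℝ) {0} = 0 := by simp
  have h : (volume : Measure (Q m)) (Prod.snd ⁻¹' {0}) = 0 :=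
    (Measure.quasiMeasurePreserving_snd (μ := (volume : Measure (P m))) (ν := (volume : Measure ℝ))).preimage_null this
  rw [ae_iff]
  refine measure_mono_null (fun q hq => ?_) h
  simpa using hq

/-- base point -/
def xi (X : Fin (m + 1) → ℝ) (t : ℝ) : Q m := ((Fin.init X, t), X (Fin.last m))

lemma SL_xi (X : Fin (m + 1) → ℝ) (t : ℝ) : SL m (xi X t) = (X, t) := by
  rw [SL_apply]; simp [xi]

lemma Gk_xi (X : Fin (m + 1) → ℝ) (t : ℝ) (q : Q m) : Gk a (xi X t) q = GammaFS a m X t (SL m q).1 (SL m q).2 := by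
  unfold Gk
  rw [SL_apply]; simp [xi]

lemma G_pd {X : Fin (m + 1) → ℝ} {t : ℝ} {q : Q m} {i : Fin (m + 1)} {D : Q m} (hD : SL m D = (Pi.single i 1, 0)) {v : ℝ}
    (h : HasDerivAt (fun s : ℝ => Gk a (xi X t) (q + s • D)) v 0) :
    pd i (fun Y => GammaFS a m X t Y (SL m q).2) (SL m q).1 = v := by
  refine pd_of ?_
  refine h.congr_of_eventuallyEq (Eventually.of_forall fun s => ?_)
  simp [Gk_xi, map_add, map_smul, hD]

lemma sum_pd (h1 : -1 < a) (h2 : a < 1) {X : Fin (m + 1) → ℝ} {t : ℝ} {q : Q m} (hq : q.1.2 < t) (hy : q.2 ≠ 0) :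
    |q.2| ^ a * (∑ i, (pd i (fun Y => GammaFS a m X t Y (SL m q).2) (SL m q).1) ^ 2) = Dg a (xi X t) q := by
  rw [Fin.sum_univ_castSucc]
  have e1 : ∀ i : Fin m, pd i.castSucc (fun Y => GammaFS a m X t Y (SL m q).2) (SL m q).1 = Gi a (xi X t) i q := by
    intro i
    refine G_pd (SL_di i) ?_
    have := Gk_line h1 h2 (xi X t) q hq i
    unfold HasLineDerivAt at this
    refine this.congr_of_eventuallyEq (Eventually.of_forall fun s => ?_)
    show Gk a (xi X t) _ = Gk a (xi X t) _
    congr 1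
    refine Prod.ext rfl ?_
    simp
  have e2 : pd (Fin.last m) (fun Y => GammaFS a m X t Y (SL m q).2) (SL m q).1 = |q.2| ^ (-a) * Gq a (xi X t) q := by
    refine G_pd SL_ey ?_
    have h := Gk_deriv_y h1 h2 (xi X t) q hq hy
    have h' : HasDerivAt (fun s : ℝ => q.2 + s) 1 0 := by simpa using (hasDerivAt_id (0:ℝ)).const_add q.2
    have h3 := HasDerivAt.comp (0 : ℝ) (h₂ := fun y => Gk a (xi X t) (q.1, y)) (h := fun s : ℝ => q.2 + s) (by simpa using h) h'
    rw [mul_one] at h3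
    refine h3.congr_of_eventuallyEq (Eventually.of_forall fun s => ?_)
    show Gk a (xi X t) _ = Gk a (xi X t) _
    congr 1
    refine Prod.ext ?_ ?_ <;> simp [ey]
  rw [Finset.sum_congr rfl fun i _ => by rw [e1 i], e2]
  unfold Dg
  have := abs_rpow_mul_neg a hy
  linear_combination (|q.2| ^ (-a) * Gq a (xi X t) q ^ 2) * this

theorem final (ha₁ : -1 < a) (ha₂ : a < 1)
    (X₀ : Fin (m + 1) → ℝ) (t₀ r : ℝ) (hr : 0 < r)
    (u : (Fin (m + 1) → ℝ) → ℝ → ℝ) (hu : memHa a m u)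
    (U : Set ((Fin (m + 1) → ℝ) × ℝ)) (hU : IsOpen U)
    (hUcl : closure (pball a m X₀ t₀ r) ⊆ U)
    (hpar : ∀ ζ ∈ U, ζ.1 (Fin.last m) ≠ 0 →
      deriv (fun s => u ζ.1 s) ζ.2 - (∑ i, pd i (pd i (fun Z => u Z ζ.2)) ζ.1) -
        a / ζ.1 (Fin.last m) * pd (Fin.last m) (fun Z => u Z ζ.2) ζ.1 = 0) :
    u X₀ t₀ = mval a m u X₀ t₀ r := by
  set c := (phiw a m (X₀ (Fin.last m)) r)⁻¹ with hcdef
  have hc : 0 < c := by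
    rw [hcdef]
    unfold phiw
    have : 0 < 1 + X₀ (Fin.last m) ^ 2 / r := by positivity
    positivity
  have hpb : ∀ q : Q m, SL m q ∈ pball a m X₀ t₀ r ↔ c < Gk a (xi X₀ t₀) q := fun q => by rw [Gk_xi]; rfl
  have key := mean_value_split ha₁ ha₂ (xi X₀ t₀) (wu_reg hu) (wu_flux hu) (hU.preimage SL_cont) hc
    (fun q hq => hUcl (subset_closure ((hpb q).2 hq)))
    (fun q hq hy => wu_L hu q hy (hpar _ hq (by simpa [SL_apply] using (show q.2 ≠ 0 from hy))))
  have e0 : wu u (xi X₀ t₀) = u X₀ t₀ := by unfold wu; rw [SL_xi]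
  rw [← e0, ← key]
  unfold mval
  rw [← hcdef, ← SL_mp.setIntegral_preimage_emb SL_emb, ← integral_const_mul]
  have hms : MeasurableSet (SL m ⁻¹' pball a m X₀ t₀ r) := by
    have e : SL m ⁻¹' pball a m X₀ t₀ r = {q : Q m | q.1.2 < t₀} ∩ (fun q => Gk a (xi X₀ t₀) q) ⁻¹' Ioi c := by
      ext q
      rw [mem_preimage, hpb]
      refine ⟨fun h => ⟨?_, h⟩, fun h => h.2⟩
      by_contra h'
      rw [Gk_zero (xi X₀ t₀) q (not_lt.1 (show ¬ q.1.2 < t₀ from h'))] at h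
      exact absurd h (not_lt.2 hc.le)
    rw [e]
    exact ((Gk_cont ha₁ ha₂ (xi X₀ t₀)).isOpen_inter_preimage (isOpen_lt (by fun_prop) continuous_const) isOpen_Ioi).measurableSet
  rw [← integral_indicator hms]
  refine integral_congr_ae ?_
  filter_upwards [Om_ae] with q hy
  by_cases hq : c < Gk a (xi X₀ t₀) q
  · rw [indicator_of_mem (show q ∈ _ from (hpb q).2 hq)]
    have hτ : q.1.2 < t₀ := by
      by_contra h'
      rw [Gk_zero _ _ (not_lt.1 h')] at hq
      exact absurd hq (not_lt.2 hc.le)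
    have e : (SL m q).1 (Fin.last m) = q.2 := by simp [SL_apply]
    unfold hl
    rw [if_pos hq, ← sum_pd ha₁ ha₂ hτ hy, e, Gk_xi]
    unfold wu
    ring
  · rw [indicator_of_notMem (show q ∉ _ from fun h => hq ((hpb q).1 h))]
    unfold hl
    rw [if_neg hq]; simp
end MV
end

/-- Mean value formula: if `u ∈ 𝓗_a` is `𝓛_a`-parabolic (here: a classical solution of
`∂_t u - Δ_Y u - (a/y) ∂_y u = 0` away from `{y = 0}`) on an open set containing the closure
of the parabolic ball `Ω_r(ξ₀)`, then
`u(ξ₀) = φ(r)⁻¹ ∫_{Ω_r(ξ₀)} u |y|^a |∇_Y Γ(ξ₀;·)|²/Γ(ξ₀;·)² dY dt`. -/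
theorem mean_value_formula (a : ℝ) (ha₁ : -1 < a) (ha₂ : a < 1) (m : ℕ) (hm : 1 ≤ m)
    (X₀ : Fin (m + 1) → ℝ) (t₀ r : ℝ) (hr : 0 < r)
    (u : (Fin (m + 1) → ℝ) → ℝ → ℝ) (hu : memHa a m u)
    (U : Set ((Fin (m + 1) → ℝ) × ℝ)) (hU : IsOpen U)
    (hUcl : closure (pball a m X₀ t₀ r) ⊆ U)
    (hpar : ∀ ζ ∈ U, ζ.1 (Fin.last m) ≠ 0 →
      deriv (fun s => u ζ.1 s) ζ.2 - (∑ i, pd i (pd i (fun Z => u Z ζ.2)) ζ.1) -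
        a / ζ.1 (Fin.last m) * pd (Fin.last m) (fun Z => u Z ζ.2) ζ.1 = 0) :
    u X₀ t₀ = mval a m u X₀ t₀ r := by
  exact MV.final ha₁ ha₂ X₀ t₀ r hr u hu U hU hUcl hpar
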